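/- For every r > 0, the expected volume of the intersection of a fixed oloid Ω_r and a uniformly moving congruent oloid in hitting position satisfies ( ∫_{SO(3)} ∫_{ℝ³} vol(Ω_r ∩ (θ·Ω_r + x)) dλ(x) dν(θ) ) / ( ∫_{SO(3)} λ{ x : Ω_r ∩ (θ·Ω_r + x) ≠ ∅ } dν(θ) ) = 4·[2E(√3/2) + K(√3/2)]²·r³ / ( 3·[ 9π² + 8E(√3/2) + 22K(√3/2) − 24I ] ). -/

import Mathlib

open MeasureTheory Real Pointwise

noncomputable section

/-- The circle `k_A = {(x,y,z) : x² + (y+1/2)² = 1 ∧ z = 0}`. -/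
def kA : Set (EuclideanSpace ℝ (Fin 3)) :=
  {p | p 0 ^ 2 + (p 1 + 1/2) ^ 2 = 1 ∧ p 2 = 0}

/-- The circle `k_B = {(x,y,z) : (y−1/2)² + z² = 1 ∧ x = 0}`. -/
def kB : Set (EuclideanSpace ℝ (Fin 3)) :=
  {p | (p 1 - 1/2) ^ 2 + p 2 ^ 2 = 1 ∧ p 0 = 0}

/-- The oloid `Ω₁`: the convex hull of `k_A ∪ k_B`. -/
def oloid : Set (EuclideanSpace ℝ (Fin 3)) := convexHull ℝ (kA ∪ kB)

/-- The scaled oloid `Ω_r = r • Ω₁`. -/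
def oloidR (r : ℝ) : Set (EuclideanSpace ℝ (Fin 3)) := r • oloid

/-- Complete elliptic integral of the first kind `K(k)`. -/
def ellipticK (k : ℝ) : ℝ := ∫ x in (0:ℝ)..(π/2), 1 / Real.sqrt (1 - k^2 * Real.sin x ^ 2)

/-- Complete elliptic integral of the second kind `E(k)`. -/
def ellipticE (k : ℝ) : ℝ := ∫ x in (0:ℝ)..(π/2), Real.sqrt (1 - k^2 * Real.sin x ^ 2)

/-- The constant `I = ∫₀^{π/2} arccos(cos x/(1+cos x)) dx`. -/
def constI : ℝ := ∫ x in (0:ℝ)..(π/2), Real.arccos (Real.cos x / (1 + Real.cos x))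

/-- Support function `h_C(u) = sup {⟨x,u⟩ : x ∈ C}` of a set `C ⊆ ℝ³`. -/
def suppFn (C : Set (EuclideanSpace ℝ (Fin 3))) (u : EuclideanSpace ℝ (Fin 3)) : ℝ :=
  sSup ((fun x => (inner ℝ x u : ℝ)) '' C)

/-- Mean width of `C`: `(1/(4π)) ∫_{S²} (h_C(u) + h_C(−u)) dσ(u)`, where `σ` is the
2-dimensional Hausdorff measure on the unit sphere. (For `C = ∅` this gives `0`.) -/
def meanWidth (C : Set (EuclideanSpace ℝ (Fin 3))) : ℝ :=
  (1 / (4 * π)) *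
    ∫ u in Metric.sphere (0 : EuclideanSpace ℝ (Fin 3)) 1, (suppFn C u + suppFn C (-u)) ∂μH[2]

/-- The rotation group `SO(3)` as 3×3 real orthogonal matrices of determinant 1. -/
abbrev SO3 := Matrix.specialOrthogonalGroup (Fin 3) ℝ

instance : MeasurableSpace SO3 := borel SO3

instance : BorelSpace SO3 := ⟨rfl⟩

/-- The action of a rotation `θ ∈ SO(3)` on a point of `ℝ³`. -/
def rotate (θ : SO3) (p : EuclideanSpace ℝ (Fin 3)) : EuclideanSpace ℝ (Fin 3) :=
  (EuclideanSpace.equiv (Fin 3) ℝ).symm (Matrix.mulVec θ.1 (EuclideanSpace.equiv (Fin 3) ℝ p))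

/-- `θ·S + x`: the image of `S` under the rotation `θ` followed by translation by `x`. -/
def moveSet (θ : SO3) (x : EuclideanSpace ℝ (Fin 3)) (S : Set (EuclideanSpace ℝ (Fin 3))) :
    Set (EuclideanSpace ℝ (Fin 3)) :=
  (fun p => rotate θ p + x) '' S

local notation "E3" => EuclideanSpace ℝ (Fin 3)

local notation "M3" => Matrix (Fin 3) (Fin 3) ℝ

lemma one_add_two_cos_pos {b : ℝ} (hb : b ∈ Set.Icc 0 (π/2)) : 0 < 1 + 2 * cos b := by
  have := cos_nonneg_of_neg_pi_div_two_le_of_le (by linarith [hb.1, pi_pos]) hb.2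
  linarith

lemma cos_two_arcsin {u : ℝ} (h1 : -1 ≤ u) (h2 : u ≤ 1) : cos (2 * arcsin u) = 1 - 2 * u^2 := by
  rw [cos_two_mul', cos_sq', sin_arcsin h1 h2]; ring

/-- The point at which the elliptic integrals are split. -/
def splitPt : ℝ := arcsin (√(2/3))

lemma splitPt_mem : splitPt ∈ Set.Icc 0 (π/2) :=
  ⟨arcsin_nonneg.2 (sqrt_nonneg _), arcsin_le_pi_div_two _⟩

lemma sin_splitPt : sin splitPt ^ 2 = 2/3 := by
  rw [splitPt, sin_arcsin (by linarith [sqrt_nonneg (2/3:ℝ)]) (Real.sqrt_le_one.2 (by norm_num))]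
  exact sq_sqrt (by norm_num)

lemma sin_sq_le_of_le_splitPt {x : ℝ} (h0 : 0 ≤ x) (h : x ≤ splitPt) : sin x ^ 2 ≤ 2/3 := by
  have h1 := splitPt_mem.2
  have h2 : sin x ≤ sin splitPt := sin_le_sin_of_le_of_le_pi_div_two (by linarith [pi_pos]) h1 h
  have h3 : 0 ≤ sin x := sin_nonneg_of_nonneg_of_le_pi h0 (by linarith [pi_pos])
  rw [← sin_splitPt]; gcongr

lemma le_sin_sq_of_splitPt_le {x : ℝ} (h0 : splitPt ≤ x) (h : x ≤ π/2) : 2/3 ≤ sin x ^ 2 := by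
  have h1 := splitPt_mem.1
  have h2 : sin splitPt ≤ sin x := sin_le_sin_of_le_of_le_pi_div_two (by linarith [pi_pos]) h h0
  have h3 : 0 ≤ sin splitPt := sin_nonneg_of_nonneg_of_le_pi h1 (by linarith [pi_pos, splitPt_mem.2])
  rw [← sin_splitPt]; gcongr

lemma two_arcsin_sqrt_half : 2 * arcsin (√(1/2)) = π/2 := by
  have : arcsin (√(1/2)) = π/4 := by
    rw [arcsin_eq_iff_eq_sin ⟨by linarith [pi_pos], by linarith [pi_pos]⟩, sin_pi_div_four,
      sqrt_eq_iff_mul_self_eq (by norm_num) (by positivity)]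
    nlinarith [sq_sqrt (show (0:ℝ) ≤ 2 by norm_num)]
  rw [this]; ring

lemma elliptic_first_half (w : ℝ → ℝ) (hw : Continuous w) :
    ∫ x in (0:ℝ)..splitPt, w (1 - 3/4 * sin x ^ 2) / √(1 - 3/4 * sin x ^ 2) =
    ∫ b in (0:ℝ)..(π/2), w ((1 + cos b)/2) / √(1 + 2 * cos b) := by
  set f : ℝ → ℝ := fun x => 2 * arcsin (√3/2 * sin x) with hf
  have h3 : (√3:ℝ)^2 = 3 := sq_sqrt (by norm_num)
  have h3p : (0:ℝ) < √3 := by positivity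
  have hlt : √3 < 2 := by nlinarith
  have hb : ∀ x, -1 < √3/2 * sin x ∧ √3/2 * sin x < 1 := fun x => by
    constructor <;> nlinarith [sin_le_one x, neg_one_le_sin x]
  have e0 : f 0 = 0 := by simp [hf]
  have e1 : f splitPt = π/2 := by
    simp only [hf]
    rw [← two_arcsin_sqrt_half]
    congr 2
    symm
    have : 0 ≤ sin splitPt := sin_nonneg_of_nonneg_of_le_pi splitPt_mem.1 (by linarith [pi_pos, splitPt_mem.2])
    rw [sqrt_eq_iff_mul_self_eq (by norm_num) (by positivity)]
    nlinarith [sin_splitPt]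
  have hD : ∀ x, 0 < 1 - 3/4 * sin x ^ 2 := fun x => by nlinarith [sin_sq_le_one x]
  have hder : ∀ x, HasDerivAt f (√3 * cos x / √(1 - 3/4 * sin x ^ 2)) x := fun x => by
    have := ((hasDerivAt_arcsin (hb x).1.ne' (hb x).2.ne).comp x
      ((hasDerivAt_sin x).const_mul (√3/2))).const_mul 2
    refine this.congr_deriv ?_
    have e : 1 - (√3/2 * sin x)^2 = 1 - 3/4 * sin x^2 := by rw [mul_pow, div_pow, h3]; ring
    rw [e]; ring
  have hmaps : f '' Set.uIcc 0 splitPt ⊆ Set.Icc 0 (π/2) := by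
    rw [Set.uIcc_of_le splitPt_mem.1]
    rintro _ ⟨x, hx, rfl⟩
    rw [← e0, ← e1]
    have hmono : ∀ a b, -(π/2) ≤ a → b ≤ π/2 → a ≤ b → f a ≤ f b := fun a b ha hb hab => by
      have := sin_le_sin_of_le_of_le_pi_div_two ha hb hab
      simp only [hf]; gcongr
    exact ⟨hmono _ _ (by linarith [pi_pos]) (by linarith [hx.2, splitPt_mem.2]) hx.1,
      hmono _ _ (by linarith [pi_pos, hx.1]) splitPt_mem.2 hx.2⟩
  have key := intervalIntegral.integral_comp_mul_deriv'' (a := 0) (b := splitPt) (f := f)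
    (f' := fun x => √3 * cos x / √(1 - 3/4 * sin x ^ 2))
    (g := fun b => w ((1 + cos b)/2) / √(1 + 2 * cos b))
    (fun x _ => (hder x).continuousAt.continuousWithinAt)
    (fun x _ => (hder x).hasDerivWithinAt)
    (by
      apply Continuous.continuousOn
      exact Continuous.div (by fun_prop) (by fun_prop) (fun x => (sqrt_pos.2 (hD x)).ne'))
    (by
      apply ContinuousOn.div
      · fun_prop
      · fun_prop
      · intro b hb
        exact (sqrt_pos.2 (one_add_two_cos_pos (hmaps hb))).ne')
  rw [e0, e1] at key
  rw [← key]
  apply intervalIntegral.integral_congr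
  intro x hx
  rw [Set.uIcc_of_le splitPt_mem.1] at hx
  have hc : 0 < cos x := by
    have h1 := sin_sq_le_of_le_splitPt hx.1 hx.2
    have h2 := cos_nonneg_of_neg_pi_div_two_le_of_le (by linarith [hx.1, pi_pos]) (hx.2.trans splitPt_mem.2)
    have h3 := sin_sq_add_cos_sq x
    rcases h2.lt_or_eq with h | h
    · exact h
    · rw [← h] at h3; nlinarith
  have hcf : cos (f x) = 1 - 3/2 * sin x ^ 2 := by
    simp only [hf]
    rw [cos_two_arcsin (hb x).1.le (hb x).2.le, mul_pow, div_pow, h3]; ring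
  simp only [Function.comp, hcf]
  have e2 : √(1 + 2 * (1 - 3/2 * sin x^2)) = √3 * cos x := by
    rw [sqrt_eq_iff_mul_self_eq (by nlinarith [sin_sq_le_one x]) (by positivity)]
    nlinarith [sin_sq_add_cos_sq x]
  rw [e2]
  have e3 : (1 + (1 - 3/2 * sin x^2))/2 = 1 - 3/4 * sin x^2 := by ring
  rw [e3]
  have := (sqrt_pos.2 (hD x)).ne'
  field_simp

lemma elliptic_second_half (w : ℝ → ℝ) (hw : Continuous w) :
    ∫ x in splitPt..(π/2), w (1 - 3/4 * sin x ^ 2) / √(1 - 3/4 * sin x ^ 2) =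
    ∫ b in (0:ℝ)..(π/2), w (1/(2 * (1 + cos b))) / √(1 + 2 * cos b) := by
  have hD : ∀ x, 0 < 1 - 3/4 * sin x ^ 2 := fun x => by nlinarith [sin_sq_le_one x]
  set f : ℝ → ℝ := fun x => 2 * arcsin (√3/2 * cos x / √(1 - 3/4 * sin x ^ 2)) with hf
  have h3 : (√3:ℝ)^2 = 3 := sq_sqrt (by norm_num)
  have h3p : (0:ℝ) < √3 := by positivity
  have husq : ∀ x, (√3/2 * cos x / √(1 - 3/4 * sin x ^ 2))^2 = 1 - 1/(4 * (1 - 3/4 * sin x ^ 2)) := fun x => by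
    have := (hD x).ne'
    rw [div_pow, sq_sqrt (hD x).le, mul_pow, div_pow, h3, cos_sq']
    rw [eq_sub_iff_add_eq, div_add_div _ _ this (by positivity), div_eq_one_iff_eq (by positivity)]
    ring
  have hb : ∀ x, -1 < √3/2 * cos x / √(1 - 3/4 * sin x ^ 2) ∧ √3/2 * cos x / √(1 - 3/4 * sin x ^ 2) < 1 := fun x => by
    rw [← abs_lt, ← sq_lt_one_iff_abs_lt_one, husq]
    have : 0 < 1/(4 * (1 - 3/4 * sin x ^ 2)) := by have := hD x; positivity
    linarith
  have e0 : f (π/2) = 0 := by simp [hf]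
  have e1 : f splitPt = π/2 := by
    simp only [hf]
    rw [← two_arcsin_sqrt_half]
    congr 2
    symm
    have : 0 ≤ cos splitPt := cos_nonneg_of_neg_pi_div_two_le_of_le (by linarith [splitPt_mem.1, pi_pos]) splitPt_mem.2
    rw [sqrt_eq_iff_mul_self_eq (by norm_num) (by positivity), ← sq, husq, sin_splitPt]
    norm_num
  have hder : ∀ x, HasDerivAt f (-(√3/2 * sin x) / (1 - 3/4 * sin x ^ 2)) x := fun x => by
    have hd1 : HasDerivAt (fun x => √(1 - 3/4 * sin x ^ 2))
        ((-(3/4 * (2 * sin x * cos x))) / (2 * √(1 - 3/4 * sin x ^ 2))) x := by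
      have := (((hasDerivAt_sin x).pow 2).const_mul (3/4)).const_sub 1
      have := this.sqrt (hD x).ne'
      simpa using this
    have hs := sqrt_pos.2 (hD x)
    have := ((hasDerivAt_arcsin (hb x).1.ne' (hb x).2.ne).comp x
      (((hasDerivAt_cos x).const_mul (√3/2)).div hd1 hs.ne')).const_mul 2
    refine this.congr_deriv ?_
    have e : √(1 - (√3/2 * cos x / √(1 - 3/4 * sin x ^ 2))^2) = 1/(2 * √(1 - 3/4 * sin x ^ 2)) := by
      rw [husq, sub_sub_cancel, sqrt_div zero_le_one, sqrt_one, sqrt_mul (by norm_num)]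
      congr 2
      rw [sqrt_eq_iff_mul_self_eq (by norm_num) (by norm_num)]; norm_num
    rw [e]
    have e := sq_sqrt (hD x).le
    have e5 := sin_sq_add_cos_sq x
    set S := √(1 - 3/4 * sin x ^ 2)
    rw [← e]
    field_simp
    have : S^2 * 4 - 3 * cos x^2 = 1 := by nlinarith
    linear_combination (-(4 * sin x)) * this
  have hX := splitPt_mem
  have hmaps : f '' Set.uIcc splitPt (π/2) ⊆ Set.Icc 0 (π/2) := by
    rw [Set.uIcc_of_le hX.2]
    rintro _ ⟨x, hx, rfl⟩
    have hc := cos_nonneg_of_neg_pi_div_two_le_of_le (by linarith [hx.1, pi_pos, hX.1]) hx.2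
    refine ⟨mul_nonneg zero_le_two (arcsin_nonneg.2 (by positivity)), ?_⟩
    rw [← two_arcsin_sqrt_half]
    simp only [hf]
    gcongr
    apply le_sqrt_of_sq_le
    rw [husq]
    have h1 := le_sin_sq_of_splitPt_le hx.1 hx.2
    have := hD x
    rw [sub_le_comm, le_div_iff₀ (by positivity)]
    nlinarith
  have key := intervalIntegral.integral_comp_mul_deriv'' (a := splitPt) (b := π/2) (f := f)
    (f' := fun x => -(√3/2 * sin x) / (1 - 3/4 * sin x ^ 2))
    (g := fun b => w (1/(2 * (1 + cos b))) / √(1 + 2 * cos b))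
    (fun x _ => (hder x).continuousAt.continuousWithinAt)
    (fun x _ => (hder x).hasDerivWithinAt)
    (by
      apply Continuous.continuousOn
      exact Continuous.div (by fun_prop) (by fun_prop) (fun x => (hD x).ne'))
    (by
      apply ContinuousOn.div
      · refine hw.comp_continuousOn (ContinuousOn.div (by fun_prop) (by fun_prop) ?_)
        intro b hb
        have := one_add_two_cos_pos (hmaps hb)
        intro h
        nlinarith
      · fun_prop
      · intro b hb
        exact (sqrt_pos.2 (one_add_two_cos_pos (hmaps hb))).ne')
  rw [e0, e1, intervalIntegral.integral_symm 0 (π/2)] at key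
  rw [← neg_inj, ← key, ← intervalIntegral.integral_neg]
  apply intervalIntegral.integral_congr
  intro x hx
  rw [Set.uIcc_of_le hX.2] at hx
  have hs : 0 < sin x := by
    have h1 := le_sin_sq_of_splitPt_le hx.1 hx.2
    have h2 := sin_nonneg_of_nonneg_of_le_pi (hX.1.trans hx.1) (by linarith [hx.2, pi_pos])
    rcases h2.lt_or_eq with h | h
    · exact h
    · rw [← h] at h1; norm_num at h1
  have hDx := hD x
  have hcf : cos (f x) = 1/(2 * (1 - 3/4 * sin x ^ 2)) - 1 := by
    simp only [hf]
    rw [cos_two_arcsin (hb x).1.le (hb x).2.le, husq, show (4:ℝ) = 2*2 by norm_num, mul_assoc, ← div_div]; ring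
  simp only [Function.comp, hcf]
  have e2 : √(1 + 2 * (1/(2 * (1 - 3/4 * sin x ^ 2)) - 1)) = √3/2 * sin x / √(1 - 3/4 * sin x ^ 2) := by
    rw [show 1 + 2 * (1/(2 * (1 - 3/4 * sin x ^ 2)) - 1) = (√3/2 * sin x / √(1 - 3/4 * sin x ^ 2))^2 by
      rw [div_pow, sq_sqrt hDx.le, mul_pow, div_pow, h3, eq_div_iff hDx.ne']
      rw [show ∀ D : ℝ, (1 + 2 * (1/(2*D) - 1)) * D = D/D - D by intro D; rw [one_div, mul_inv]; ring,
        div_self hDx.ne']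
      ring]
    exact sqrt_sq (by positivity)
  rw [e2]
  have e3 : 1/(2 * (1 + (1/(2 * (1 - 3/4 * sin x ^ 2)) - 1))) = 1 - 3/4 * sin x^2 := by
    rw [add_sub_cancel, mul_one_div, div_mul_cancel_left₀ two_ne_zero, one_div, inv_inv]
  rw [e3]
  have := (sqrt_pos.2 (hD x))
  have e := sq_sqrt (hD x).le
  set S := √(1 - 3/4 * sin x ^ 2)
  rw [← e]
  field_simp

lemma elliptic_split (w : ℝ → ℝ) (hw : Continuous w) :
    ∫ x in (0:ℝ)..(π/2), w (1 - 3/4 * sin x ^ 2) / √(1 - 3/4 * sin x ^ 2) =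
    (∫ b in (0:ℝ)..(π/2), w ((1 + cos b)/2) / √(1 + 2 * cos b)) +
    ∫ b in (0:ℝ)..(π/2), w (1/(2 * (1 + cos b))) / √(1 + 2 * cos b) := by
  have hc : Continuous fun x => w (1 - 3/4 * sin x ^ 2) / √(1 - 3/4 * sin x ^ 2) :=
    Continuous.div (by fun_prop) (by fun_prop)
      (fun x => (sqrt_pos.2 (by nlinarith [sin_sq_le_one x])).ne')
  rw [← elliptic_first_half w hw, ← elliptic_second_half w hw,
    intervalIntegral.integral_add_adjacent_intervals (hc.intervalIntegrable _ _) (hc.intervalIntegrable _ _)]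

/-- `∫₀^{π/2} dβ/√(1+2cos β)`. -/
def halfK : ℝ := ∫ b in (0:ℝ)..(π/2), 1 / √(1 + 2 * cos b)

lemma sqrt_three_half_sq : (√3/2)^2 = (3/4:ℝ) := by
  rw [div_pow, sq_sqrt (by norm_num)]; norm_num

lemma ellipticK_eq : ellipticK (√3/2) = 2 * halfK := by
  have := elliptic_split (fun _ => 1) continuous_const
  rw [ellipticK, sqrt_three_half_sq, this, halfK]; ring

lemma continuousOn_inv_sqrt : ContinuousOn (fun b => 1 / √(1 + 2 * cos b)) (Set.Icc 0 (π/2)) :=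
  ContinuousOn.div (by fun_prop) (by fun_prop)
    (fun _ hb => (sqrt_pos.2 (one_add_two_cos_pos hb)).ne')

lemma one_add_cos_pos {b : ℝ} (hb : b ∈ Set.Icc 0 (π/2)) : 0 < 1 + cos b := by
  have := cos_nonneg_of_neg_pi_div_two_le_of_le (by linarith [hb.1, pi_pos]) hb.2
  linarith

lemma two_E_add_K : 2 * ellipticE (√3/2) + ellipticK (√3/2) =
    ∫ b in (0:ℝ)..(π/2), (2 + cos b)^2 / ((1 + cos b) * √(1 + 2 * cos b)) := by
  have hE : ellipticE (√3/2) = ∫ x in (0:ℝ)..(π/2), (1 - 3/4 * sin x ^ 2) / √(1 - 3/4 * sin x ^ 2) := by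
    rw [ellipticE, sqrt_three_half_sq]
    congr 1; ext x
    rw [div_sqrt]
  have := elliptic_split (fun x => x) continuous_id
  rw [hE, this, ellipticK_eq, halfK, ← intervalIntegral.integral_add, ← intervalIntegral.integral_const_mul,
    ← intervalIntegral.integral_const_mul, ← intervalIntegral.integral_add]
  · apply intervalIntegral.integral_congr
    intro b hb
    rw [Set.uIcc_of_le (by positivity)] at hb
    have h1 := one_add_cos_pos hb
    have h2 := sqrt_pos.2 (one_add_two_cos_pos hb)
    simp only
    field_simp
    ring
  all_goals
    apply ContinuousOn.intervalIntegrable_of_Icc (by positivity)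
    have h1 : ∀ b ∈ Set.Icc 0 (π/2), √(1 + 2 * cos b) ≠ 0 := fun _ hb => (sqrt_pos.2 (one_add_two_cos_pos hb)).ne'
    have h2 : ∀ b ∈ Set.Icc 0 (π/2), 2 * (1 + cos b) ≠ 0 := fun _ hb => (mul_pos two_pos (one_add_cos_pos hb)).ne'
  · exact continuousOn_const.mul ((ContinuousOn.div (by fun_prop) (by fun_prop) h1).add
      (ContinuousOn.div (ContinuousOn.div (by fun_prop) (by fun_prop) h2) (by fun_prop) h1))
  · exact continuousOn_const.mul continuousOn_inv_sqrt
  · exact ContinuousOn.div (by fun_prop) (by fun_prop) h1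
  · exact (ContinuousOn.div (ContinuousOn.div (by fun_prop) (by fun_prop) h2) (by fun_prop) h1)

lemma cos_nonneg_of_mem {b : ℝ} (hb : b ∈ Set.Icc 0 (π/2)) : 0 ≤ cos b :=
  cos_nonneg_of_neg_pi_div_two_le_of_le (by linarith [hb.1, pi_pos]) hb.2

lemma hasDerivAt_sqrt_q {b : ℝ} (hb : b ∈ Set.Icc 0 (π/2)) :
    HasDerivAt (fun b => √(1 + 2 * cos b)) (-sin b / √(1 + 2 * cos b)) b := by
  have := (((hasDerivAt_cos b).const_mul 2).const_add 1).sqrt (one_add_two_cos_pos hb).ne'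
  refine this.congr_deriv ?_
  have := sqrt_pos.2 (one_add_two_cos_pos hb)
  field_simp

lemma integral_volume_density :
    ∫ b in (0:ℝ)..(π/2), 2 * cos b ^ 2 * (5 + 5 * cos b + 2 * cos b ^ 2) /
      ((1 + cos b)^2 * √(1 + 2 * cos b)) = 2/3 * (2 * ellipticE (√3/2) + ellipticK (√3/2)) := by
  have h1 : ∀ b ∈ Set.Icc 0 (π/2), √(1 + 2 * cos b) ≠ 0 := fun _ hb => (sqrt_pos.2 (one_add_two_cos_pos hb)).ne'
  have h2 : ∀ b ∈ Set.Icc 0 (π/2), (1 + cos b) ≠ 0 := fun _ hb => (one_add_cos_pos hb).ne'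
  rw [two_E_add_K, ← intervalIntegral.integral_const_mul, ← sub_eq_zero, ← intervalIntegral.integral_sub]
  rotate_left
  · apply ContinuousOn.intervalIntegrable_of_Icc (by positivity)
    exact ContinuousOn.div (by fun_prop) (by fun_prop) (fun b hb => mul_ne_zero (pow_ne_zero 2 (h2 b hb)) (h1 b hb))
  · apply ContinuousOn.intervalIntegrable_of_Icc (by positivity)
    exact continuousOn_const.mul (ContinuousOn.div (by fun_prop) (by fun_prop) (fun b hb => mul_ne_zero ((h2 b hb)) (h1 b hb)))
  have key := intervalIntegral.integral_eq_sub_of_hasDerivAt (a := 0) (b := π/2)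
    (f := fun b => 4/3 * (sin b * √(1 + 2 * cos b) * (1 - 1/(1 + cos b)^2)))
    (f' := fun b => 2 * cos b ^ 2 * (5 + 5 * cos b + 2 * cos b ^ 2) /
      ((1 + cos b)^2 * √(1 + 2 * cos b)) - 2/3 * ((2 + cos b)^2 / ((1 + cos b) * √(1 + 2 * cos b)))) ?_ ?_
  · rw [key]; simp
  · intro b hb
    rw [Set.uIcc_of_le (by positivity)] at hb
    have hd : HasDerivAt (fun b => 1 - 1/(1 + cos b)^2) (-(2 * sin b / (1 + cos b)^3)) b := by
      have := ((hasDerivAt_const b (1:ℝ)).div (((hasDerivAt_cos b).const_add 1).pow 2) (pow_ne_zero 2 (h2 b hb))).const_sub 1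
      refine this.congr_deriv ?_
      have := h2 b hb
      simp only [Pi.pow_apply]
      field_simp
      ring
    refine ((((hasDerivAt_sin b).mul (hasDerivAt_sqrt_q hb)).mul hd).const_mul (4/3)).congr_deriv ?_
    have e := sq_sqrt (one_add_two_cos_pos hb).le
    have hS := h1 b hb
    have hc := h2 b hb
    simp only [Pi.mul_apply]
    set S := √(1 + 2 * cos b)
    have hs := sin_sq b
    set c := cos b
    field_simp
    rw [hs]
    have : S^2 = 1 + 2 * c := e
    rw [this]
    ring
  · apply ContinuousOn.intervalIntegrable_of_Icc (by positivity)
    refine ContinuousOn.sub ?_ ?_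
    · exact ContinuousOn.div (by fun_prop) (by fun_prop) (fun b hb => mul_ne_zero (pow_ne_zero 2 (h2 b hb)) (h1 b hb))
    · exact continuousOn_const.mul (ContinuousOn.div (by fun_prop) (by fun_prop) (fun b hb => mul_ne_zero ((h2 b hb)) (h1 b hb)))

lemma integral_area_density :
    ∫ b in (0:ℝ)..(π/2), (2 + cos b) / (√(1 + cos b) * √(1 + 2 * cos b)) = √2 * π / 2 := by
  have h1 : ∀ b ∈ Set.Icc 0 (π/2), √(1 + 2 * cos b) ≠ 0 := fun _ hb => (sqrt_pos.2 (one_add_two_cos_pos hb)).ne'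
  have h2 : ∀ b ∈ Set.Icc 0 (π/2), √(1 + cos b) ≠ 0 := fun _ hb => (sqrt_pos.2 (one_add_cos_pos hb)).ne'
  have key := intervalIntegral.integral_eq_sub_of_hasDerivAt (a := 0) (b := π/2)
    (f := fun b => √2 * (arctan (sin (b/2) / √(1 + 2 * cos b)) + arctan (2 * (sin (b/2) / √(1 + 2 * cos b)))))
    (f' := fun b => (2 + cos b) / (√(1 + cos b) * √(1 + 2 * cos b))) ?_ ?_
  · rw [key]
    have : arctan (sin (π/2/2)) + arctan (2 * sin (π/2/2)) = π/2 := by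
      rw [show π/2/2 = π/4 by ring, sin_pi_div_four]
      have h22 : (√2:ℝ) ≠ 0 := by positivity
      have : 2 * (√2/2) = (√2/2)⁻¹ := by
        field_simp; rw [sq_sqrt (by norm_num)]
      rw [this, arctan_inv_of_pos (by positivity)]; ring
    simp [this]
    ring
  · intro b hb
    rw [Set.uIcc_of_le (by positivity)] at hb
    have hd0 : HasDerivAt (fun b => sin (b/2)) (cos (b/2) * (1/2)) b :=
      ((hasDerivAt_id b).div_const 2).sin
    have hd := hd0.div (hasDerivAt_sqrt_q hb) (h1 b hb)
    refine ((hd.arctan.add (hd.const_mul 2).arctan).const_mul √2).congr_deriv ?_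
    have hcp : 0 < cos (b/2) := cos_pos_of_mem_Ioo ⟨by linarith [hb.1, pi_pos], by linarith [hb.2, pi_pos]⟩
    have hcb : cos b = 2 * cos (b/2)^2 - 1 := by rw [← cos_two_mul]; congr 1; ring
    have hsb : sin b = 2 * sin (b/2) * cos (b/2) := by rw [← sin_two_mul]; congr 1; ring
    have e := sq_sqrt (one_add_two_cos_pos hb).le
    have hS := h1 b hb
    have e2 : √(1 + cos b) = √2 * cos (b/2) := by
      rw [hcb, show 1 + (2 * cos (b/2)^2 - 1) = 2 * cos (b/2)^2 by ring, sqrt_mul (by norm_num), sqrt_sq hcp.le]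
    rw [e2]
    have h22 : (√2:ℝ)^2 = 2 := sq_sqrt (by norm_num)
    have h20 : (√2:ℝ) ≠ 0 := by positivity
    simp only [Pi.div_apply]
    set S := √(1 + 2 * cos b)
    rw [hsb]
    have hs := sin_sq (b/2)
    set s := sin (b/2)
    set d := cos (b/2)
    have hSd : S^2 = 4*d^2 - 1 := by rw [e, hcb]; ring
    rw [hcb]
    have p1 : 1 + (s/S)^2 = 3 * d^2 / S^2 := by
      rw [div_pow, hs]; field_simp; rw [hSd]; ring
    have p2 : 1 + (2 * (s/S))^2 = 3/S^2 := by
      rw [mul_pow, div_pow, hs]; field_simp; rw [hSd]; ring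
    rw [p1, p2]
    field_simp
    rw [h22, hs, hSd]
    ring
  · apply ContinuousOn.intervalIntegrable_of_Icc (by positivity)
    exact ContinuousOn.div (by fun_prop) (by fun_prop) (fun b hb => mul_ne_zero (h2 b hb) (h1 b hb))

/-- The angle `α(β)` on `k_A` paired with the angle `β` on `k_B`. -/
def alpha (b : ℝ) : ℝ := arccos (cos b / (1 + cos b))

lemma alpha_arg {b : ℝ} (hb : b ∈ Set.Icc 0 (π/2)) :
    0 ≤ cos b / (1 + cos b) ∧ cos b / (1 + cos b) < 1 := by
  have h1 := one_add_cos_pos hb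
  have h2 := cos_nonneg_of_mem hb
  refine ⟨by positivity, ?_⟩
  rw [div_lt_one h1]; linarith

lemma cos_alpha {b : ℝ} (hb : b ∈ Set.Icc 0 (π/2)) : cos (alpha b) = cos b / (1 + cos b) :=
  cos_arccos (by linarith [(alpha_arg hb).1]) (alpha_arg hb).2.le

lemma sin_alpha {b : ℝ} (hb : b ∈ Set.Icc 0 (π/2)) : sin (alpha b) = √(1 + 2 * cos b) / (1 + cos b) := by
  have h1 := one_add_cos_pos hb
  rw [alpha, sin_arccos, show 1 - (cos b / (1 + cos b))^2 = (1 + 2 * cos b) / (1 + cos b)^2 by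
    field_simp; ring, sqrt_div (one_add_two_cos_pos hb).le, sqrt_sq h1.le]

lemma hasDerivAt_alpha {b : ℝ} (hb : b ∈ Set.Icc 0 (π/2)) :
    HasDerivAt alpha (sin b / ((1 + cos b) * √(1 + 2 * cos b))) b := by
  have h1 := one_add_cos_pos hb
  have h2 := alpha_arg hb
  have := (hasDerivAt_arccos (by linarith : cos b / (1 + cos b) ≠ -1) h2.2.ne).comp b
    ((hasDerivAt_cos b).div ((hasDerivAt_cos b).const_add 1) h1.ne')
  refine this.congr_deriv ?_
  rw [← sin_arccos, ← alpha, sin_alpha hb]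
  have := sqrt_pos.2 (one_add_two_cos_pos hb)
  field_simp
  ring

lemma arctan_sqrt_q {b : ℝ} (hb : b ∈ Set.Icc 0 (π/2)) : arctan (√(1 + 2 * cos b)) = (π - alpha b)/2 := by
  have h1 := one_add_cos_pos hb
  have hq := one_add_two_cos_pos hb
  set A := arctan (√(1 + 2 * cos b)) with hA
  have hA0 : 0 ≤ A := arctan_nonneg.2 (sqrt_nonneg _)
  have hA1 : A < π/2 := arctan_lt_pi_div_two _
  have : cos (π - 2*A) = cos b / (1 + cos b) := by
    rw [cos_pi_sub, cos_two_mul, hA, cos_sq_arctan, sq_sqrt hq.le]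
    field_simp
    ring
  rw [alpha, ← this, arccos_cos (by linarith) (by linarith)]
  ring

lemma alpha_zero : alpha 0 = π/3 := by
  rw [alpha, cos_zero, show (1:ℝ)/(1+1) = cos (π/3) by rw [cos_pi_div_three]; norm_num,
    arccos_cos (by positivity) (by linarith [pi_pos])]

lemma alpha_pi_div_two : alpha (π/2) = π/2 := by simp [alpha]

lemma continuousOn_alpha : ContinuousOn alpha (Set.Icc 0 (π/2)) :=
  fun _ hb => (hasDerivAt_alpha hb).continuousAt.continuousWithinAt

/-- The density of the mean width integral. -/
def widthDensity (t : ℝ) : ℝ :=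
  (1 + cos t / 2) * (arctan (√(1 + 2 * cos t)) + √(1 + 2 * cos t) / (2 * (1 + cos t)))

lemma one_add_cos_pos' {t : ℝ} (ht : t ∈ Set.Icc 0 (2*π/3)) : 0 < 1 + cos t := by
  have : cos π < cos t := cos_lt_cos_of_nonneg_of_le_pi ht.1 le_rfl (by linarith [ht.2, pi_pos])
  rw [cos_pi] at this; linarith

lemma continuousOn_widthDensity : ContinuousOn widthDensity (Set.Icc 0 (2*π/3)) := by
  unfold widthDensity
  refine ContinuousOn.mul (by fun_prop) (ContinuousOn.add ?_ ?_)
  · exact continuous_arctan.comp_continuousOn (by fun_prop)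
  · exact ContinuousOn.div (by fun_prop) (by fun_prop) (fun t ht => (mul_pos two_pos (one_add_cos_pos' ht)).ne')

lemma integral_widthDensity :
    ∫ t in (0:ℝ)..(2*π/3), widthDensity t = 3*π^2/8 + 3/4 * ellipticK (√3/2) - constI := by
  have hI : constI = ∫ b in (0:ℝ)..(π/2), alpha b := rfl
  have h1 : ∀ b ∈ Set.Icc 0 (π/2), √(1 + 2 * cos b) ≠ 0 := fun _ hb => (sqrt_pos.2 (one_add_two_cos_pos hb)).ne'
  have h2 : ∀ b ∈ Set.Icc 0 (π/2), (1 + cos b) ≠ 0 := fun _ hb => (one_add_cos_pos hb).ne'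
  have hsub : Set.uIcc 0 (π/2) ⊆ Set.Icc 0 (2*π/3) := by
    rw [Set.uIcc_of_le (by positivity)]; apply Set.Icc_subset_Icc_right; linarith [pi_pos]
  have hmaps : (fun b => π - alpha b) '' Set.uIcc 0 (π/2) ⊆ Set.Icc 0 (2*π/3) := by
    rw [Set.uIcc_of_le (by positivity)]
    rintro _ ⟨b, hb, rfl⟩
    have : alpha b ≤ π := arccos_le_pi _
    refine ⟨by simp only; linarith, ?_⟩
    have : alpha 0 ≤ alpha b := by
      apply arccos_le_arccos
      have h3 := one_add_cos_pos hb
      rw [cos_zero, div_le_div_iff₀ h3 (by norm_num)]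
      linarith [cos_le_one b]
    rw [alpha_zero] at this
    simp only; linarith
  have hcd : ContinuousOn (fun b => -(sin b / ((1 + cos b) * √(1 + 2 * cos b)))) (Set.Icc 0 (π/2)) :=
    (ContinuousOn.div (by fun_prop) (by fun_prop) (fun b hb => mul_ne_zero ((h2 b hb)) (h1 b hb))).neg
  have hca : ContinuousOn (fun b => π - alpha b) (Set.Icc 0 (π/2)) := continuousOn_const.sub continuousOn_alpha
  have huI : Set.uIcc 0 (π/2) = Set.Icc 0 (π/2) := Set.uIcc_of_le (by positivity)
  have key := intervalIntegral.integral_comp_mul_deriv'' (a := 0) (b := π/2) (f := fun b => π - alpha b)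
    (f' := fun b => -(sin b / ((1 + cos b) * √(1 + 2 * cos b))))
    (g := widthDensity)
    (by rw [huI]; exact hca)
    (fun x hx => ((hasDerivAt_alpha (by
      rw [min_eq_left (by positivity), max_eq_right (by positivity)] at hx; exact ⟨hx.1.le, hx.2.le⟩)).const_sub π).hasDerivWithinAt)
    (by rw [huI]; exact hcd)
    (continuousOn_widthDensity.mono hmaps)
  simp only [alpha_zero, alpha_pi_div_two] at key
  rw [← intervalIntegral.integral_add_adjacent_intervals (b := π/2)]
  rotate_left
  · exact (continuousOn_widthDensity.mono hsub).intervalIntegrable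
  · apply ContinuousOn.intervalIntegrable
    apply continuousOn_widthDensity.mono
    rw [Set.uIcc_of_le (by linarith [pi_pos])]
    exact Set.Icc_subset_Icc_left (by positivity)
  rw [intervalIntegral.integral_symm (2*π/3), show 2*π/3 = π - π/3 by ring, show (∫ x in π - π/3..π/2, widthDensity x) =
    ∫ x in π - π/3..π - π/2, widthDensity x by congr 1; ring, ← key]
  rw [ellipticK_eq, hI, halfK, ← sub_eq_add_neg]
  have hi1 : IntervalIntegrable widthDensity volume 0 (π/2) := (continuousOn_widthDensity.mono hsub).intervalIntegrable
  have hi2 : IntervalIntegrable (fun x => (widthDensity ∘ fun b => π - alpha b) x * -(sin x / ((1 + cos x) * √(1 + 2 * cos x)))) volume 0 (π/2) := by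
    apply ContinuousOn.intervalIntegrable
    rw [huI] at hmaps ⊢
    exact (continuousOn_widthDensity.comp hca (Set.mapsTo_iff_image_subset.2 hmaps)).mul hcd
  have hi3 : IntervalIntegrable alpha volume 0 (π/2) :=
    ContinuousOn.intervalIntegrable_of_Icc (by positivity) continuousOn_alpha
  have hi4 : IntervalIntegrable (fun b => 1 / √(1 + 2 * cos b)) volume 0 (π/2) :=
    ContinuousOn.intervalIntegrable_of_Icc (by positivity) continuousOn_inv_sqrt
  rw [← intervalIntegral.integral_sub hi1 hi2]
  have main := intervalIntegral.integral_eq_sub_of_hasDerivAt (a := 0) (b := π/2)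
    (f := fun b => b/2 * (alpha b - sin (alpha b)/2) + sin b/4 * (π - alpha b))
    (f' := fun b => (widthDensity b - (widthDensity ∘ fun b => π - alpha b) b * -(sin b / ((1 + cos b) * √(1 + 2 * cos b))))
      - (π/2 + 3/2 * (1/√(1 + 2 * cos b)) - alpha b)) ?_ ?_
  · rw [intervalIntegral.integral_sub (hi1.sub hi2) ((intervalIntegrable_const.add (hi4.const_mul _)).sub hi3),
      intervalIntegral.integral_sub (intervalIntegrable_const.add (hi4.const_mul _)) hi3,
      intervalIntegral.integral_add intervalIntegrable_const (hi4.const_mul _),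
      intervalIntegral.integral_const_mul, intervalIntegral.integral_const] at main
    simp [alpha_pi_div_two, alpha_zero] at main
    simp only [one_div, Function.comp, mul_neg, sub_neg_eq_add]
    linear_combination main
  · intro b hb
    rw [huI] at hb
    have ha := hasDerivAt_alpha hb
    refine ((((hasDerivAt_id b).div_const 2).mul (ha.sub (ha.sin.div_const 2))).add
      (((hasDerivAt_sin b).div_const 4).mul (ha.const_sub π))).congr_deriv ?_
    have e := sq_sqrt (one_add_two_cos_pos hb).le
    have hS := sqrt_pos.2 (one_add_two_cos_pos hb)
    have hc := one_add_cos_pos hb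
    have hc1 : 0 ≤ 1 - cos b := by linarith [cos_le_one b]
    have hb2 : b/2 ∈ Set.Icc 0 (π/4) := ⟨by linarith [hb.1], by linarith [hb.2]⟩
    have hcp : 0 < cos (b/2) := cos_pos_of_mem_Ioo ⟨by linarith [hb.1, pi_pos], by linarith [hb.2, pi_pos]⟩
    have hsp : 0 ≤ sin (b/2) := sin_nonneg_of_nonneg_of_le_pi (by linarith [hb.1]) (by linarith [hb.2, pi_pos])
    have hcb : cos b = 2 * cos (b/2)^2 - 1 := by rw [← cos_two_mul]; congr 1; ring
    have hsb : sin b = 2 * sin (b/2) * cos (b/2) := by rw [← sin_two_mul]; congr 1; ring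
    have et : √(1 + 2 * -(cos b / (1 + cos b))) = tan (b/2) := by
      rw [show 1 + 2 * -(cos b / (1 + cos b)) = tan (b/2)^2 by
        rw [tan_eq_sin_div_cos, div_pow, sin_sq, hcb]; field_simp; ring]
      exact sqrt_sq (by rw [tan_eq_sin_div_cos]; positivity)
    have et2 : tan (b/2) = sin b / (1 + cos b) := by
      rw [tan_eq_sin_div_cos, hsb, hcb]; field_simp; ring
    have ew : widthDensity (π - alpha b) = (1 - cos b / (1 + cos b) / 2) * (b/2 + sin b/2) := by
      rw [widthDensity, cos_pi_sub, cos_alpha hb, et, arctan_tan (by linarith [hb.1, pi_pos]) (by linarith [hb.2, pi_pos]), et2]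
      have : 1 + -(cos b / (1 + cos b)) = 1/(1 + cos b) := by field_simp; ring
      rw [this]
      field_simp
      ring
    simp only [Function.comp]
    rw [ew, widthDensity, arctan_sqrt_q hb, cos_alpha hb]
    simp only [sin_alpha hb, id, Pi.sub_apply]
    have hs := sin_sq b
    set S := √(1 + 2 * cos b)
    set c := cos b
    field_simp
    ring_nf
    have e4 : S^2 = 1 + 2*c := e
    simp only [e4, hs]
    ring
  · exact (hi1.sub hi2).sub ((intervalIntegrable_const.add (hi4.const_mul _)).sub hi3)

section

/-- The convex body with support function `h`. -/
def bodyOf (h : EuclideanSpace ℝ (Fin 3) → ℝ) : Set (EuclideanSpace ℝ (Fin 3)) := {y | ∀ x, inner ℝ y x ≤ h x}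

/-- A smooth convex function `f` at bounded distance from `h`, with gradient `g` and Hessian `H`. -/
structure IsPotential (h f : EuclideanSpace ℝ (Fin 3) → ℝ)
    (g : EuclideanSpace ℝ (Fin 3) → EuclideanSpace ℝ (Fin 3))
    (H : EuclideanSpace ℝ (Fin 3) → Matrix (Fin 3) (Fin 3) ℝ) : Prop where
  hasGrad : ∀ x, HasFDerivAt f (innerSL ℝ (g x)) x
  hasHess : ∀ x, HasFDerivAt g (Matrix.toEuclideanCLM (n := Fin 3) (𝕜 := ℝ) (H x)) x
  grad_le : ∀ x y, f x + inner ℝ (g x) (y - x) ≤ f y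
  bdd : ∃ c, ∀ x, |f x - h x| ≤ c
  cont : Continuous H

lemma convex_bodyOf (h : E3 → ℝ) : Convex ℝ (bodyOf h) := by
  intro y hy z hz a b ha hb hab x
  rw [inner_add_left, real_inner_smul_left, real_inner_smul_left]
  calc a * inner ℝ y x + b * inner ℝ z x ≤ a * h x + b * h x :=
        add_le_add (mul_le_mul_of_nonneg_left (hy x) ha) (mul_le_mul_of_nonneg_left (hz x) hb)
    _ = h x := by rw [← add_mul, hab, one_mul]

lemma isClosed_bodyOf (h : E3 → ℝ) : IsClosed (bodyOf h) := by
  have : bodyOf h = ⋂ x, {y | inner ℝ y x ≤ h x} := by ext; simp [bodyOf]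
  rw [this]
  exact isClosed_iInter fun x => isClosed_le (by fun_prop) continuous_const

lemma det_add_smul (P Q : M3) (t : ℝ) :
    (P + t • Q).det = P.det + t * (P.adjugate * Q).trace + t^2 * (Q.adjugate * P).trace + t^3 * Q.det := by
  simp only [Matrix.det_fin_three, Matrix.adjugate_fin_three, Matrix.trace_fin_three, Matrix.mul_apply,
    Fin.sum_univ_three, Matrix.add_apply, Matrix.smul_apply, smul_eq_mul, Matrix.of_apply, Matrix.cons_val]
  ring

open scoped MatrixOrder Matrix.Norms.L2Operator in
lemma trace_adjugate_mul_nonneg {P Q : M3} (hP : P.PosSemidef) (hQ : Q.PosSemidef) :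
    0 ≤ (P.adjugate * Q).trace := by
  obtain ⟨R, rfl⟩ := CStarAlgebra.nonneg_iff_eq_star_mul_self.mp hP.nonneg
  obtain ⟨S, rfl⟩ := CStarAlgebra.nonneg_iff_eq_star_mul_self.mp hQ.nonneg
  simp only [Matrix.star_eq_conjTranspose]
  have e : ((R.conjTranspose * R).adjugate * (S.conjTranspose * S)).trace =
      ((S * R.adjugate).conjTranspose * (S * R.adjugate)).trace := by
    rw [Matrix.adjugate_mul_distrib, Matrix.conjTranspose_mul, Matrix.adjugate_conjTranspose,
      Matrix.mul_assoc, Matrix.trace_mul_comm]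
    simp only [Matrix.mul_assoc]
  rw [e]
  exact (Matrix.posSemidef_conjTranspose_mul_self _).trace_nonneg

lemma det_toEuclideanCLM (M : M3) :
    (Matrix.toEuclideanCLM (n := Fin 3) (𝕜 := ℝ) M).det = M.det := by
  have : ((Matrix.toEuclideanCLM (n := Fin 3) (𝕜 := ℝ) M : E3 →L[ℝ] E3) : E3 →ₗ[ℝ] E3) =
      Matrix.toLin (EuclideanSpace.basisFun (Fin 3) ℝ).toBasis (EuclideanSpace.basisFun (Fin 3) ℝ).toBasis M := by
    rw [Matrix.coe_toEuclideanCLM_eq_toEuclideanLin, Matrix.toEuclideanLin_eq_toLin_orthonormal]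
  rw [ContinuousLinearMap.det, this, LinearMap.det_toLin]

namespace IsPotential
variable {h f : E3 → ℝ} {g : E3 → E3} {H : E3 → M3}

lemma continuous_gradient (hp : IsPotential h f g H) : Continuous g :=
  continuous_iff_continuousAt.2 fun x => (hp.hasHess x).continuousAt

lemma inner_hess_symm (hp : IsPotential h f g H) (x v w : E3) :
    inner ℝ (Matrix.toEuclideanCLM (n := Fin 3) (𝕜 := ℝ) (H x) v) w =
      inner ℝ (Matrix.toEuclideanCLM (n := Fin 3) (𝕜 := ℝ) (H x) w) v := by
  have h2 : HasFDerivAt (fun x => innerSL ℝ (g x))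
      ((innerSL ℝ).comp (Matrix.toEuclideanCLM (n := Fin 3) (𝕜 := ℝ) (H x))) x :=
    (innerSL ℝ (E := E3)).hasFDerivAt.comp x (hp.hasHess x)
  exact second_derivative_symmetric hp.hasGrad h2 v w

lemma monotone_g (hp : IsPotential h f g H) (x y : E3) : 0 ≤ inner ℝ (g y - g x) (y - x) := by
  have h1 := hp.grad_le x y
  have h2 := hp.grad_le y x
  rw [← neg_sub y x, inner_neg_right] at h2
  rw [inner_sub_left]; linarith

lemma inner_hess_nonneg (hp : IsPotential h f g H) (x v : E3) :
    0 ≤ inner ℝ (Matrix.toEuclideanCLM (n := Fin 3) (𝕜 := ℝ) (H x) v) v := by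
  have hl : HasDerivAt (fun t : ℝ => x + t • v) v 0 := by
    simpa using ((hasDerivAt_id (0:ℝ)).smul_const v).const_add x
  have h1 : HasDerivAt (fun t : ℝ => g (x + t • v)) (Matrix.toEuclideanCLM (n := Fin 3) (𝕜 := ℝ) (H x) v) 0 := by
    apply HasFDerivAt.comp_hasDerivAt (0:ℝ) _ hl
    simpa using hp.hasHess x
  have h2 : HasDerivAt (fun t : ℝ => inner ℝ (g (x + t • v)) v) (inner ℝ (Matrix.toEuclideanCLM (n := Fin 3) (𝕜 := ℝ) (H x) v) v) 0 := by
    simpa using h1.inner ℝ (hasDerivAt_const (0:ℝ) v)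
  have hm : Monotone (fun t : ℝ => inner ℝ (g (x + t • v)) v) := by
    intro s t hst
    rcases hst.eq_or_lt with rfl | hst
    · exact le_rfl
    have := hp.monotone_g (x + s • v) (x + t • v)
    rw [show x + t • v - (x + s • v) = (t - s) • v by module, real_inner_smul_right, inner_sub_left] at this
    have := nonneg_of_mul_nonneg_right this (sub_pos.2 hst)
    simp only; linarith
  rw [← h2.deriv]
  exact hm.deriv_nonneg

lemma posSemidef (hp : IsPotential h f g H) (x : E3) : (H x).PosSemidef := by
  rw [Matrix.posSemidef_iff_dotProduct_mulVec]
  constructor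
  · ext i j
    have := hp.inner_hess_symm x (EuclideanSpace.single i 1) (EuclideanSpace.single j 1)
    rw [real_inner_comm, Matrix.inner_toEuclideanCLM, real_inner_comm, Matrix.inner_toEuclideanCLM] at this
    simpa using this
  · intro v
    have := hp.inner_hess_nonneg x (WithLp.toLp 2 v)
    rw [real_inner_comm, Matrix.inner_toEuclideanCLM] at this
    simpa using this

lemma range_subset (hp : IsPotential h f g H) (hom : ∀ x, ∀ t : ℝ, 0 < t → h (t • x) = t * h x) :
    Set.range g ⊆ bodyOf h := by
  rintro _ ⟨x, rfl⟩ z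
  obtain ⟨c, hc⟩ := hp.bdd
  by_contra hlt
  push Not at hlt
  set d := inner ℝ (g x) z - h z
  have hd : 0 < d := sub_pos.2 hlt
  set k := inner ℝ (g x) x - f x + c
  set t := (|k| + 1) / d
  have ht : 0 < t := by positivity
  have h1 := hp.grad_le x (t • z)
  have h2 := (abs_le.1 (hc (t • z))).2
  rw [hom z t ht] at h2
  rw [inner_sub_right, real_inner_smul_right] at h1
  have h3 : t * d ≤ k := by simp only [d, k]; linarith
  have h4 : t * d = |k| + 1 := by simp only [t]; field_simp
  linarith [le_abs_self k]

lemma interior_subset_range (hp : IsPotential h f g H) : interior (bodyOf h) ⊆ Set.range g := by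
  intro y hy
  obtain ⟨c, hc⟩ := hp.bdd
  obtain ⟨ε, hε, hb⟩ := Metric.isOpen_iff.1 isOpen_interior y hy
  have hfc : Continuous f := continuous_iff_continuousAt.2 fun x => (hp.hasGrad x).continuousAt
  have key : ∀ x, ε/2 * ‖x‖ - c ≤ f x - inner ℝ y x := by
    intro x
    have h2 := (abs_le.1 (hc x)).1
    suffices inner ℝ y x + ε/2 * ‖x‖ ≤ h x by linarith
    rcases eq_or_ne x 0 with rfl | hx
    · have := interior_subset hy 0
      simpa using this
    have hx' : ‖x‖ ≠ 0 := norm_ne_zero_iff.2 hx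
    have hm : y + (ε/2/‖x‖) • x ∈ bodyOf h := by
      apply interior_subset
      apply hb
      rw [mem_ball_iff_norm, add_sub_cancel_left, norm_smul, norm_div, norm_div, norm_norm, div_mul_cancel₀ _ hx']
      rw [Real.norm_of_nonneg hε.le]; norm_num; linarith
    have := hm x
    rw [inner_add_left, real_inner_smul_left, real_inner_self_eq_norm_sq] at this
    rw [show ε / 2 * ‖x‖ = ε/2/‖x‖ * ‖x‖^2 by field_simp]
    exact this
  have hcoer : Filter.Tendsto (fun x => f x - inner ℝ y x) (Filter.cocompact E3) Filter.atTop := by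
    apply Filter.tendsto_atTop_mono key
    apply Filter.tendsto_atTop_add_const_right
    exact (tendsto_norm_cocompact_atTop (E := E3)).const_mul_atTop (by positivity)
  obtain ⟨x, hx⟩ := (hfc.sub (by fun_prop : Continuous fun x => inner ℝ y x)).exists_forall_le hcoer
  refine ⟨x, ?_⟩
  have hmin : IsLocalMin (fun x => f x - innerSL ℝ y x) x := Filter.Eventually.of_forall hx
  have h0 := hmin.hasFDerivAt_eq_zero ((hp.hasGrad x).sub (innerSL ℝ y).hasFDerivAt)
  rw [← map_sub] at h0
  have h1 : inner ℝ (g x - y) (g x - y) = 0 := by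
    have := congrArg (fun L => L (g x - y)) h0
    rw [inner_sub_left]; simpa using this
  exact sub_eq_zero.1 (inner_self_eq_zero.1 h1)

lemma lintegral_det (hp : IsPotential h f g H) (hom : ∀ x, ∀ t : ℝ, 0 < t → h (t • x) = t * h x)
    (hs : ∀ x y, x ≠ y → f x + inner ℝ (g x) (y - x) < f y) :
    ∫⁻ x, ENNReal.ofReal (H x).det = volume (bodyOf h) := by
  have inj : Set.InjOn g Set.univ := by
    intro x _ y _ hxy
    by_contra hne
    have h1 := hs x y hne
    have h2 := hs y x (Ne.symm hne)
    rw [hxy] at h1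
    rw [← neg_sub y x, inner_neg_right] at h2
    linarith
  have h1 := lintegral_abs_det_fderiv_eq_addHaar_image volume MeasurableSet.univ
    (fun x _ => (hp.hasHess x).hasFDerivWithinAt) inj
  rw [Set.image_univ, Measure.restrict_univ] at h1
  have h2 : volume (Set.range g) = volume (bodyOf h) := by
    apply le_antisymm (measure_mono (hp.range_subset hom))
    have : bodyOf h ⊆ Set.range g ∪ frontier (bodyOf h) := by
      intro y hy
      by_cases hi : y ∈ interior (bodyOf h)
      · exact Or.inl (hp.interior_subset_range hi)
      · exact Or.inr ⟨subset_closure hy, hi⟩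
    refine (measure_mono this).trans ((measure_union_le _ _).trans ?_)
    rw [(convex_bodyOf h).addHaar_frontier volume, add_zero]
  rw [← h2, ← h1]
  congr 1 with x
  rw [det_toEuclideanCLM, abs_of_nonneg (hp.posSemidef x).det_nonneg]

lemma add_smul {h' f' : E3 → ℝ} {g' : E3 → E3} {H' : E3 → M3} (hp : IsPotential h f g H)
    (hp' : IsPotential h' f' g' H') {t : ℝ} (ht : 0 ≤ t) :
    IsPotential (fun x => h x + t * h' x) (fun x => f x + t * f' x) (fun x => g x + t • g' x)
      (fun x => H x + t • H' x) where
  hasGrad x := by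
    refine ((hp.hasGrad x).add ((hp'.hasGrad x).const_mul t)).congr_fderiv ?_
    ext v; simp
  hasHess x := by
    refine ((hp.hasHess x).add ((hp'.hasHess x).const_smul t)).congr_fderiv ?_
    simp
  grad_le x y := by
    have h1 := hp.grad_le x y
    have h2 := mul_le_mul_of_nonneg_left (hp'.grad_le x y) ht
    rw [inner_add_left, real_inner_smul_left]; linarith
  bdd := by
    obtain ⟨c, hc⟩ := hp.bdd
    obtain ⟨c', hc'⟩ := hp'.bdd
    refine ⟨c + t * c', fun x => ?_⟩
    rw [show f x + t * f' x - (h x + t * h' x) = (f x - h x) + t * (f' x - h' x) by ring]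
    refine (abs_add_le _ _).trans (add_le_add (hc x) ?_)
    rw [abs_mul, abs_of_nonneg ht]
    exact mul_le_mul_of_nonneg_left (hc' x) ht
  cont := hp.cont.add (hp'.cont.const_smul t)

/-- The volume polynomial of `bodyOf (h + t h')`. -/
lemma volume_add_smul {h' f' : E3 → ℝ} {g' : E3 → E3} {H' : E3 → M3} (hp : IsPotential h f g H)
    (hp' : IsPotential h' f' g' H') (hom : ∀ x, ∀ t : ℝ, 0 < t → h (t • x) = t * h x)
    (hom' : ∀ x, ∀ t : ℝ, 0 < t → h' (t • x) = t * h' x)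
    (hs : ∀ x y, x ≠ y → f x + inner ℝ (g x) (y - x) < f y) {t : ℝ} (ht : 0 ≤ t) :
    volume (bodyOf fun x => h x + t * h' x) = volume (bodyOf h)
      + ENNReal.ofReal t * (∫⁻ x, ENNReal.ofReal ((H x).adjugate * H' x).trace)
      + ENNReal.ofReal t ^ 2 * (∫⁻ x, ENNReal.ofReal ((H' x).adjugate * H x).trace)
      + ENNReal.ofReal t ^ 3 * ∫⁻ x, ENNReal.ofReal (H' x).det := by
  have c1 := hp.cont
  have c2 := hp'.cont
  have m1 : Measurable fun x => ENNReal.ofReal (H x).det :=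
    (by fun_prop : Continuous fun x => (H x).det).measurable.ennreal_ofReal
  have m2 : Measurable fun x => ENNReal.ofReal (H' x).det :=
    (by fun_prop : Continuous fun x => (H' x).det).measurable.ennreal_ofReal
  have m3 : Measurable fun x => ENNReal.ofReal ((H x).adjugate * H' x).trace :=
    (by fun_prop : Continuous fun x => ((H x).adjugate * H' x).trace).measurable.ennreal_ofReal
  have m4 : Measurable fun x => ENNReal.ofReal ((H' x).adjugate * H x).trace :=
    (by fun_prop : Continuous fun x => ((H' x).adjugate * H x).trace).measurable.ennreal_ofReal
  rw [← (hp.add_smul hp' ht).lintegral_det, ← hp.lintegral_det hom hs]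
  · simp only [det_add_smul]
    rw [← lintegral_const_mul, ← lintegral_const_mul, ← lintegral_const_mul, ← lintegral_add_left,
      ← lintegral_add_left, ← lintegral_add_left]
    · congr 1 with x
      have p1 := hp.posSemidef x
      have p2 := hp'.posSemidef x
      have n1 := trace_adjugate_mul_nonneg p1 p2
      have n2 := trace_adjugate_mul_nonneg p2 p1
      have n3 := p1.det_nonneg
      have n4 := p2.det_nonneg
      rw [ENNReal.ofReal_add (by positivity) (by positivity), ENNReal.ofReal_add (by positivity) (by positivity),
        ENNReal.ofReal_add (by positivity) (by positivity), ENNReal.ofReal_mul ht, ENNReal.ofReal_mul (by positivity),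
        ENNReal.ofReal_mul (by positivity), ENNReal.ofReal_pow ht, ENNReal.ofReal_pow ht]
    all_goals fun_prop
  · intro x s hs'
    rw [hom x s hs', hom' x s hs']; ring
  · intro x y hxy
    have h1 := hs x y hxy
    have h2 := mul_le_mul_of_nonneg_left (hp'.grad_le x y) ht
    rw [inner_add_left, real_inner_smul_left]; linarith

end IsPotential

end

section

namespace IsPotential
variable {h f : E3 → ℝ} {g : E3 → E3} {H : E3 → M3}

lemma _root_.gradient_eq_of_supporting {f : E3 → ℝ} {g v x : E3} (hf : HasFDerivAt f (innerSL ℝ g) x)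
    (hv : ∀ y, f x + inner ℝ v (y - x) ≤ f y) : g = v := by
  have hmin : IsLocalMin (fun y => f y - innerSL ℝ v y) x := Filter.Eventually.of_forall fun y => by
    have := hv y
    rw [inner_sub_right] at this
    simp only [innerSL_apply_apply]; linarith
  have h0 := hmin.hasFDerivAt_eq_zero (hf.sub (innerSL ℝ v).hasFDerivAt)
  rw [← map_sub] at h0
  have h1 : inner ℝ (g - v) (g - v) = 0 := by
    have := congrArg (fun L => L (g - v)) h0
    rw [inner_sub_left]; simpa using this
  exact sub_eq_zero.1 (inner_self_eq_zero.1 h1)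

lemma exists_of_contDiff (hf : ContDiff ℝ 2 f) (hsub : ∀ x, ∃ v, ∀ y, f x + inner ℝ v (y - x) ≤ f y)
    (hb : ∃ c, ∀ x, |f x - h x| ≤ c) : ∃ g H, IsPotential h f g H := by
  have hd : ∀ x, HasFDerivAt f (innerSL ℝ ((InnerProductSpace.toDual ℝ E3).symm (fderiv ℝ f x))) x := by
    intro x
    refine ((hf.differentiable (by norm_num)) x).hasFDerivAt.congr_fderiv ?_
    ext w
    simp
  have hg : ContDiff ℝ 1 (fun x => (InnerProductSpace.toDual ℝ E3).symm (fderiv ℝ f x)) :=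
    (InnerProductSpace.toDual ℝ E3).symm.contDiff.comp (hf.fderiv_right (by norm_num))
  refine ⟨fun x => (InnerProductSpace.toDual ℝ E3).symm (fderiv ℝ f x), fun x =>
    (Matrix.toEuclideanCLM (n := Fin 3) (𝕜 := ℝ)).symm
      (fderiv ℝ (fun x => (InnerProductSpace.toDual ℝ E3).symm (fderiv ℝ f x)) x), hd, ?_, ?_, hb, ?_⟩
  · intro x
    rw [StarAlgEquiv.apply_symm_apply]
    exact ((hg.differentiable (by norm_num)) x).hasFDerivAt
  · intro x y
    obtain ⟨v, hv⟩ := hsub x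
    rw [gradient_eq_of_supporting (hd x) hv]
    exact hv y
  · have h1 : Continuous ((Matrix.toEuclideanCLM (n := Fin 3) (𝕜 := ℝ)).symm : (E3 →L[ℝ] E3) → M3) :=
      LinearMap.continuous_of_finiteDimensional
        ((Matrix.toEuclideanCLM (n := Fin 3) (𝕜 := ℝ)).symm.toAlgEquiv.toLinearMap)
    exact h1.comp (hg.continuous_fderiv (by norm_num))

lemma comp_transpose (hp : IsPotential h f g H) (O : M3) :
    IsPotential (fun x => h (Matrix.toEuclideanCLM (n := Fin 3) (𝕜 := ℝ) O.transpose x))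
      (fun x => f (Matrix.toEuclideanCLM (n := Fin 3) (𝕜 := ℝ) O.transpose x))
      (fun x => Matrix.toEuclideanCLM (n := Fin 3) (𝕜 := ℝ) O (g (Matrix.toEuclideanCLM (n := Fin 3) (𝕜 := ℝ) O.transpose x)))
      (fun x => O * H (Matrix.toEuclideanCLM (n := Fin 3) (𝕜 := ℝ) O.transpose x) * O.transpose) where
  hasGrad x := by
    refine ((hp.hasGrad _).comp x (Matrix.toEuclideanCLM (n := Fin 3) (𝕜 := ℝ) O.transpose).hasFDerivAt).congr_fderiv ?_
    ext v
    simp only [ContinuousLinearMap.comp_apply, innerSL_apply_apply]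
    rw [Matrix.inner_toEuclideanCLM, real_inner_comm, Matrix.inner_toEuclideanCLM,
      Matrix.dotProduct_mulVec, Matrix.vecMul_transpose, dotProduct_comm, Matrix.dotProduct_mulVec]
  hasHess x := by
    refine ((Matrix.toEuclideanCLM (n := Fin 3) (𝕜 := ℝ) O).hasFDerivAt.comp x
      ((hp.hasHess _).comp x (Matrix.toEuclideanCLM (n := Fin 3) (𝕜 := ℝ) O.transpose).hasFDerivAt)).congr_fderiv ?_
    rw [map_mul, map_mul]; rfl
  grad_le x y := by
    have := hp.grad_le (Matrix.toEuclideanCLM (n := Fin 3) (𝕜 := ℝ) O.transpose x)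
      (Matrix.toEuclideanCLM (n := Fin 3) (𝕜 := ℝ) O.transpose y)
    rw [← map_sub, Matrix.inner_toEuclideanCLM, Matrix.dotProduct_mulVec, Matrix.vecMul_transpose] at this
    rw [real_inner_comm, Matrix.inner_toEuclideanCLM, dotProduct_comm]
    exact this
  bdd := by
    obtain ⟨c, hc⟩ := hp.bdd
    exact ⟨c, fun x => hc _⟩
  cont := (continuous_const.matrix_mul (hp.cont.comp (ContinuousLinearMap.continuous _))).matrix_mul continuous_const

end IsPotential

/-- The support function of the circle `k_A`. -/
def supportA (x : EuclideanSpace ℝ (Fin 3)) : ℝ := √(x 0 ^ 2 + x 1 ^ 2) - x 1 / 2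

/-- The support function of the circle `k_B`. -/
def supportB (x : EuclideanSpace ℝ (Fin 3)) : ℝ := √(x 1 ^ 2 + x 2 ^ 2) + x 1 / 2

/-- The support function of the oloid. -/
def supportO (x : EuclideanSpace ℝ (Fin 3)) : ℝ := max (supportA x) (supportB x)

lemma supportA_smul (x : E3) (t : ℝ) (ht : 0 < t) : supportA (t • x) = t * supportA x := by
  simp only [supportA, PiLp.smul_apply, smul_eq_mul]
  rw [show (t * x 0)^2 + (t * x 1)^2 = t^2 * (x 0 ^2 + x 1 ^2) by ring, sqrt_mul (by positivity), sqrt_sq ht.le]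
  ring

lemma supportB_smul (x : E3) (t : ℝ) (ht : 0 < t) : supportB (t • x) = t * supportB x := by
  simp only [supportB, PiLp.smul_apply, smul_eq_mul]
  rw [show (t * x 1)^2 + (t * x 2)^2 = t^2 * (x 1 ^2 + x 2 ^2) by ring, sqrt_mul (by positivity), sqrt_sq ht.le]
  ring

lemma supportO_smul (x : E3) (t : ℝ) (ht : 0 < t) : supportO (t • x) = t * supportO x := by
  rw [supportO, supportA_smul x t ht, supportB_smul x t ht, ← mul_max_of_nonneg _ _ ht.le]; rfl

lemma inner_eq_sum (x y : E3) : (inner ℝ x y : ℝ) = x 0 * y 0 + x 1 * y 1 + x 2 * y 2 := by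
  simp [PiLp.inner_apply, Fin.sum_univ_three]; ring

lemma mul_add_mul_le_sqrt {a b : ℝ} (h : a^2 + b^2 ≤ 1) (x y : ℝ) : a * x + b * y ≤ √(x^2 + y^2) := by
  apply le_sqrt_of_sq_le
  nlinarith [sq_nonneg (a*y - b*x), sq_nonneg x, sq_nonneg y]

lemma inner_le_supportA {p : E3} (hp : p ∈ kA) (x : E3) : inner ℝ p x ≤ supportA x := by
  rw [inner_eq_sum, supportA, hp.2]
  have := mul_add_mul_le_sqrt hp.1.le (x 0) (x 1)
  linarith

lemma inner_le_supportB {p : E3} (hp : p ∈ kB) (x : E3) : inner ℝ p x ≤ supportB x := by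
  rw [inner_eq_sum, supportB, hp.2]
  have := mul_add_mul_le_sqrt hp.1.le (x 1) (x 2)
  linarith

lemma exists_unit_mul_eq_sqrt (x y : ℝ) : ∃ a b : ℝ, a^2 + b^2 = 1 ∧ a * x + b * y = √(x^2 + y^2) := by
  by_cases h : x^2 + y^2 = 0
  · have hx : x = 0 := by nlinarith [sq_nonneg x, sq_nonneg y]
    have hy : y = 0 := by nlinarith [sq_nonneg x, sq_nonneg y]
    exact ⟨1, 0, by norm_num, by simp [hx, hy]⟩
  · have hn : 0 < x^2 + y^2 := lt_of_le_of_ne (by positivity) (Ne.symm h)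
    have e := sq_sqrt hn.le
    have hs := sqrt_pos.2 hn
    refine ⟨x / √(x^2+y^2), y / √(x^2+y^2), ?_, ?_⟩
    · rw [div_pow, div_pow, e, ← add_div, div_self h]
    · rw [div_mul_eq_mul_div, div_mul_eq_mul_div, ← add_div, ← sq, ← sq, div_eq_iff hs.ne', ← sq, e]

lemma exists_inner_eq_supportA (x : E3) : ∃ p ∈ kA, inner ℝ p x = supportA x := by
  obtain ⟨a, b, h1, h2⟩ := exists_unit_mul_eq_sqrt (x 0) (x 1)
  refine ⟨!₂[a, b - 1/2, 0], ⟨by simpa using h1, by simp⟩, ?_⟩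
  rw [inner_eq_sum, supportA, ← h2]
  simp; ring

lemma exists_inner_eq_supportB (x : E3) : ∃ p ∈ kB, inner ℝ p x = supportB x := by
  obtain ⟨a, b, h1, h2⟩ := exists_unit_mul_eq_sqrt (x 1) (x 2)
  refine ⟨!₂[0, a + 1/2, b], ⟨by simpa using h1, by simp⟩, ?_⟩
  rw [inner_eq_sum, supportB, ← h2]
  simp; ring

lemma norm_sq_eq_sum (x : E3) : ‖x‖^2 = x 0 ^2 + x 1 ^2 + x 2 ^2 := by
  rw [← real_inner_self_eq_norm_sq, inner_eq_sum]; ring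

/-- The disc bounded by `k_A`. -/
def discA : Set (EuclideanSpace ℝ (Fin 3)) := {p | p 0 ^ 2 + (p 1 + 1/2) ^ 2 ≤ 1 ∧ p 2 = 0}

/-- The disc bounded by `k_B`. -/
def discB : Set (EuclideanSpace ℝ (Fin 3)) := {p | (p 1 - 1/2) ^ 2 + p 2 ^ 2 ≤ 1 ∧ p 0 = 0}

lemma exists_convex_comb_circle {u v : ℝ} (h : u^2 + v^2 ≤ 1) :
    ∃ s a : ℝ, 0 ≤ s ∧ s ≤ 1 ∧ a^2 + v^2 = 1 ∧ u = s * a + (1 - s) * (-a) := by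
  have hv : 0 ≤ 1 - v^2 := by nlinarith [sq_nonneg u]
  have e := sq_sqrt hv
  rcases (sqrt_nonneg (1 - v^2)).eq_or_lt with h0 | h0
  · refine ⟨0, √(1-v^2), le_rfl, zero_le_one, by linarith, ?_⟩
    rw [← h0] at e ⊢
    have : u = 0 := by nlinarith [sq_nonneg u]
    simp [this]
  · have h1 : |u| ≤ √(1-v^2) := abs_le_sqrt (by linarith)
    obtain ⟨h2, h3⟩ := abs_le.1 h1
    refine ⟨(1 + u / √(1-v^2))/2, √(1-v^2), ?_, ?_, by linarith, ?_⟩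
    · have : -1 ≤ u / √(1-v^2) := by rw [le_div_iff₀ h0]; linarith
      linarith
    · have : u / √(1-v^2) ≤ 1 := by rw [div_le_iff₀ h0]; linarith
      linarith
    · field_simp; ring

lemma discA_subset_convexHull : discA ⊆ convexHull ℝ kA := by
  rintro p ⟨h1, h2⟩
  obtain ⟨s, a, hs0, hs1, ha, hu⟩ := exists_convex_comb_circle h1
  have m1 : (!₂[a, p 1, 0] : E3) ∈ convexHull ℝ kA := subset_convexHull ℝ _ ⟨by simpa using ha, by simp⟩
  have m2 : (!₂[-a, p 1, 0] : E3) ∈ convexHull ℝ kA := subset_convexHull ℝ _ ⟨by simpa using ha, by simp⟩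
  convert convex_convexHull ℝ kA m1 m2 hs0 (sub_nonneg.2 hs1) (by ring) using 1
  ext i; fin_cases i <;> simp [h2, hu]; ring

lemma discB_subset_convexHull : discB ⊆ convexHull ℝ kB := by
  rintro p ⟨h1, h2⟩
  rw [add_comm] at h1
  obtain ⟨s, a, hs0, hs1, ha, hu⟩ := exists_convex_comb_circle h1
  rw [add_comm] at ha
  have m1 : (!₂[0, p 1, a] : E3) ∈ convexHull ℝ kB := subset_convexHull ℝ _ ⟨by simpa using ha, by simp⟩
  have m2 : (!₂[0, p 1, -a] : E3) ∈ convexHull ℝ kB := subset_convexHull ℝ _ ⟨by simpa using ha, by simp⟩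
  convert convex_convexHull ℝ kB m1 m2 hs0 (sub_nonneg.2 hs1) (by ring) using 1
  ext i; fin_cases i <;> simp [h2, hu]; ring

lemma sq_add_sq_convex_comb_le {u v u' v' a b : ℝ} (h : u^2 + v^2 ≤ 1) (h' : u'^2 + v'^2 ≤ 1)
    (ha : 0 ≤ a) (hb : 0 ≤ b) (hab : a + b = 1) : (a * u + b * u')^2 + (a * v + b * v')^2 ≤ 1 := by
  obtain rfl : b = 1 - a := by linarith
  nlinarith [mul_nonneg ha hb, sq_nonneg (u - u'), sq_nonneg (v - v'), mul_le_mul_of_nonneg_left h ha,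
    mul_le_mul_of_nonneg_left h' hb, mul_nonneg (mul_nonneg ha hb) (sq_nonneg (u - u')),
    mul_nonneg (mul_nonneg ha hb) (sq_nonneg (v - v'))]

lemma convex_discA : Convex ℝ discA := by
  rintro p ⟨h1, h2⟩ q ⟨h3, h4⟩ a b ha hb hab
  refine ⟨?_, by simp [h2, h4]⟩
  have e : (a • p + b • q) 1 = a * p 1 + b * q 1 := by simp
  have e0 : (a • p + b • q) 0 = a * p 0 + b * q 0 := by simp
  rw [e, e0]
  convert sq_add_sq_convex_comb_le h1 h3 ha hb hab using 3
  linear_combination (-1/2) * hab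

lemma convex_discB : Convex ℝ discB := by
  rintro p ⟨h1, h2⟩ q ⟨h3, h4⟩ a b ha hb hab
  refine ⟨?_, by simp [h2, h4]⟩
  have e : (a • p + b • q) 1 = a * p 1 + b * q 1 := by simp
  have e0 : (a • p + b • q) 2 = a * p 2 + b * q 2 := by simp
  rw [e, e0]
  convert sq_add_sq_convex_comb_le h1 h3 ha hb hab using 3
  linear_combination (1/2) * hab

lemma oloid_eq_convexJoin : oloid = convexJoin ℝ discA discB := by
  apply Set.Subset.antisymm
  · apply convexHull_min _ (convex_discA.convexJoin convex_discB)
    apply Set.union_subset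
    · refine Set.Subset.trans ?_ (subset_convexJoin_left ⟨!₂[0, 1/2, 0], by simp [discB]⟩)
      exact fun p hp => ⟨hp.1.le, hp.2⟩
    · refine Set.Subset.trans ?_ (subset_convexJoin_right ⟨!₂[0, -1/2, 0], by simp [discA]; norm_num⟩)
      exact fun p hp => ⟨hp.1.le, hp.2⟩
  · refine convexJoin_subset (?_ : discA ⊆ convexHull ℝ (kA ∪ kB)) (?_ : discB ⊆ convexHull ℝ (kA ∪ kB)) (convex_convexHull ℝ _)
    · exact discA_subset_convexHull.trans (convexHull_mono Set.subset_union_left)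
    · exact discB_subset_convexHull.trans (convexHull_mono Set.subset_union_right)

lemma isCompact_discA : IsCompact discA := by
  apply Metric.isCompact_of_isClosed_isBounded
  · exact (isClosed_le (by fun_prop : Continuous fun p : E3 => p 0 ^ 2 + (p 1 + 1/2) ^ 2) (continuous_const (y := (1:ℝ)))).inter
      (isClosed_eq (by fun_prop : Continuous fun p : E3 => p 2) (continuous_const (y := (0:ℝ))))
  · apply (Metric.isBounded_closedBall (x := (0:E3)) (r := 2)).subset
    rintro p ⟨h1, h2⟩
    rw [mem_closedBall_zero_iff]
    apply le_of_sq_le_sq _ (by norm_num)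
    rw [norm_sq_eq_sum, h2]
    nlinarith [sq_nonneg (p 0), sq_nonneg (p 1 - 1/2)]

lemma isCompact_discB : IsCompact discB := by
  apply Metric.isCompact_of_isClosed_isBounded
  · exact (isClosed_le (by fun_prop : Continuous fun p : E3 => (p 1 - 1/2) ^ 2 + p 2 ^ 2) (continuous_const (y := (1:ℝ)))).inter
      (isClosed_eq (by fun_prop : Continuous fun p : E3 => p 0) (continuous_const (y := (0:ℝ))))
  · apply (Metric.isBounded_closedBall (x := (0:E3)) (r := 2)).subset
    rintro p ⟨h1, h2⟩
    rw [mem_closedBall_zero_iff]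
    apply le_of_sq_le_sq _ (by norm_num)
    rw [norm_sq_eq_sum, h2]
    nlinarith [sq_nonneg (p 2), sq_nonneg (p 1 + 1/2)]

lemma isCompact_oloid : IsCompact oloid := by
  have : oloid = (fun q : ℝ × E3 × E3 => (1 - q.1) • q.2.1 + q.1 • q.2.2) ''
      (Set.Icc 0 1 ×ˢ discA ×ˢ discB) := by
    rw [oloid_eq_convexJoin]
    ext p
    simp only [mem_convexJoin, segment_eq_image, Set.mem_image, Set.mem_prod, Prod.exists]
    constructor
    · rintro ⟨a, ha, b, hb, t, ht, rfl⟩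
      exact ⟨t, a, b, ⟨ht, ha, hb⟩, rfl⟩
    · rintro ⟨t, a, b, ⟨ht, ha, hb⟩, rfl⟩
      exact ⟨a, ha, b, hb, t, ht, rfl⟩
  rw [this]
  exact (isCompact_Icc.prod (isCompact_discA.prod isCompact_discB)).image (by fun_prop)

lemma convex_oloid : Convex ℝ oloid := convex_convexHull ℝ _

lemma exists_inner_eq_supportO (x : E3) : ∃ p ∈ oloid, inner ℝ p x = supportO x := by
  rcases le_total (supportA x) (supportB x) with hle | hle
  · obtain ⟨p, hp, e⟩ := exists_inner_eq_supportB x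
    exact ⟨p, subset_convexHull ℝ _ (Or.inr hp), by rw [e, supportO, max_eq_right hle]⟩
  · obtain ⟨p, hp, e⟩ := exists_inner_eq_supportA x
    exact ⟨p, subset_convexHull ℝ _ (Or.inl hp), by rw [e, supportO, max_eq_left hle]⟩

lemma bodyOf_subset_of_attained {K : Set E3} {h : E3 → ℝ} (hc : Convex ℝ K) (hcl : IsClosed K)
    (hat : ∀ x, ∃ p ∈ K, inner ℝ p x = h x) : bodyOf h ⊆ K := by
  intro y hy
  by_contra hyK
  obtain ⟨f, u, hf, hu⟩ := geometric_hahn_banach_closed_point hc hcl hyK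
  set v := (InnerProductSpace.toDual ℝ E3).symm f
  have hv : ∀ z, f z = inner ℝ z v := fun z => by
    rw [real_inner_comm, InnerProductSpace.toDual_symm_apply]
  obtain ⟨p, hp, e⟩ := hat v
  have h1 := hf p hp
  have h2 := hy v
  rw [hv] at h1 hu
  linarith

lemma oloid_eq_bodyOf : oloid = bodyOf supportO := by
  apply Set.Subset.antisymm
  · apply convexHull_min _ (convex_bodyOf _)
    rintro p (hp | hp) x
    · exact (inner_le_supportA hp x).trans (le_max_left _ _)
    · exact (inner_le_supportB hp x).trans (le_max_right _ _)
  · exact bodyOf_subset_of_attained convex_oloid isCompact_oloid.isClosed exists_inner_eq_supportO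

end

lemma sqrt_one_add_lt {u v u' v' : ℝ} (h : u ≠ u' ∨ v ≠ v') :
    √(1 + u^2 + v^2) + (u / √(1 + u^2 + v^2) * (u' - u) + v / √(1 + u^2 + v^2) * (v' - v)) < √(1 + u'^2 + v'^2) := by
  have hN : 0 < √(1 + u^2 + v^2) := sqrt_pos.2 (by positivity)
  have e := sq_sqrt (show 0 ≤ 1 + u^2 + v^2 by positivity)
  have key : 1 + u * u' + v * v' < √(1 + u^2 + v^2) * √(1 + u'^2 + v'^2) := by
    rw [← sqrt_mul (by positivity)]
    apply lt_sqrt_of_sq_lt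
    have : 0 < (u - u')^2 + (v - v')^2 := by
      rcases h with h | h
      · have := sub_ne_zero.2 h; positivity
      · have := sub_ne_zero.2 h; positivity
    nlinarith [sq_nonneg (u * v' - u' * v)]
  have : √(1 + u^2 + v^2) + (u / √(1 + u^2 + v^2) * (u' - u) + v / √(1 + u^2 + v^2) * (v' - v)) =
      (1 + u * u' + v * v') / √(1 + u^2 + v^2) := by
    field_simp
    rw [e]; ring
  rw [this, div_lt_iff₀ hN, mul_comm (√_)]
  exact key

lemma sqrt_one_add_le (u v u' v' : ℝ) :
    √(1 + u^2 + v^2) + (u / √(1 + u^2 + v^2) * (u' - u) + v / √(1 + u^2 + v^2) * (v' - v)) ≤ √(1 + u'^2 + v'^2) := by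
  by_cases h : u ≠ u' ∨ v ≠ v'
  · exact (sqrt_one_add_lt h).le
  · push Not at h
    simp [h.1, h.2]

/-- A smoothed version of `supportA`. -/
def smoothA (x : EuclideanSpace ℝ (Fin 3)) : ℝ := √(1 + x 0 ^ 2 + x 1 ^ 2) - x 1 / 2

/-- A smoothed version of `supportB`. -/
def smoothB (x : EuclideanSpace ℝ (Fin 3)) : ℝ := √(1 + x 1 ^ 2 + x 2 ^ 2) + x 1 / 2

/-- A smooth strictly convex function at bounded distance from the support function of the oloid. -/
def smoothO (x : EuclideanSpace ℝ (Fin 3)) : ℝ :=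
  (smoothA x + smoothB x + √(1 + (smoothA x - smoothB x)^2)) / 2

lemma contDiff_smoothO : ContDiff ℝ 2 smoothO := by
  have c : ∀ i : Fin 3, ContDiff ℝ 2 fun x : E3 => x i := fun i => by fun_prop
  have hA : ContDiff ℝ 2 smoothA :=
    (((contDiff_const.add ((c 0).pow 2)).add ((c 1).pow 2)).sqrt (fun x => by positivity)).sub ((c 1).div_const 2)
  have hB : ContDiff ℝ 2 smoothB :=
    (((contDiff_const.add ((c 1).pow 2)).add ((c 2).pow 2)).sqrt (fun x => by positivity)).add ((c 1).div_const 2)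
  exact ((hA.add hB).add ((contDiff_const.add ((hA.sub hB).pow 2)).sqrt (fun x => by positivity))).div_const 2

lemma exists_supporting_smoothO (x : E3) :
    ∃ v, ∀ y, y ≠ x → smoothO x + inner ℝ v (y - x) < smoothO y := by
  set w := smoothA x - smoothB x with hw
  set S := √(1 + w^2) with hS
  have hS0 : 0 < S := sqrt_pos.2 (by positivity)
  have hwS : |w / S| < 1 := by
    rw [abs_div, abs_of_pos hS0, div_lt_one hS0, ← sqrt_sq_eq_abs]
    exact sqrt_lt_sqrt (by positivity) (by linarith)
  obtain ⟨hl, hr⟩ := abs_lt.1 hwS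
  set p := (1 + w/S)/2 with hp
  have hp0 : 0 < p := by linarith
  have hp1 : 0 < 1 - p := by linarith
  set N := √(1 + x 0^2 + x 1 ^2)
  set N' := √(1 + x 1^2 + x 2 ^2)
  refine ⟨!₂[p * (x 0 / N), p * (x 1 / N - 1/2) + (1 - p) * (x 1 / N' + 1/2), (1 - p) * (x 2 / N')], fun y hy => ?_⟩
  have hne : (x 0 ≠ y 0 ∨ x 1 ≠ y 1) ∨ (x 1 ≠ y 1 ∨ x 2 ≠ y 2) := by
    by_contra hcon
    push Not at hcon
    apply hy
    ext i; fin_cases i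
    · exact hcon.1.1.symm
    · exact hcon.1.2.symm
    · exact hcon.2.2.symm
  have a1 := sqrt_one_add_le (x 0) (x 1) (y 0) (y 1)
  have b1 := sqrt_one_add_le (x 1) (x 2) (y 1) (y 2)
  have c1 := sqrt_one_add_le w 0 (smoothA y - smoothB y) 0
  simp only [ne_eq, OfNat.ofNat_ne_zero, not_false_eq_true, zero_pow, add_zero, sub_zero, mul_zero] at c1
  have hx : smoothO x = (smoothA x + smoothB x + S)/2 := rfl
  have hy' : smoothO y = (smoothA y + smoothB y + √(1 + (smoothA y - smoothB y)^2))/2 := rfl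
  have hAx : smoothA x = N - x 1 / 2 := rfl
  have hBx : smoothB x = N' + x 1 / 2 := rfl
  have hAy : smoothA y = √(1 + y 0^2 + y 1 ^2) - y 1 / 2 := rfl
  have hBy : smoothB y = √(1 + y 1^2 + y 2 ^2) + y 1 / 2 := rfl
  have key : p * (smoothA x + (x 0 / N * (y 0 - x 0) + x 1 / N * (y 1 - x 1)) - (y 1 - x 1)/2)
      + (1 - p) * (smoothB x + (x 1 / N' * (y 1 - x 1) + x 2 / N' * (y 2 - x 2)) + (y 1 - x 1)/2)
      < p * smoothA y + (1 - p) * smoothB y := by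
    rcases hne with h | h
    · have a2 := sqrt_one_add_lt h
      refine add_lt_add_of_lt_of_le (mul_lt_mul_of_pos_left ?_ hp0) (mul_le_mul_of_nonneg_left ?_ hp1.le)
      · linarith
      · linarith
    · have b2 := sqrt_one_add_lt h
      refine add_lt_add_of_le_of_lt (mul_le_mul_of_nonneg_left ?_ hp0.le) (mul_lt_mul_of_pos_left ?_ hp1)
      · linarith
      · linarith
  have hpw : 2 * p = 1 + w / S := by rw [hp]; ring
  rw [inner_eq_sum, hx, hy']
  simp only [PiLp.sub_apply, Matrix.cons_val_zero, Matrix.cons_val_one, Matrix.cons_val]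
  have c2 : S + (2 * p - 1) * (smoothA y - smoothB y - (smoothA x - smoothB x)) ≤ √(1 + (smoothA y - smoothB y)^2) := by
    rw [hpw]; refine le_trans (le_of_eq ?_) c1; rw [hw]; ring
  linarith

lemma abs_smoothO_sub_le (x : E3) : |smoothO x - supportO x| ≤ 2 := by
  have hs : ∀ t : ℝ, 0 ≤ t → √t ≤ √(1 + t) ∧ √(1 + t) ≤ √t + 1 := fun t ht => by
    refine ⟨sqrt_le_sqrt (by linarith), ?_⟩
    rw [sqrt_le_left (by positivity)]
    nlinarith [sq_sqrt ht, sqrt_nonneg t]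
  obtain ⟨a1, a2⟩ := hs (x 0 ^2 + x 1 ^2) (by positivity)
  obtain ⟨b1, b2⟩ := hs (x 1 ^2 + x 2 ^2) (by positivity)
  obtain ⟨c1, c2⟩ := hs ((smoothA x - smoothB x)^2) (by positivity)
  rw [sqrt_sq_eq_abs] at c1 c2
  have e1 : smoothA x = √(1 + (x 0 ^2 + x 1 ^2)) - x 1 / 2 := by rw [← add_assoc]; rfl
  have e2 : smoothB x = √(1 + (x 1 ^2 + x 2 ^2)) + x 1 / 2 := by rw [← add_assoc]; rfl
  have e3 : supportA x = √(x 0 ^2 + x 1 ^2) - x 1 / 2 := rfl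
  have e4 : supportB x = √(x 1 ^2 + x 2 ^2) + x 1 / 2 := rfl
  have hx : smoothO x = (smoothA x + smoothB x + √(1 + (smoothA x - smoothB x)^2))/2 := rfl
  rw [abs_le, supportO]
  rcases abs_cases (smoothA x - smoothB x) with ⟨h1, h2⟩ | ⟨h1, h2⟩ <;>
  rcases max_cases (supportA x) (supportB x) with ⟨h3, h4⟩ | ⟨h3, h4⟩ <;>
  rw [h3] <;> constructor <;> linarith

lemma exists_potential_oloid : ∃ g H, IsPotential supportO smoothO g H ∧
    ∀ x y, x ≠ y → smoothO x + inner ℝ (g x) (y - x) < smoothO y := by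
  have hsub : ∀ x, ∃ v, ∀ y, smoothO x + inner ℝ v (y - x) ≤ smoothO y := fun x => by
    obtain ⟨v, hv⟩ := exists_supporting_smoothO x
    refine ⟨v, fun y => ?_⟩
    rcases eq_or_ne y x with rfl | h
    · simp
    · exact (hv y h).le
  obtain ⟨g, H, hp⟩ := IsPotential.exists_of_contDiff contDiff_smoothO hsub ⟨2, abs_smoothO_sub_le⟩
  refine ⟨g, H, hp, fun x y hxy => ?_⟩
  obtain ⟨v, hv⟩ := exists_supporting_smoothO x
  rw [gradient_eq_of_supporting (v := v) (hp.hasGrad x)]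
  · exact hv y hxy.symm
  · intro y
    rcases eq_or_ne y x with rfl | h
    · simp
    · exact (hv y h).le

/-- The continuous linear endomorphism of `ℝ³` given by a matrix. -/
abbrev matCLM (M : Matrix (Fin 3) (Fin 3) ℝ) : EuclideanSpace ℝ (Fin 3) →L[ℝ] EuclideanSpace ℝ (Fin 3) :=
  Matrix.toEuclideanCLM (n := Fin 3) (𝕜 := ℝ) M

instance : SecondCountableTopology SO3 :=
  haveI : SecondCountableTopology M3 := inferInstanceAs (SecondCountableTopology (Fin 3 → Fin 3 → ℝ))
  TopologicalSpace.Subtype.secondCountableTopology _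

lemma SO3.coe_inv (θ : SO3) : (θ⁻¹).1 = θ.1.transpose := by
  ext i j; rfl

lemma SO3.mul_transpose (θ : SO3) : θ.1 * θ.1.transpose = 1 := by
  rw [← SO3.coe_inv]
  exact congrArg Subtype.val (mul_inv_cancel θ)

instance : ContinuousInv SO3 where
  continuous_inv := by
    apply Continuous.subtype_mk (f := fun θ : SO3 => θ.1.transpose)
    exact continuous_subtype_val.matrix_transpose

lemma rotate_eq (θ : SO3) (p : E3) : rotate θ p = matCLM θ.1 p := rfl

lemma continuous_matCLM : Continuous matCLM :=
  LinearMap.continuous_of_finiteDimensional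
    ((Matrix.toEuclideanCLM (n := Fin 3) (𝕜 := ℝ)).toAlgEquiv.toLinearMap)

lemma inner_matCLM_transpose (M : M3) (x y : E3) : inner ℝ (matCLM M x) y = inner ℝ x (matCLM M.transpose y) := by
  rw [real_inner_comm, Matrix.inner_toEuclideanCLM, Matrix.inner_toEuclideanCLM, Matrix.dotProduct_mulVec,
    ← Matrix.mulVec_transpose, dotProduct_comm]

lemma matCLM_mul_apply (M N : M3) (x : E3) : matCLM (M * N) x = matCLM M (matCLM N x) := by
  rw [matCLM, map_mul]; rfl

lemma norm_matCLM {O : M3} (hO : O.transpose * O = 1) (x : E3) : ‖matCLM O x‖ = ‖x‖ := by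
  rw [← sq_eq_sq₀ (norm_nonneg _) (norm_nonneg _), ← real_inner_self_eq_norm_sq, inner_matCLM_transpose,
    ← matCLM_mul_apply, hO, matCLM, map_one, ← real_inner_self_eq_norm_sq]
  rfl

lemma measurePreserving_matCLM {O : M3} (hO : O.transpose * O = 1) :
    MeasurePreserving (matCLM O : E3 → E3) volume volume :=
  LinearIsometryEquiv.measurePreserving
    (LinearIsometry.toLinearIsometryEquiv ⟨(matCLM O : E3 →L[ℝ] E3).toLinearMap, norm_matCLM hO⟩ rfl)

lemma measurableEmbedding_matCLM {O : M3} (hO : O.transpose * O = 1) :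
    MeasurableEmbedding (matCLM O : E3 → E3) :=
  (LinearIsometry.toLinearIsometryEquiv ⟨(matCLM O : E3 →L[ℝ] E3).toLinearMap, norm_matCLM hO⟩
    rfl).toHomeomorph.measurableEmbedding

/-- The matrix `-θ`. -/
def negMat (θ : SO3) : Matrix (Fin 3) (Fin 3) ℝ := -θ.1

lemma negMat_transpose_mul (θ : SO3) : (negMat θ).transpose * negMat θ = 1 := by
  rw [negMat, Matrix.transpose_neg, neg_mul_neg, mul_eq_one_comm, SO3.mul_transpose]

lemma negMat_mul_transpose (θ : SO3) : negMat θ * (negMat θ).transpose = 1 := by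
  rw [mul_eq_one_comm, negMat_transpose_mul]

lemma negMat_inv (θ : SO3) : negMat θ⁻¹ = (negMat θ).transpose := by
  rw [negMat, negMat, SO3.coe_inv, Matrix.transpose_neg]

lemma continuous_negMat : Continuous negMat := continuous_subtype_val.neg

lemma lintegral_comp_inv {ν : Measure SO3} [IsProbabilityMeasure ν] [ν.IsMulLeftInvariant]
    {φ : SO3 → ENNReal} (hφ : Measurable φ) : ∫⁻ θ, φ θ⁻¹ ∂ν = ∫⁻ θ, φ θ ∂ν := by
  have hm : Measurable (fun p : SO3 × SO3 => φ (p.2⁻¹ * p.1)) :=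
    hφ.comp (by fun_prop : Continuous fun p : SO3 × SO3 => p.2⁻¹ * p.1).measurable
  have h1 : ∫⁻ η, ∫⁻ θ, φ (θ⁻¹ * η) ∂ν ∂ν = ∫⁻ θ, φ θ⁻¹ ∂ν := by
    have : ∀ η, ∫⁻ θ, φ (θ⁻¹ * η) ∂ν = ∫⁻ θ, φ θ⁻¹ ∂ν := fun η => by
      rw [← lintegral_mul_left_eq_self _ η]
      simp
    simp [this]
  have h2 : ∫⁻ η, ∫⁻ θ, φ (θ⁻¹ * η) ∂ν ∂ν = ∫⁻ θ, φ θ ∂ν := by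
    rw [lintegral_lintegral_swap hm.aemeasurable]
    have : ∀ θ, ∫⁻ η, φ (θ⁻¹ * η) ∂ν = ∫⁻ θ, φ θ ∂ν := fun θ => lintegral_mul_left_eq_self _ _
    simp [this]
  rw [← h1, h2]

lemma smul_eq_rotation_e0 (x : E3) : ∃ θ : SO3, x = ‖x‖ • matCLM θ.1 (EuclideanSpace.single 0 1) := by
  obtain ⟨a, b, h1, h2⟩ := exists_unit_mul_eq_sqrt (x 0) (x 1)
  set ρ := √(x 0 ^2 + x 1 ^2)
  have hρ : ρ^2 = x 0 ^2 + x 1 ^2 := sq_sqrt (by positivity)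
  obtain ⟨c, d, h3, h4⟩ := exists_unit_mul_eq_sqrt ρ (x 2)
  have hn : √(ρ^2 + x 2 ^2) = ‖x‖ := by
    rw [hρ, ← norm_sq_eq_sum, sqrt_sq (norm_nonneg _)]
  have hn2 : ρ^2 + x 2^2 = ‖x‖^2 := by rw [hρ, norm_sq_eq_sum]
  rw [hn] at h4
  have e0 : x 0 = ρ * a ∧ x 1 = ρ * b := by
    have : (a * x 1 - b * x 0)^2 = 0 := by
      linear_combination (x 0 ^2 + x 1 ^2) * h1 - (a * x 0 + b * x 1 + ρ) * h2 - hρ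
    have h0 : a * x 1 - b * x 0 = 0 := pow_eq_zero_iff (two_ne_zero) |>.1 this
    constructor
    · linear_combination (- x 0) * h1 + a * h2 - b * h0
    · linear_combination (- x 1) * h1 + b * h2 + a * h0
  have e1 : ρ = ‖x‖ * c ∧ x 2 = ‖x‖ * d := by
    have : (c * x 2 - d * ρ)^2 = 0 := by
      linear_combination (ρ ^2 + x 2 ^2) * h3 - (c * ρ + d * x 2 + ‖x‖) * h4 + hn2
    have h0 : c * x 2 - d * ρ = 0 := pow_eq_zero_iff (two_ne_zero) |>.1 this
    constructor
    · linear_combination (- ρ) * h3 + c * h4 - d * h0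
    · linear_combination (- x 2) * h3 + d * h4 + c * h0
  refine ⟨⟨!![a * c, -b, -(a * d); b * c, a, -(b * d); d, 0, c], ?_⟩, ?_⟩
  · rw [Matrix.mem_specialOrthogonalGroup_iff, Matrix.mem_orthogonalGroup_iff]
    constructor
    · ext i j
      fin_cases i <;> fin_cases j <;>
      simp [Matrix.mul_apply, Fin.sum_univ_three]
      · linear_combination h1 + a^2 * h3
      · linear_combination a * b * h3
      · ring
      · linear_combination a * b * h3
      · linear_combination h1 + b^2 * h3
      · ring
      · ring
      · ring
      · linear_combination h3
    · rw [Matrix.det_fin_three]; simp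
      linear_combination (c^2 + d^2) * h1 + h3
  · ext i
    have : (matCLM !![a * c, -b, -(a * d); b * c, a, -(b * d); d, 0, c] (EuclideanSpace.single 0 1) : E3).ofLp =
      ![a * c, b * c, d] := by
        rw [matCLM, Matrix.ofLp_toEuclideanCLM]
        ext i; fin_cases i <;> simp [Matrix.mulVec, dotProduct]
    rw [PiLp.smul_apply, this]
    fin_cases i
    · simp; rw [e0.1, e1.1]; ring
    · simp; rw [e0.2, e1.1]; ring
    · simp; rw [e1.2]

section

/-- The mixed volume functional of the Hessian `H` and its conjugate by `O`. -/
def mixedVol (H : EuclideanSpace ℝ (Fin 3) → Matrix (Fin 3) (Fin 3) ℝ) (O : Matrix (Fin 3) (Fin 3) ℝ) : ENNReal :=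
  ∫⁻ x, ENNReal.ofReal ((H x).adjugate * (O * H (matCLM O.transpose x) * O.transpose)).trace

lemma adjugate_orthogonal {O : M3} (hO : O * O.transpose = 1) : O.adjugate = O.det • O.transpose := by
  calc O.adjugate = O.adjugate * (O * O.transpose) := by rw [hO, mul_one]
    _ = _ := by rw [← Matrix.mul_assoc, Matrix.adjugate_mul, Matrix.smul_mul, one_mul]

lemma det_mul_self_orthogonal {O : M3} (hO : O * O.transpose = 1) : O.det * O.det = 1 := by
  have := congrArg Matrix.det hO
  rwa [Matrix.det_mul, Matrix.det_transpose, Matrix.det_one] at this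

lemma adjugate_conj {O : M3} (hO : O * O.transpose = 1) (M : M3) :
    (O * M * O.transpose).adjugate = O * M.adjugate * O.transpose := by
  have h2 : O.transpose * O.transpose.transpose = 1 := by
    rw [Matrix.transpose_transpose, mul_eq_one_comm, hO]
  rw [Matrix.adjugate_mul_distrib, Matrix.adjugate_mul_distrib, adjugate_orthogonal hO, adjugate_orthogonal h2,
    Matrix.transpose_transpose, Matrix.det_transpose, Matrix.mul_smul, Matrix.mul_smul, Matrix.smul_mul, smul_smul,
    det_mul_self_orthogonal hO, one_smul, Matrix.mul_assoc]

lemma mixedVol_transpose {H : E3 → M3} {O : M3} (hO : O * O.transpose = 1) :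
    ∫⁻ x, ENNReal.ofReal ((O * H (matCLM O.transpose x) * O.transpose).adjugate * H x).trace =
      mixedVol H O.transpose := by
  have h2 : O.transpose * O = 1 := by rw [mul_eq_one_comm, hO]
  rw [mixedVol, ← (measurePreserving_matCLM h2).lintegral_comp_emb (measurableEmbedding_matCLM h2)]
  congr 1 with x
  rw [← matCLM_mul_apply, h2, adjugate_conj hO, Matrix.transpose_transpose]
  have : matCLM 1 x = x := by rw [matCLM, map_one]; rfl
  rw [this, Matrix.mul_assoc, Matrix.mul_assoc, Matrix.trace_mul_comm]
  simp only [Matrix.mul_assoc]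

lemma lintegral_det_conj {H : E3 → M3} {O : M3} (hO : O * O.transpose = 1) :
    ∫⁻ x, ENNReal.ofReal (O * H (matCLM O.transpose x) * O.transpose).det = ∫⁻ x, ENNReal.ofReal (H x).det := by
  have h2 : O.transpose.transpose * O.transpose = 1 := by rw [Matrix.transpose_transpose, hO]
  rw [← (measurePreserving_matCLM h2).lintegral_comp_emb (measurableEmbedding_matCLM h2)
    fun x => ENNReal.ofReal (H x).det]
  congr 1 with x
  rw [Matrix.det_mul, Matrix.det_mul, Matrix.det_transpose, mul_comm, ← mul_assoc, det_mul_self_orthogonal hO, one_mul]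

variable {g : E3 → E3} {H : E3 → M3}

lemma volume_bodyOf_add_conj (hp : IsPotential supportO smoothO g H)
    (hs : ∀ x y, x ≠ y → smoothO x + inner ℝ (g x) (y - x) < smoothO y) {O : M3} (hO : O * O.transpose = 1) :
    volume (bodyOf fun x => supportO x + supportO (matCLM O.transpose x)) =
      2 * volume oloid + (mixedVol H O + mixedVol H O.transpose) := by
  have := hp.volume_add_smul (hp.comp_transpose O) supportO_smul
    (fun x t ht => by rw [map_smul, supportO_smul _ _ ht]) hs zero_le_one
  simp only [one_mul] at this
  rw [this, oloid_eq_bodyOf, ← hp.lintegral_det supportO_smul hs, mixedVol_transpose hO, lintegral_det_conj hO,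
    show mixedVol H O = ∫⁻ x, ENNReal.ofReal ((H x).adjugate * (O * H (matCLM O.transpose x) * O.transpose)).trace from rfl]
  simp only [ENNReal.ofReal_one, one_pow, one_mul]
  ring

lemma hitting_set_eq (θ : SO3) : {x : E3 | (oloid ∩ moveSet θ x oloid).Nonempty} =
    bodyOf fun x => supportO x + supportO (matCLM (negMat θ).transpose x) := by
  have e : {x : E3 | (oloid ∩ moveSet θ x oloid).Nonempty} = oloid + matCLM (negMat θ) '' oloid := by
    ext x
    simp only [Set.mem_ofPred_eq, Set.mem_add, Set.mem_image]
    have hn : ∀ q, matCLM (negMat θ) q = - rotate θ q := fun q => by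
      rw [rotate_eq, matCLM, negMat, map_neg]; rfl
    constructor
    · rintro ⟨_, hp, q, hq, rfl⟩
      exact ⟨_, hp, _, ⟨q, hq, rfl⟩, by rw [hn]; simp⟩
    · rintro ⟨p, hp, _, ⟨q, hq, rfl⟩, rfl⟩
      refine ⟨p, hp, q, hq, ?_⟩
      rw [hn]; simp
  rw [e]
  apply Set.Subset.antisymm
  · rintro _ ⟨p, hp, _, ⟨q, hq, rfl⟩, rfl⟩ x
    rw [oloid_eq_bodyOf] at hp hq
    rw [inner_add_left, inner_matCLM_transpose]
    exact add_le_add (hp x) (hq _)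
  · apply bodyOf_subset_of_attained
    · exact convex_oloid.add (convex_oloid.linear_image (matCLM (negMat θ)).toLinearMap)
    · exact (isCompact_oloid.add (isCompact_oloid.image (matCLM (negMat θ)).continuous)).isClosed
    · intro x
      obtain ⟨p, hp, e1⟩ := exists_inner_eq_supportO x
      obtain ⟨q, hq, e2⟩ := exists_inner_eq_supportO (matCLM (negMat θ).transpose x)
      refine ⟨p + matCLM (negMat θ) q, Set.add_mem_add hp ⟨q, hq, rfl⟩, ?_⟩
      rw [inner_add_left, inner_matCLM_transpose, e1, e2]

lemma continuous_conj_hess (hc : Continuous H) : Continuous fun p : SO3 × E3 =>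
    negMat p.1 * H (matCLM (negMat p.1).transpose p.2) * (negMat p.1).transpose := by
  have h1 : Continuous fun p : SO3 × E3 => negMat p.1 := continuous_negMat.comp continuous_fst
  have h2 : Continuous fun p : SO3 × E3 => matCLM (negMat p.1).transpose p.2 :=
    (continuous_matCLM.comp h1.matrix_transpose).clm_apply continuous_snd
  exact (h1.matrix_mul (hc.comp h2)).matrix_mul h1.matrix_transpose

lemma continuous_mixed_integrand (hc : Continuous H) : Continuous fun p : SO3 × E3 =>
    ((H p.2).adjugate * (negMat p.1 * H (matCLM (negMat p.1).transpose p.2) * (negMat p.1).transpose)).trace :=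
  ((hc.comp continuous_snd).matrix_adjugate.matrix_mul (continuous_conj_hess hc)).matrix_trace

lemma lintegral_hitting (hp : IsPotential supportO smoothO g H)
    (hs : ∀ x y, x ≠ y → smoothO x + inner ℝ (g x) (y - x) < smoothO y)
    (ν : Measure SO3) [IsProbabilityMeasure ν] [ν.IsMulLeftInvariant] :
    ∫⁻ θ, volume {x : E3 | (oloid ∩ moveSet θ x oloid).Nonempty} ∂ν =
      2 * volume oloid + 2 * ∫⁻ θ, mixedVol H (negMat θ) ∂ν := by
  have hm : Measurable fun θ : SO3 => mixedVol H (negMat θ) :=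
    (continuous_mixed_integrand hp.cont).measurable.ennreal_ofReal.lintegral_prod_right'
  have : ∀ θ, volume {x : E3 | (oloid ∩ moveSet θ x oloid).Nonempty} =
      2 * volume oloid + (mixedVol H (negMat θ) + mixedVol H (negMat θ⁻¹)) := fun θ => by
    rw [hitting_set_eq, volume_bodyOf_add_conj hp hs (negMat_mul_transpose θ), negMat_inv]
  simp only [this]
  rw [lintegral_add_left measurable_const, lintegral_add_left hm, lintegral_comp_inv hm]
  simp
  ring

end

section

section ParametricIntegral

variable {F : Type*} [NormedAddCommGroup F]
  {φ : SO3 → EuclideanSpace ℝ (Fin 3) → F}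
  (ν : Measure SO3) [IsProbabilityMeasure ν]

lemma integrable_of_locally_bounded (hφ : Continuous fun p : SO3 × E3 => φ p.1 p.2)
    (hb : ∀ R, ∃ C, ∀ θ x, ‖x‖ ≤ R → ‖φ θ x‖ ≤ C) (x : E3) : Integrable (fun θ => φ θ x) ν := by
  obtain ⟨C, hC⟩ := hb ‖x‖
  have hc : Continuous fun θ => φ θ x := hφ.comp (Continuous.prodMk_left x)
  exact Integrable.of_bound hc.aestronglyMeasurable C (Filter.Eventually.of_forall fun θ => hC θ x le_rfl)

lemma continuous_integral_of_locally_bounded [NormedSpace ℝ F] (hφ : Continuous fun p : SO3 × E3 => φ p.1 p.2)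
    (hb : ∀ R, ∃ C, ∀ θ x, ‖x‖ ≤ R → ‖φ θ x‖ ≤ C) : Continuous fun x => ∫ θ, φ θ x ∂ν := by
  rw [continuous_iff_continuousAt]
  intro x
  obtain ⟨C, hC⟩ := hb (‖x‖ + 1)
  have hn : ∀ᶠ y in nhds x, ‖y‖ ≤ ‖x‖ + 1 :=
    (continuous_norm.continuousAt.eventually_lt continuousAt_const (by linarith : ‖x‖ < ‖x‖ + 1)).mono
      fun _ h => le_of_lt h
  refine continuousAt_of_dominated (bound := fun _ => C) (Filter.Eventually.of_forall fun y => ?_) ?_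
    (integrable_const _) (Filter.Eventually.of_forall fun θ => ?_)
  · exact (hφ.comp (Continuous.prodMk_left y)).aestronglyMeasurable
  · filter_upwards [hn] with y hy
    exact Filter.Eventually.of_forall fun θ => hC θ y hy
  · exact (hφ.comp (Continuous.prodMk_right θ)).continuousAt

lemma hasFDerivAt_integral_of_locally_bounded [NormedSpace ℝ F] {φ' : SO3 → E3 → E3 →L[ℝ] F}
    (hφ : Continuous fun p : SO3 × E3 => φ p.1 p.2)
    (hb : ∀ R, ∃ C, ∀ θ x, ‖x‖ ≤ R → ‖φ θ x‖ ≤ C)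
    (hφ' : Continuous fun p : SO3 × E3 => φ' p.1 p.2)
    (hb' : ∀ R, ∃ C, ∀ θ x, ‖x‖ ≤ R → ‖φ' θ x‖ ≤ C)
    (hd : ∀ θ x, HasFDerivAt (φ θ) (φ' θ x) x) (x : E3) :
    HasFDerivAt (fun x => ∫ θ, φ θ x ∂ν) (∫ θ, φ' θ x ∂ν) x := by
  obtain ⟨C, hC⟩ := hb' (‖x‖ + 1)
  have hn : ∀ᶠ y in nhds x, ‖y‖ ≤ ‖x‖ + 1 :=
    (continuous_norm.continuousAt.eventually_lt continuousAt_const (by linarith : ‖x‖ < ‖x‖ + 1)).mono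
      fun _ h => le_of_lt h
  refine hasFDerivAt_integral_of_dominated_of_fderiv_le (F := fun x θ => φ θ x) (F' := fun x θ => φ' θ x)
    (bound := fun _ => C) hn (Filter.Eventually.of_forall fun y => ?_)
    (integrable_of_locally_bounded ν hφ hb x) ?_ ?_ (integrable_const _)
    (Filter.Eventually.of_forall fun θ y _ => hd θ y)
  · exact (hφ.comp (Continuous.prodMk_left y)).aestronglyMeasurable
  · exact (hφ'.comp (Continuous.prodMk_left x)).aestronglyMeasurable
  · exact Filter.Eventually.of_forall fun θ y hy => hC θ y hy

end ParametricIntegral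

lemma norm_matCLM_transpose (θ : SO3) (x : E3) : ‖matCLM (negMat θ).transpose x‖ = ‖x‖ :=
  norm_matCLM (by rw [Matrix.transpose_transpose, negMat_mul_transpose]) x

lemma exists_bound_of_continuous {G : Type*} [SeminormedAddCommGroup G] {k : E3 → G} (hk : Continuous k) (R : ℝ) :
    ∃ C, ∀ x, ‖x‖ ≤ R → ‖k x‖ ≤ C := by
  obtain ⟨C, hC⟩ := (isCompact_closedBall (0 : E3) R).exists_bound_of_continuousOn hk.continuousOn
  exact ⟨C, fun x hx => hC x (by simpa using hx)⟩

lemma supportA_nonneg (x : E3) : √(x 0 ^ 2 + x 1 ^ 2) / 2 ≤ supportA x := by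
  have : x 1 ≤ √(x 0 ^ 2 + x 1 ^ 2) := le_sqrt_of_sq_le (by nlinarith [sq_nonneg (x 0)])
  rw [supportA]; linarith

lemma supportB_nonneg (x : E3) : √(x 1 ^ 2 + x 2 ^ 2) / 2 ≤ supportB x := by
  have : -x 1 ≤ √(x 1 ^ 2 + x 2 ^ 2) := le_sqrt_of_sq_le (by nlinarith [sq_nonneg (x 2)])
  rw [supportB]; linarith

lemma norm_div_four_le_supportO (x : E3) : ‖x‖ / 4 ≤ supportO x := by
  have h1 := (supportA_nonneg x).trans (le_max_left _ (supportB x))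
  have h2 := (supportB_nonneg x).trans (le_max_right (supportA x) _)
  rw [← supportO] at h1 h2
  have s1 : √(x 0 ^ 2 + x 1 ^ 2) ^ 2 = _ := sq_sqrt (by positivity)
  have s2 : √(x 1 ^ 2 + x 2 ^ 2) ^ 2 = _ := sq_sqrt (by positivity)
  have p1 := sqrt_nonneg (x 0 ^ 2 + x 1 ^ 2)
  have p2 := sqrt_nonneg (x 1 ^ 2 + x 2 ^ 2)
  have h0 : 0 ≤ supportO x := by linarith
  apply le_of_sq_le_sq _ h0
  rw [div_pow, norm_sq_eq_sum]
  nlinarith [sq_nonneg (x 0), sq_nonneg (x 1), sq_nonneg (x 2)]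

lemma continuous_supportO : Continuous supportO := by
  unfold supportO supportA supportB
  fun_prop

lemma supportO_zero : supportO 0 = 0 := by simp [supportO, supportA, supportB]

/-- The mean value of the support function of the oloid over the unit sphere. -/
def meanSupport (ν : Measure SO3) : ℝ :=
  ∫ θ, supportO (matCLM (negMat θ).transpose (EuclideanSpace.single 0 1)) ∂ν

lemma continuous_matCLM_negMat_transpose : Continuous fun p : SO3 × E3 => matCLM (negMat p.1).transpose p.2 :=
  (continuous_matCLM.comp (continuous_negMat.comp continuous_fst).matrix_transpose).clm_apply continuous_snd

lemma locally_bounded_supportO : ∀ R, ∃ C, ∀ (θ : SO3) (x : E3), ‖x‖ ≤ R →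
    ‖supportO (matCLM (negMat θ).transpose x)‖ ≤ C := fun R => by
  obtain ⟨C, hC⟩ := exists_bound_of_continuous continuous_supportO R
  exact ⟨C, fun θ x hx => hC _ (by rwa [norm_matCLM_transpose])⟩

lemma integral_supportO (ν : Measure SO3) [ν.IsMulLeftInvariant] (x : E3) :
    ∫ θ, supportO (matCLM (negMat θ).transpose x) ∂ν = meanSupport ν * ‖x‖ := by
  rcases eq_or_ne x 0 with rfl | hx
  · simp [supportO_zero]
  obtain ⟨η, e⟩ := smul_eq_rotation_e0 x
  have h : ∀ θ, supportO (matCLM (negMat θ).transpose x) =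
      ‖x‖ * supportO (matCLM (negMat (η⁻¹ * θ)).transpose (EuclideanSpace.single 0 1)) := fun θ => by
    have : (negMat (η⁻¹ * θ)).transpose = (negMat θ).transpose * η.1 := by
      rw [negMat, negMat, Matrix.transpose_neg, Matrix.transpose_neg, Submonoid.coe_mul, Matrix.transpose_mul,
        SO3.coe_inv, Matrix.transpose_transpose, Matrix.neg_mul]
    rw [this, matCLM_mul_apply]
    conv_lhs => rw [e]
    rw [map_smul, supportO_smul _ _ (norm_pos_iff.2 hx)]
  simp only [h]
  rw [integral_const_mul, integral_mul_left_eq_self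
    (fun θ => supportO (matCLM (negMat θ).transpose (EuclideanSpace.single 0 1))), meanSupport, mul_comm]

variable (ν : Measure SO3) [IsProbabilityMeasure ν]

lemma integrable_supportO (x : E3) : Integrable (fun θ => supportO (matCLM (negMat θ).transpose x)) ν :=
  integrable_of_locally_bounded (φ := fun θ x => supportO (matCLM (negMat θ).transpose x)) ν
    (continuous_supportO.comp continuous_matCLM_negMat_transpose) locally_bounded_supportO x

lemma meanSupport_pos : 0 < meanSupport ν := by
  have : ∫ _ : SO3, (1/4 : ℝ) ∂ν ≤ meanSupport ν := by
    apply integral_mono (integrable_const _) (integrable_supportO ν _)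
    intro θ
    have := norm_div_four_le_supportO (matCLM (negMat θ).transpose (EuclideanSpace.single 0 1))
    rw [norm_matCLM_transpose] at this
    simpa using this
  simp at this
  linarith

lemma meanSupport_mul_lintegral [ν.IsMulLeftInvariant] :
    ENNReal.ofReal (meanSupport ν) * (∫⁻ v : E3, ENNReal.ofReal (‖v‖ * exp (-‖v‖^2))) =
      ∫⁻ v : E3, ENNReal.ofReal (supportO v * exp (-‖v‖^2)) := by
  have hc : Continuous fun p : SO3 × E3 => supportO (matCLM (negMat p.1).transpose p.2) * exp (-‖p.2‖^2) :=
    (continuous_supportO.comp continuous_matCLM_negMat_transpose).mul (by fun_prop)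
  have h1 : ∀ θ : SO3, ∫⁻ v : E3, ENNReal.ofReal (supportO (matCLM (negMat θ).transpose v) * exp (-‖v‖^2)) =
      ∫⁻ v : E3, ENNReal.ofReal (supportO v * exp (-‖v‖^2)) := fun θ => by
    have h2 : (negMat θ).transpose.transpose * (negMat θ).transpose = 1 := by
      rw [Matrix.transpose_transpose, negMat_mul_transpose]
    rw [← (measurePreserving_matCLM h2).lintegral_comp_emb (measurableEmbedding_matCLM h2)
      fun v => ENNReal.ofReal (supportO v * exp (-‖v‖^2))]
    simp only [norm_matCLM_transpose]
  have h3 : ∫⁻ θ, ∫⁻ v : E3, ENNReal.ofReal (supportO (matCLM (negMat θ).transpose v) * exp (-‖v‖^2)) ∂volume ∂ν =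
      ∫⁻ v : E3, ENNReal.ofReal (supportO v * exp (-‖v‖^2)) := by
    simp [h1]
  rw [← h3, lintegral_lintegral_swap hc.measurable.ennreal_ofReal.aemeasurable,
    ← lintegral_const_mul _ (by fun_prop : Continuous fun v : E3 => ‖v‖ * exp (-‖v‖^2)).measurable.ennreal_ofReal]
  congr 1 with v
  rw [← ofReal_integral_eq_lintegral_ofReal ((integrable_supportO ν v).mul_const _), integral_mul_const,
    integral_supportO, ← ENNReal.ofReal_mul (meanSupport_pos ν).le, mul_assoc]
  exact Filter.Eventually.of_forall fun θ => mul_nonneg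
    ((by positivity : (0:ℝ) ≤ _ / 4).trans (norm_div_four_le_supportO _)) (exp_nonneg _)

variable {g : E3 → E3} {H : E3 → M3}

/-- The linear map inverse to `matCLM`. -/
def matCLMSymm : (EuclideanSpace ℝ (Fin 3) →L[ℝ] EuclideanSpace ℝ (Fin 3)) →ₗ[ℝ] Matrix (Fin 3) (Fin 3) ℝ :=
  ((Matrix.toEuclideanCLM (n := Fin 3) (𝕜 := ℝ)).symm.toAlgEquiv.toLinearMap)

lemma matCLM_matCLMSymm (T : E3 →L[ℝ] E3) : matCLM (matCLMSymm T) = T :=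
  (Matrix.toEuclideanCLM (n := Fin 3) (𝕜 := ℝ)).apply_symm_apply T

lemma matCLMSymm_matCLM (M : M3) : matCLMSymm (matCLM M) = M :=
  (Matrix.toEuclideanCLM (n := Fin 3) (𝕜 := ℝ)).symm_apply_apply M

/-- The Hessian conjugated by `-θ`. -/
def conjHess (H : EuclideanSpace ℝ (Fin 3) → Matrix (Fin 3) (Fin 3) ℝ) (θ : SO3) (x : EuclideanSpace ℝ (Fin 3)) :
    Matrix (Fin 3) (Fin 3) ℝ :=
  negMat θ * H (matCLM (negMat θ).transpose x) * (negMat θ).transpose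

lemma locally_bounded_conjHess (hc : Continuous H) : ∀ R, ∃ C, ∀ (θ : SO3) (x : E3), ‖x‖ ≤ R →
    ‖matCLM (conjHess H θ x)‖ ≤ C := fun R => by
  obtain ⟨C, hC⟩ := exists_bound_of_continuous (continuous_matCLM.comp hc) R
  refine ⟨C, fun θ x hx => ?_⟩
  have h := hC (matCLM (negMat θ).transpose x) (by rwa [norm_matCLM_transpose])
  refine ContinuousLinearMap.opNorm_le_bound _ ((norm_nonneg _).trans h) fun v => ?_
  rw [conjHess, matCLM_mul_apply, matCLM_mul_apply, norm_matCLM (negMat_transpose_mul θ)]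
  calc _ ≤ _ := ContinuousLinearMap.le_opNorm _ _
    _ ≤ _ := by rw [norm_matCLM_transpose]; exact mul_le_mul_of_nonneg_right h (norm_nonneg _)

/-- The average over rotations of the conjugated Hessians. -/
def meanHess (H : EuclideanSpace ℝ (Fin 3) → Matrix (Fin 3) (Fin 3) ℝ) (x : EuclideanSpace ℝ (Fin 3)) :
    Matrix (Fin 3) (Fin 3) ℝ :=
  matCLMSymm (∫ θ, matCLM (conjHess H θ x) ∂ν)

lemma continuous_matCLM_conjHess (hc : Continuous H) : Continuous fun p : SO3 × E3 => matCLM (conjHess H p.1 p.2) :=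
  continuous_matCLM.comp (continuous_conj_hess hc)

theorem exists_isPotential_mean [ν.IsMulLeftInvariant] (hp : IsPotential supportO smoothO g H) :
    ∃ F G, IsPotential (fun x => meanSupport ν * ‖x‖) F G (meanHess ν H) := by
  set f' : SO3 → E3 → ℝ := fun θ x => smoothO (matCLM (negMat θ).transpose x)
  set g' : SO3 → E3 → E3 := fun θ x => matCLM (negMat θ) (g (matCLM (negMat θ).transpose x))
  have hpθ := fun θ => hp.comp_transpose (negMat θ)
  have cf : Continuous fun p : SO3 × E3 => f' p.1 p.2 :=
    contDiff_smoothO.continuous.comp continuous_matCLM_negMat_transpose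
  have cg : Continuous fun p : SO3 × E3 => g' p.1 p.2 :=
    (continuous_matCLM.comp (continuous_negMat.comp continuous_fst)).clm_apply
      (hp.continuous_gradient.comp continuous_matCLM_negMat_transpose)
  have bf : ∀ R, ∃ C, ∀ θ x, ‖x‖ ≤ R → ‖f' θ x‖ ≤ C := fun R => by
    obtain ⟨C, hC⟩ := exists_bound_of_continuous contDiff_smoothO.continuous R
    exact ⟨C, fun θ x hx => hC _ (by rwa [norm_matCLM_transpose])⟩
  have bg : ∀ R, ∃ C, ∀ θ x, ‖x‖ ≤ R → ‖g' θ x‖ ≤ C := fun R => by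
    obtain ⟨C, hC⟩ := exists_bound_of_continuous hp.continuous_gradient R
    exact ⟨C, fun θ x hx => by
      rw [norm_matCLM (negMat_transpose_mul θ)]; exact hC _ (by rwa [norm_matCLM_transpose])⟩
  have iff := integrable_of_locally_bounded ν cf bf
  have ig := integrable_of_locally_bounded ν cg bg
  refine ⟨fun x => ∫ θ, f' θ x ∂ν, fun x => ∫ θ, g' θ x ∂ν, ?_, ?_, ?_, ?_, ?_⟩
  · intro x
    have := hasFDerivAt_integral_of_locally_bounded ν (φ' := fun θ x => innerSL ℝ (g' θ x)) cf bf
      ((innerSL ℝ).continuous.comp cg) (fun R => ?_) (fun θ x => (hpθ θ).hasGrad x) x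
    · rwa [ContinuousLinearMap.integral_comp_comm _ (ig x)] at this
    · obtain ⟨C, hC⟩ := bg R
      exact ⟨C, fun θ x hx => by rw [innerSL_apply_norm]; exact hC θ x hx⟩
  · intro x
    have := hasFDerivAt_integral_of_locally_bounded ν cg bg (continuous_matCLM_conjHess hp.cont)
      (locally_bounded_conjHess hp.cont) (fun θ x => (hpθ θ).hasHess x) x
    refine this.congr_fderiv (matCLM_matCLMSymm _).symm
  · intro x y
    have e : (∫ θ, f' θ x ∂ν) + inner ℝ (∫ θ, g' θ x ∂ν) (y - x) =
        ∫ θ, (f' θ x + inner ℝ (g' θ x) (y - x)) ∂ν := by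
      rw [integral_add (iff x) ((ig x).inner_const _), real_inner_comm, ← integral_inner (ig x)]
      simp only [real_inner_comm]
    rw [e]
    exact integral_mono ((iff x).add ((ig x).inner_const _)) (iff y) fun θ => (hpθ θ).grad_le x y
  · refine ⟨2, fun x => ?_⟩
    rw [← integral_supportO, ← integral_sub (iff x) (integrable_supportO ν x), ← Real.norm_eq_abs]
    refine (norm_integral_le_of_norm_le_const (C := 2)
      (Filter.Eventually.of_forall fun θ => abs_smoothO_sub_le _)).trans ?_
    simp
  · exact (LinearMap.continuous_of_finiteDimensional matCLMSymm).comp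
      (continuous_integral_of_locally_bounded ν (continuous_matCLM_conjHess hp.cont)
        (locally_bounded_conjHess hp.cont))

lemma lintegral_mixedVol (hp : IsPotential supportO smoothO g H) :
    ∫⁻ θ, mixedVol H (negMat θ) ∂ν = ∫⁻ x, ENNReal.ofReal ((H x).adjugate * meanHess ν H x).trace := by
  simp only [mixedVol]
  rw [lintegral_lintegral_swap (continuous_mixed_integrand hp.cont).measurable.ennreal_ofReal.aemeasurable]
  congr 1 with x
  have hi := integrable_of_locally_bounded (φ := fun θ x => matCLM (conjHess H θ x)) ν
    (continuous_matCLM_conjHess hp.cont) (locally_bounded_conjHess hp.cont) x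
  let L : (E3 →L[ℝ] E3) →ₗ[ℝ] ℝ :=
    Matrix.traceLinearMap (Fin 3) ℝ ℝ ∘ₗ LinearMap.mulLeft ℝ (H x).adjugate ∘ₗ matCLMSymm
  have hL : ∀ T, LinearMap.toContinuousLinearMap L T = ((H x).adjugate * matCLMSymm T).trace := fun T => rfl
  rw [meanHess, ← hL, ← ContinuousLinearMap.integral_comp_comm _ hi, ofReal_integral_eq_lintegral_ofReal]
  · simp only [hL, matCLMSymm_matCLM, conjHess]
  · exact ContinuousLinearMap.integrable_comp _ hi
  · refine Filter.Eventually.of_forall fun θ => ?_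
    simp only [hL, matCLMSymm_matCLM, Pi.zero_apply]
    exact trace_adjugate_mul_nonneg (hp.posSemidef x) ((hp.comp_transpose (negMat θ)).posSemidef x)

end

/-- The point of `ℝ³` with second coordinate `y` and remaining coordinates `w`. -/
def mkPoint (p : ℝ × (ℝ × ℝ)) : EuclideanSpace ℝ (Fin 3) := !₂[p.2.1, p.1, p.2.2]

@[simp] lemma mkPoint_zero (p : ℝ × (ℝ × ℝ)) : mkPoint p 0 = p.2.1 := rfl

@[simp] lemma mkPoint_one (p : ℝ × (ℝ × ℝ)) : mkPoint p 1 = p.1 := rfl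

@[simp] lemma mkPoint_two (p : ℝ × (ℝ × ℝ)) : mkPoint p 2 = p.2.2 := rfl

/-- The coordinates of a point of `ℝ³`, in the order expected by `mkPoint`. -/
def pointEquiv : EuclideanSpace ℝ (Fin 3) ≃ᵐ ℝ × (ℝ × ℝ) :=
  ((MeasurableEquiv.toLp 2 (Fin 3 → ℝ)).symm.trans (MeasurableEquiv.piFinSuccAbove (fun _ => ℝ) 1)).trans
    ((MeasurableEquiv.refl ℝ).prodCongr MeasurableEquiv.finTwoArrow)

lemma measurePreserving_pointEquiv : MeasurePreserving pointEquiv := by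
  have h1 := PiLp.volume_preserving_ofLp (Fin 3)
  have h2 := volume_preserving_piFinSuccAbove (fun _ : Fin 3 => ℝ) 1
  have h3 := (MeasurePreserving.id (volume : Measure ℝ)).prod (volume_preserving_finTwoArrow ℝ)
  exact h3.comp (h2.comp h1)

lemma mkPoint_eq : mkPoint = pointEquiv.symm := by
  ext1 p
  rw [MeasurableEquiv.eq_symm_apply]
  rfl

lemma measurePreserving_mkPoint : MeasurePreserving mkPoint := by
  rw [mkPoint_eq]; exact measurePreserving_pointEquiv.symm

/-- The length of the section of `S` by the line parallel to the second axis through `w`. -/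
def sectionLength (S : Set (EuclideanSpace ℝ (Fin 3))) (w : ℝ × ℝ) : ENNReal :=
  volume {y : ℝ | mkPoint (y, w) ∈ S}

lemma measurable_sectionLength {S : Set E3} (hS : MeasurableSet S) : Measurable (sectionLength S) :=
  measurable_measure_prodMk_right (measurePreserving_mkPoint.measurable hS)

lemma volume_eq_lintegral_sectionLength {S : Set E3} (hS : MeasurableSet S) :
    volume S = ∫⁻ w, sectionLength S w := by
  rw [← measurePreserving_mkPoint.measure_preimage hS.nullMeasurableSet, Measure.volume_eq_prod,
    Measure.prod_apply_symm (measurePreserving_mkPoint.measurable hS)]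
  rfl

lemma lintegral_eq_two_mul_of_even {f : ℝ → ENNReal} (hf : ∀ x, f (-x) = f x) :
    ∫⁻ x, f x = 2 * ∫⁻ x in Set.Ioi 0, f x := by
  have h1 : ∫⁻ x in Set.Iio 0, f x = ∫⁻ x in Set.Ioi 0, f x := by
    rw [← (Measure.measurePreserving_neg (volume : Measure ℝ)).setLIntegral_comp_preimage_emb
      (MeasurableEquiv.neg ℝ).measurableEmbedding f (Set.Ioi 0)]
    simp [hf]
  rw [← lintegral_add_compl f (measurableSet_Ioi (a := (0:ℝ))), Set.compl_Ioi,
    setLIntegral_congr Iio_ae_eq_Iic.symm, h1, two_mul]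

/-- The open quadrant. -/
def quadrant : Set (ℝ × ℝ) := Set.Ioi 0 ×ˢ Set.Ioi 0

lemma measurableSet_quadrant : MeasurableSet quadrant := measurableSet_Ioi.prod measurableSet_Ioi

lemma lintegral_eq_four_mul_quadrant {f : ℝ × ℝ → ENNReal} (hm : Measurable f) (h1 : ∀ x z, f (-x, z) = f (x, z))
    (h2 : ∀ x z, f (x, -z) = f (x, z)) : ∫⁻ w, f w = 4 * ∫⁻ w in quadrant, f w := by
  rw [Measure.volume_eq_prod, lintegral_prod _ hm.aemeasurable, quadrant, ← Measure.prod_restrict,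
    lintegral_prod _ hm.aemeasurable]
  simp only [fun x => lintegral_eq_two_mul_of_even (f := fun z => f (x, z)) (h2 x)]
  rw [lintegral_const_mul' _ _ (by simp), lintegral_eq_two_mul_of_even, ← mul_assoc]
  · norm_num
  · intro x; simp [h1]

/-- The triangle over which the sections of the oloid are nonempty. -/
def triangle : Set (ℝ × ℝ) := {w | 0 < w.1 ∧ 0 < w.2 ∧ w.1 + w.2 < 1}

lemma isOpen_triangle : IsOpen triangle := by
  refine IsOpen.inter (isOpen_lt continuous_const continuous_fst) (IsOpen.inter
    (isOpen_lt continuous_const continuous_snd) (isOpen_lt (continuous_fst.add continuous_snd) continuous_const))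

lemma triangle_subset_quadrant : triangle ⊆ quadrant := fun _ h => ⟨h.1, h.2.1⟩

/-- The body `Ω + t B` (`B` the unit ball). -/
def parallelBody (t : ℝ) : Set (EuclideanSpace ℝ (Fin 3)) := bodyOf fun x => supportO x + t * ‖x‖

lemma isClosed_parallelBody (t : ℝ) : IsClosed (parallelBody t) := isClosed_bodyOf _

lemma parallelBody_zero : parallelBody 0 = oloid := by simp [parallelBody, oloid_eq_bodyOf]

lemma parallelBody_mono {s t : ℝ} (h : s ≤ t) : parallelBody s ⊆ parallelBody t := fun _ hy x =>
  (hy x).trans (add_le_add le_rfl (mul_le_mul_of_nonneg_right h (norm_nonneg x)))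

lemma add_mem_parallelBody {p v : E3} {t : ℝ} (hp : p ∈ oloid) (hv : ‖v‖ ≤ t) : p + v ∈ parallelBody t := fun x => by
  rw [oloid_eq_bodyOf] at hp
  rw [inner_add_left]
  exact add_le_add (hp x) ((real_inner_le_norm v x).trans (by gcongr))

lemma mem_parallelBody_of_isometry {t : ℝ} {σ : E3 → E3} (h1 : ∀ x y, inner ℝ (σ x) y = (inner ℝ x (σ y) : ℝ))
    (h2 : ∀ x, supportO (σ x) = supportO x) (h3 : ∀ x, ‖σ x‖ = ‖x‖) {q : E3} (hq : q ∈ parallelBody t) :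
    σ q ∈ parallelBody t := fun x => by
  rw [h1]
  refine (hq (σ x)).trans ?_
  beta_reduce
  rw [h2, h3]

lemma neg_fst_mem_parallelBody {t x y z : ℝ} (h : mkPoint (y, (x, z)) ∈ parallelBody t) :
    mkPoint (y, (-x, z)) ∈ parallelBody t := by
  refine mem_parallelBody_of_isometry (σ := fun q => mkPoint (q 1, (-q 0, q 2))) (fun x y => ?_) (fun x => ?_)
    (fun x => ?_) h
  · simp [inner_eq_sum]
  · simp [supportO, supportA, supportB]
  · rw [← sq_eq_sq₀ (norm_nonneg _) (norm_nonneg _), norm_sq_eq_sum, norm_sq_eq_sum]; simp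

lemma neg_snd_mem_parallelBody {t x y z : ℝ} (h : mkPoint (y, (x, z)) ∈ parallelBody t) :
    mkPoint (y, (x, -z)) ∈ parallelBody t := by
  refine mem_parallelBody_of_isometry (σ := fun q => mkPoint (q 1, (q 0, -q 2))) (fun x y => ?_) (fun x => ?_)
    (fun x => ?_) h
  · simp [inner_eq_sum]
  · simp [supportO, supportA, supportB]
  · rw [← sq_eq_sq₀ (norm_nonneg _) (norm_nonneg _), norm_sq_eq_sum, norm_sq_eq_sum]; simp

lemma swap_mem_parallelBody {t x y z : ℝ} (h : mkPoint (y, (x, z)) ∈ parallelBody t) :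
    mkPoint (-y, (z, x)) ∈ parallelBody t := by
  refine mem_parallelBody_of_isometry (σ := fun q => mkPoint (-q 1, (q 2, q 0))) (fun x y => ?_) (fun x => ?_)
    (fun x => ?_) h
  · simp [inner_eq_sum]; ring
  · simp only [supportO, supportA, supportB, mkPoint_zero, mkPoint_one, mkPoint_two]
    rw [max_comm]
    congr 1
    · rw [neg_sq, add_comm (x 1 ^ 2), neg_div, sub_eq_add_neg]
    · rw [neg_sq, add_comm (x 1 ^ 2), neg_div, sub_neg_eq_add]
  · rw [← sq_eq_sq₀ (norm_nonneg _) (norm_nonneg _), norm_sq_eq_sum, norm_sq_eq_sum]; simp; ring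

lemma sectionLength_parallelBody_neg_fst (t x z : ℝ) :
    sectionLength (parallelBody t) (-x, z) = sectionLength (parallelBody t) (x, z) := by
  rw [sectionLength, sectionLength]
  congr 1 with y
  exact ⟨fun h => by simpa using neg_fst_mem_parallelBody h, neg_fst_mem_parallelBody⟩

lemma sectionLength_parallelBody_neg_snd (t x z : ℝ) :
    sectionLength (parallelBody t) (x, -z) = sectionLength (parallelBody t) (x, z) := by
  rw [sectionLength, sectionLength]
  congr 1 with y
  exact ⟨fun h => by simpa using neg_snd_mem_parallelBody h, neg_snd_mem_parallelBody⟩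

lemma volume_parallelBody (t : ℝ) :
    volume (parallelBody t) = 4 * ∫⁻ w in quadrant, sectionLength (parallelBody t) w := by
  have hm := (isClosed_parallelBody t).measurableSet
  rw [volume_eq_lintegral_sectionLength hm, lintegral_eq_four_mul_quadrant (measurable_sectionLength hm)
    (sectionLength_parallelBody_neg_fst t) (sectionLength_parallelBody_neg_snd t)]

/-- Projection to the `(x, z)`-plane of the segment of parameter `p.1` generating the boundary of the oloid. -/
def chart (p : ℝ × ℝ) : ℝ × ℝ := ((1 - p.2) * sin (alpha p.1), p.2 * sin p.1)

/-- The domain of `chart`. -/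
def chartDomain : Set (ℝ × ℝ) := Set.Ioo 0 (π/2) ×ˢ Set.Ioo 0 1

lemma mem_Icc_of_mem_chartDomain {p : ℝ × ℝ} (hp : p ∈ chartDomain) : p.1 ∈ Set.Icc 0 (π/2) :=
  ⟨hp.1.1.le, hp.1.2.le⟩

lemma cos_pos_of_mem_chartDomain {p : ℝ × ℝ} (hp : p ∈ chartDomain) : 0 < cos p.1 :=
  cos_pos_of_mem_Ioo ⟨by linarith [hp.1.1, pi_pos], hp.1.2⟩

lemma sin_pos_of_mem_chartDomain {p : ℝ × ℝ} (hp : p ∈ chartDomain) : 0 < sin p.1 :=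
  sin_pos_of_pos_of_lt_pi hp.1.1 (by linarith [hp.1.2, pi_pos])

lemma sin_alpha_pos {b : ℝ} (hb : b ∈ Set.Icc 0 (π/2)) : 0 < sin (alpha b) := by
  rw [sin_alpha hb]
  exact div_pos (sqrt_pos.2 (one_add_two_cos_pos hb)) (one_add_cos_pos hb)

lemma sin_alpha_lt {b b' : ℝ} (hb : b ∈ Set.Icc 0 (π/2)) (hb' : b' ∈ Set.Icc 0 (π/2)) (h : b < b') :
    sin (alpha b) < sin (alpha b') := by
  have h1 : cos b' < cos b := cos_lt_cos_of_nonneg_of_le_pi hb.1 (by linarith [hb'.2, pi_pos]) h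
  have p1 := one_add_cos_pos hb
  have p2 := one_add_cos_pos hb'
  have h2 : cos b' / (1 + cos b') < cos b / (1 + cos b) := by
    rw [div_lt_div_iff₀ p2 p1]; nlinarith
  have h3 := (alpha_arg hb').1
  have e1 := sin_sq_add_cos_sq (alpha b)
  have e2 := sin_sq_add_cos_sq (alpha b')
  rw [cos_alpha hb] at e1
  rw [cos_alpha hb'] at e2
  nlinarith [sin_alpha_pos hb, sin_alpha_pos hb']

lemma chart_injOn : Set.InjOn chart chartDomain := by
  have key : ∀ p ∈ chartDomain, ∀ q ∈ chartDomain, p.1 < q.1 → chart p ≠ chart q := by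
    rintro p hp q hq h e
    have e1 : (1 - p.2) * sin (alpha p.1) = (1 - q.2) * sin (alpha q.1) := congrArg Prod.fst e
    have e2 : p.2 * sin p.1 = q.2 * sin q.1 := congrArg Prod.snd e
    have h1 := sin_alpha_lt (mem_Icc_of_mem_chartDomain hp) (mem_Icc_of_mem_chartDomain hq) h
    have h2 : sin p.1 < sin q.1 := sin_lt_sin_of_lt_of_le_pi_div_two (by linarith [hp.1.1, pi_pos]) hq.1.2.le h
    have h3 := sin_alpha_pos (mem_Icc_of_mem_chartDomain hp)
    have h4 := sin_pos_of_mem_chartDomain hp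
    have h5 := hp.2.1
    have h6 := hp.2.2
    have h7 := hq.2.1
    have h8 := hq.2.2
    rcases le_or_gt p.2 q.2 with hle | hlt
    · nlinarith
    · nlinarith
  intro p hp q hq e
  rcases lt_trichotomy p.1 q.1 with h | h | h
  · exact absurd e (key p hp q hq h)
  · have e2 : p.2 * sin p.1 = q.2 * sin q.1 := congrArg Prod.snd e
    rw [h] at e2
    exact Prod.ext h (mul_right_cancel₀ (sin_pos_of_mem_chartDomain hq).ne' e2)
  · exact absurd e.symm (key q hq p hp h)

lemma chart_image : chart '' chartDomain = triangle := by
  apply Set.Subset.antisymm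
  · rintro _ ⟨p, hp, rfl⟩
    have h1 := sin_alpha_pos (mem_Icc_of_mem_chartDomain hp)
    have h2 := sin_pos_of_mem_chartDomain hp
    have h3 : sin p.1 < 1 := by
      nlinarith [sin_sq_add_cos_sq p.1, cos_pos_of_mem_chartDomain hp]
    have h4 := hp.2.1
    have h5 := hp.2.2
    have h6 := sin_le_one (alpha p.1)
    exact ⟨mul_pos (by linarith) h1, mul_pos h4 h2, by simp only [chart]; nlinarith⟩
  · rintro ⟨x, z⟩ ⟨hx, hz, hxz⟩
    simp only at hx hz hxz
    have hz1 : z < 1 := by linarith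
    have m0 : 0 < arcsin z := arcsin_pos.2 hz
    have m1 : arcsin z < π/2 := arcsin_lt_pi_div_two.2 hz1
    have hs : ∀ b ∈ Set.Icc (arcsin z) (π/2), 0 < sin b := fun b hb =>
      sin_pos_of_pos_of_lt_pi (by linarith [hb.1]) (by linarith [hb.2, pi_pos])
    have hc : ContinuousOn (fun b => sin (alpha b) * (1 - z / sin b)) (Set.Icc (arcsin z) (π/2)) := by
      refine (continuous_sin.comp_continuousOn
        (continuousOn_alpha.mono (Set.Icc_subset_Icc_left m0.le))).mul (continuousOn_const.sub ?_)
      exact continuousOn_const.div continuous_sin.continuousOn fun b hb => (hs b hb).ne'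
    have he1 : sin (alpha (arcsin z)) * (1 - z / sin (arcsin z)) = 0 := by
      rw [sin_arcsin (by linarith) hz1.le, div_self hz.ne', sub_self, mul_zero]
    have he2 : sin (alpha (π/2)) * (1 - z / sin (π/2)) = 1 - z := by
      rw [alpha_pi_div_two, sin_pi_div_two]; ring
    obtain ⟨b, hb, e⟩ := intermediate_value_Ioo m1.le hc (show x ∈ Set.Ioo _ _ by
      rw [he1, he2]; exact ⟨hx, by linarith⟩)
    simp only at e
    have hsb := hs b ⟨hb.1.le, hb.2.le⟩
    have hlt : z < sin b := by
      have := sin_lt_sin_of_lt_of_le_pi_div_two (by linarith [pi_pos]) hb.2.le hb.1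
      rwa [sin_arcsin (by linarith) hz1.le] at this
    refine ⟨(b, z / sin b), ⟨⟨m0.trans hb.1, hb.2⟩, div_pos hz hsb, (div_lt_one hsb).2 hlt⟩, ?_⟩
    refine Prod.ext ?_ ?_
    · simp only [chart]; rw [← e]; ring
    · simp only [chart]; field_simp

/-- The Jacobian of `chart`. -/
def chartJac (p : ℝ × ℝ) : ℝ :=
  cos p.1 / ((1 + cos p.1) * √(1 + 2 * cos p.1)) * (1 - cos p.1 + 3 * cos p.1 * p.2)

/-- The derivative of `chart`. -/
def chartFDeriv (p : ℝ × ℝ) : ℝ × ℝ →L[ℝ] ℝ × ℝ :=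
  (Matrix.toLin (.finTwoProd ℝ) (.finTwoProd ℝ)
    !![(1 - p.2) * (cos (alpha p.1) * (sin p.1 / ((1 + cos p.1) * √(1 + 2 * cos p.1)))), - sin (alpha p.1);
      p.2 * cos p.1, sin p.1]).toContinuousLinearMap

lemma hasFDerivAt_chart {p : ℝ × ℝ} (hp : p ∈ chartDomain) : HasFDerivAt chart (chartFDeriv p) p := by
  unfold chartFDeriv
  rw [Matrix.toLin_finTwoProd_toContinuousLinearMap]
  have ha := (hasDerivAt_alpha (mem_Icc_of_mem_chartDomain hp)).sin
  refine (HasFDerivAt.prodMk (𝕜 := ℝ)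
      ((hasFDerivAt_snd.const_sub 1).mul (ha.comp_hasFDerivAt p hasFDerivAt_fst))
      (hasFDerivAt_snd.mul ((hasDerivAt_sin p.1).comp_hasFDerivAt p hasFDerivAt_fst))).congr_fderiv ?_
  ext <;> simp

lemma abs_det_chartFDeriv {p : ℝ × ℝ} (hp : p ∈ chartDomain) : |(chartFDeriv p).det| = chartJac p := by
  have hb := mem_Icc_of_mem_chartDomain hp
  have h1 := one_add_cos_pos hb
  have h2 := cos_pos_of_mem_chartDomain hp
  have h3 := sqrt_pos.2 (one_add_two_cos_pos hb)
  have h4 := cos_le_one p.1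
  have h5 := hp.2.1
  have hq := sq_sqrt (one_add_two_cos_pos hb).le
  have : (chartFDeriv p).det = chartJac p := by
    unfold chartFDeriv
    simp only [LinearMap.det_toContinuousLinearMap, LinearMap.det_toLin, Matrix.det_fin_two_of]
    rw [cos_alpha hb, sin_alpha hb, chartJac]
    have hs := sin_sq_add_cos_sq p.1
    rw [mul_comm 2 (cos p.1)] at hq ⊢
    field_simp
    rw [show sin p.1 ^ 2 = (1 - cos p.1) * (1 + cos p.1) by linear_combination hs, hq]
    ring
  rw [this, abs_of_nonneg]
  rw [chartJac]
  have : 0 ≤ 1 - cos p.1 + 3 * cos p.1 * p.2 := by nlinarith [mul_pos h2 h5]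
  positivity

lemma isOpen_chartDomain : IsOpen chartDomain := isOpen_Ioo.prod isOpen_Ioo

lemma integral_triangle {F k : ℝ × ℝ → ℝ} (hk : ContinuousOn k (Set.Icc 0 (π/2) ×ˢ Set.Icc 0 1))
    (h : ∀ p ∈ chartDomain, chartJac p * F (chart p) = k p) :
    IntegrableOn F triangle ∧ ∫ w in triangle, F w = ∫ b in (0:ℝ)..(π/2), ∫ l in (0:ℝ)..1, k (b, l) := by
  have hi : IntegrableOn k (Set.Icc 0 (π/2) ×ˢ Set.Icc 0 1) := hk.integrableOn_compact (isCompact_Icc.prod isCompact_Icc)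
  have hsub : chartDomain ⊆ Set.Icc 0 (π/2) ×ˢ Set.Icc 0 1 :=
    Set.prod_mono Set.Ioo_subset_Icc_self Set.Ioo_subset_Icc_self
  have hd : ∀ p ∈ chartDomain, HasFDerivWithinAt chart (chartFDeriv p) chartDomain p :=
    fun p hp => (hasFDerivAt_chart hp).hasFDerivWithinAt
  have hm := isOpen_chartDomain.measurableSet
  have heq : Set.EqOn (fun p => |(chartFDeriv p).det| • F (chart p)) k chartDomain := fun p hp => by
    simp only [smul_eq_mul]; rw [abs_det_chartFDeriv hp, h p hp]
  constructor
  · rw [← chart_image, integrableOn_image_iff_integrableOn_abs_det_fderiv_smul _ hm hd chart_injOn,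
      integrableOn_congr_fun heq hm]
    exact hi.mono_set hsub
  · rw [← chart_image, integral_image_eq_integral_abs_det_fderiv_smul _ hm hd chart_injOn,
      setIntegral_congr_fun hm heq, chartDomain, Measure.volume_eq_prod, setIntegral_prod _ (hi.mono_set hsub),
      intervalIntegral.integral_of_le (by positivity), integral_Ioc_eq_integral_Ioo]
    simp only [intervalIntegral.integral_of_le zero_le_one, integral_Ioc_eq_integral_Ioo]

/-- The inverse of `chart`. -/
def chartInv : ℝ × ℝ → ℝ × ℝ := Function.invFunOn chart chartDomain

lemma chartInv_chart {p : ℝ × ℝ} (hp : p ∈ chartDomain) : chartInv (chart p) = p :=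
  chart_injOn.leftInvOn_invFunOn hp

/-- The height of the boundary point of the oloid with parameters `p`. -/
def topHeight (p : ℝ × ℝ) : ℝ := (1 - p.2) * (cos p.1 / (1 + cos p.1) - 1/2) + p.2 * (1/2 + cos p.1)

/-- The area density of the boundary of the oloid at the point with parameters `p`. -/
def slant (p : ℝ × ℝ) : ℝ := √(2 * (1 + cos p.1)) / cos p.1

lemma integral_zero_one_quadratic (a b d : ℝ) : ∫ l in (0:ℝ)..1, (a + b * l + d * l^2) = a + b/2 + d/3 := by
  rw [intervalIntegral.integral_add (Continuous.intervalIntegrable (by fun_prop) _ _)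
    (Continuous.intervalIntegrable (by fun_prop) _ _), intervalIntegral.integral_add
    (Continuous.intervalIntegrable (by fun_prop) _ _) (Continuous.intervalIntegrable (by fun_prop) _ _),
    intervalIntegral.integral_const_mul, intervalIntegral.integral_const_mul]
  simp
  ring

lemma continuousOn_of_mem_Icc {k : ℝ × ℝ → ℝ} (h : ∀ p : ℝ × ℝ, p.1 ∈ Set.Icc 0 (π/2) → ContinuousAt k p) :
    ContinuousOn k (Set.Icc 0 (π/2) ×ˢ Set.Icc 0 1) := fun p hp => (h p hp.1).continuousWithinAt

lemma integral_topHeight : IntegrableOn (topHeight ∘ chartInv) triangle ∧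
    8 * ∫ w in triangle, (topHeight ∘ chartInv) w = 2/3 * (2 * ellipticE (√3/2) + ellipticK (√3/2)) := by
  have hk : ContinuousOn (fun p => chartJac p * topHeight p) (Set.Icc 0 (π/2) ×ˢ Set.Icc 0 1) := by
    refine continuousOn_of_mem_Icc fun p hp => ?_
    have p1 := one_add_cos_pos hp
    have p2 := sqrt_pos.2 (one_add_two_cos_pos hp)
    unfold chartJac topHeight
    fun_prop (disch := positivity)
  obtain ⟨h1, h2⟩ := integral_triangle (F := topHeight ∘ chartInv) hk
    fun p hp => by rw [Function.comp_apply, chartInv_chart hp]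
  refine ⟨h1, ?_⟩
  rw [h2, ← integral_volume_density, ← intervalIntegral.integral_const_mul]
  refine intervalIntegral.integral_congr fun b hb => ?_
  rw [Set.uIcc_of_le (by positivity)] at hb
  have p1 := one_add_cos_pos hb
  have p2 := sqrt_pos.2 (one_add_two_cos_pos hb)
  have e : ∀ l, chartJac (b, l) * topHeight (b, l) =
      cos b / ((1 + cos b)^2 * √(1 + 2 * cos b)) * (-(1 - cos b)^2/2) +
      cos b / ((1 + cos b)^2 * √(1 + 2 * cos b)) * ((1 - cos b) * (1 + cos b + cos b^2) - 3 * cos b * (1 - cos b)/2) * l +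
      cos b / ((1 + cos b)^2 * √(1 + 2 * cos b)) * (3 * cos b * (1 + cos b + cos b^2)) * l^2 := fun l => by
    simp only [chartJac, topHeight]
    field_simp
    ring
  simp only [e, integral_zero_one_quadratic]
  field_simp
  ring

lemma integral_slant : IntegrableOn (slant ∘ chartInv) triangle ∧
    ∫ w in triangle, (slant ∘ chartInv) w = π / 2 := by
  have hk : ContinuousOn (fun p => √2 / (√(1 + cos p.1) * √(1 + 2 * cos p.1)) * (1 - cos p.1 + 3 * cos p.1 * p.2))
      (Set.Icc 0 (π/2) ×ˢ Set.Icc 0 1) := by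
    refine continuousOn_of_mem_Icc fun p hp => ?_
    have p1 := sqrt_pos.2 (one_add_cos_pos hp)
    have p2 := sqrt_pos.2 (one_add_two_cos_pos hp)
    fun_prop (disch := positivity)
  obtain ⟨h1, h2⟩ := integral_triangle (F := slant ∘ chartInv) hk fun p hp => by
    have p0 := cos_pos_of_mem_chartDomain hp
    have p1 := one_add_cos_pos (mem_Icc_of_mem_chartDomain hp)
    have p2 := sqrt_pos.2 (one_add_two_cos_pos (mem_Icc_of_mem_chartDomain hp))
    have p3 := sqrt_pos.2 p1
    rw [Function.comp_apply, chartInv_chart hp, chartJac, slant, sqrt_mul zero_le_two]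
    have e := sq_sqrt p1.le
    field_simp
    rw [e]
    ring
  refine ⟨h1, ?_⟩
  have : π / 2 = ∫ b in (0:ℝ)..(π/2), √2 / 2 * ((2 + cos b) / (√(1 + cos b) * √(1 + 2 * cos b))) := by
    rw [intervalIntegral.integral_const_mul, integral_area_density]
    have := mul_self_sqrt (zero_le_two (α := ℝ))
    linear_combination (-π/4) * this
  rw [h2]
  refine Eq.trans ?_ this.symm
  refine intervalIntegral.integral_congr fun b hb => ?_
  rw [Set.uIcc_of_le (by positivity)] at hb
  have p1 := sqrt_pos.2 (one_add_cos_pos hb)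
  have p2 := sqrt_pos.2 (one_add_two_cos_pos hb)
  have e : ∀ l, √2 / (√(1 + cos b) * √(1 + 2 * cos b)) * (1 - cos b + 3 * cos b * l) =
      √2 / (√(1 + cos b) * √(1 + 2 * cos b)) * (1 - cos b) +
      √2 / (√(1 + cos b) * √(1 + 2 * cos b)) * (3 * cos b) * l + 0 * l^2 := fun l => by ring
  simp only [e, integral_zero_one_quadratic]
  field_simp
  ring

/-- An outer normal of the oloid along the segment of parameter `b`. -/
def normalVec (b : ℝ) : EuclideanSpace ℝ (Fin 3) := mkPoint (cos b, (√(1 + 2 * cos b), sin b))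

lemma inner_mkPoint (p q : ℝ × (ℝ × ℝ)) :
    (inner ℝ (mkPoint p) (mkPoint q) : ℝ) = p.2.1 * q.2.1 + p.1 * q.1 + p.2.2 * q.2.2 := by
  rw [inner_eq_sum]; rfl

lemma norm_normalVec {b : ℝ} (hb : b ∈ Set.Icc 0 (π/2)) : ‖normalVec b‖ = √(2 * (1 + cos b)) := by
  have h1 := one_add_cos_pos hb
  rw [eq_comm, sqrt_eq_iff_eq_sq (by positivity) (norm_nonneg _), norm_sq_eq_sum, normalVec]
  simp only [mkPoint_zero, mkPoint_one, mkPoint_two]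
  rw [sq_sqrt (one_add_two_cos_pos hb).le]
  linear_combination - sin_sq_add_cos_sq b

lemma supportO_normalVec {b : ℝ} (hb : b ∈ Set.Icc 0 (π/2)) : supportO (normalVec b) = 1 + cos b / 2 := by
  have h1 := one_add_cos_pos hb
  rw [supportO, supportA, supportB, normalVec]
  simp only [mkPoint_zero, mkPoint_one, mkPoint_two]
  rw [sq_sqrt (one_add_two_cos_pos hb).le, cos_sq_add_sin_sq, sqrt_one,
    show 1 + 2 * cos b + cos b^2 = (1 + cos b)^2 by ring, sqrt_sq h1.le,
    show 1 + cos b - cos b / 2 = 1 + cos b / 2 by ring, max_self]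

lemma le_topHeight {p : ℝ × ℝ} (hp : p ∈ chartDomain) {t y : ℝ} (h : mkPoint (y, chart p) ∈ parallelBody t) :
    y ≤ topHeight p + t * slant p := by
  have hb := mem_Icc_of_mem_chartDomain hp
  have h1 := one_add_cos_pos hb
  have h2 := cos_pos_of_mem_chartDomain hp
  have := h (normalVec p.1)
  beta_reduce at this
  rw [norm_normalVec hb, supportO_normalVec hb, normalVec, inner_mkPoint] at this
  simp only [chart, sin_alpha hb] at this
  have e := mul_self_sqrt (one_add_two_cos_pos hb).le
  have hs := sin_sq_add_cos_sq p.1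
  have e1 : (1 - p.2) * (√(1 + 2 * cos p.1) / (1 + cos p.1)) * √(1 + 2 * cos p.1) =
      (1 - p.2) * (1 + 2 * cos p.1) / (1 + cos p.1) := by
    rw [div_eq_mul_inv, div_eq_mul_inv]
    linear_combination (1 - p.2) * (1 + cos p.1)⁻¹ * e
  rw [e1] at this
  refine le_of_mul_le_mul_right ?_ h2
  have e2 : (topHeight p + t * slant p) * cos p.1 = 1 + cos p.1 / 2 + t * √(2 * (1 + cos p.1)) -
      (1 - p.2) * (1 + 2 * cos p.1) / (1 + cos p.1) - p.2 * sin p.1 * sin p.1 := by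
    rw [topHeight, slant]
    field_simp
    linear_combination (2 * p.2 * (1 + cos p.1)) * hs
  rw [e2]; linarith

lemma mkPoint_mem_oloid {l x y z : ℝ} (hl0 : 0 < l) (hl1 : l < 1) (hx : x^2 ≤ (1 - l)^2) (hz : z^2 ≤ l^2)
    (hy : |y - (l - 1/2)| ≤ √((1 - l)^2 - x^2) + √(l^2 - z^2)) : mkPoint (y, (x, z)) ∈ oloid := by
  have hl : 0 < 1 - l := by linarith
  obtain ⟨τ, hτ, e⟩ : ∃ τ : ℝ, τ^2 ≤ 1 ∧ y - (l - 1/2) = τ * (√((1 - l)^2 - x^2) + √(l^2 - z^2)) := by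
    rcases (add_nonneg (sqrt_nonneg ((1 - l)^2 - x^2)) (sqrt_nonneg (l^2 - z^2))).eq_or_lt with h | h
    · refine ⟨0, by norm_num, ?_⟩
      rw [← h] at hy
      rw [abs_nonpos_iff.1 hy, zero_mul]
    · refine ⟨(y - (l - 1/2)) / (√((1 - l)^2 - x^2) + √(l^2 - z^2)), ?_, (div_mul_cancel₀ _ h.ne').symm⟩
      rw [sq_le_one_iff_abs_le_one, abs_div, abs_of_pos h]
      exact (div_le_one h).2 hy
  have ea := sq_sqrt (sub_nonneg.2 hx)
  have eb := sq_sqrt (sub_nonneg.2 hz)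
  have ha : mkPoint (τ * √((1 - l)^2 - x^2) / (1 - l) - 1/2, (x / (1 - l), 0)) ∈ discA := by
    refine ⟨?_, rfl⟩
    simp only [mkPoint_zero, mkPoint_one, sub_add_cancel]
    rw [div_pow, div_pow, ← add_div, div_le_one (by positivity), mul_pow, ea]
    nlinarith [sq_nonneg x]
  have hb : mkPoint (τ * √(l^2 - z^2) / l + 1/2, (0, z / l)) ∈ discB := by
    refine ⟨?_, rfl⟩
    simp only [mkPoint_two, mkPoint_one, add_sub_cancel_right]
    rw [div_pow, div_pow, ← add_div, div_le_one (by positivity), mul_pow, eb]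
    nlinarith [sq_nonneg z]
  have := convex_oloid (convexHull_mono Set.subset_union_left (discA_subset_convexHull ha))
    (convexHull_mono Set.subset_union_right (discB_subset_convexHull hb)) hl.le hl0.le (by ring)
  convert this using 1
  ext i
  fin_cases i
  · simp; field_simp
  · simp only [Fin.mk_one, mkPoint_one, PiLp.add_apply, PiLp.smul_apply, smul_eq_mul]
    field_simp
    linear_combination 2 * e
  · simp; field_simp

lemma sq_sub_chart_fst {p : ℝ × ℝ} (hp : p ∈ chartDomain) :
    (1 - p.2)^2 - (chart p).1^2 = ((1 - p.2) * (cos p.1 / (1 + cos p.1)))^2 := by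
  rw [← cos_alpha (mem_Icc_of_mem_chartDomain hp), chart]
  linear_combination (-(1 - p.2)^2) * sin_sq_add_cos_sq (alpha p.1)

lemma sq_sub_chart_snd (p : ℝ × ℝ) : p.2^2 - (chart p).2^2 = (p.2 * cos p.1)^2 := by
  rw [chart]
  linear_combination (-p.2^2) * sin_sq_add_cos_sq p.1

lemma eventually_pos_of_hasDerivAt {G : ℝ → ℝ} {m : ℝ} (h : HasDerivAt G m 0) (h0 : G 0 = 0) (hm : 0 < m) :
    ∀ᶠ t in nhdsWithin 0 (Set.Ioi 0), 0 < G t := by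
  have := (hasDerivWithinAt_iff_tendsto_slope' (by simp)).1 (h.hasDerivWithinAt (s := Set.Ioi 0))
  filter_upwards [(tendsto_order.1 this).1 0 hm, self_mem_nhdsWithin] with t ht ht0
  rw [slope_def_field, h0, sub_zero, sub_zero] at ht
  exact (div_pos_iff_of_pos_right ht0).1 ht

lemma eventually_mem_parallelBody {p : ℝ × ℝ} (hp : p ∈ chartDomain) {s : ℝ} (hs : s < slant p) :
    ∀ᶠ t in nhdsWithin 0 (Set.Ioi 0), mkPoint (topHeight p + t * s, chart p) ∈ parallelBody t := by
  have hb := mem_Icc_of_mem_chartDomain hp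
  have h1 := one_add_cos_pos hb
  have h2 := cos_pos_of_mem_chartDomain hp
  have hq := one_add_two_cos_pos hb
  have hl0 := hp.2.1
  have hl1 : 0 < 1 - p.2 := by linarith [hp.2.2]
  set N := ‖normalVec p.1‖ with hN
  have hN' := norm_normalVec hb
  rw [← hN] at hN'
  have hNpos : 0 < N := by rw [hN']; positivity
  have hN2 : N^2 = 2 * (1 + cos p.1) := by rw [hN']; exact sq_sqrt (by positivity)
  have hsl : s < N / cos p.1 := by rwa [hN']
  set X : ℝ → ℝ := fun t => (chart p).1 + t * (-√(1 + 2 * cos p.1) / N) with hX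
  set Z : ℝ → ℝ := fun t => (chart p).2 + t * (-sin p.1 / N) with hZ
  set Y : ℝ → ℝ := fun t => topHeight p + t * (s - cos p.1 / N) with hY
  have ex := sq_sub_chart_fst hp
  have ez := sq_sub_chart_snd p
  have px : 0 < (1 - p.2) * (cos p.1 / (1 + cos p.1)) := by positivity
  have pz : 0 < p.2 * cos p.1 := by positivity
  have dX : HasDerivAt X (-√(1 + 2 * cos p.1) / N) 0 := by
    exact (((hasDerivAt_id' (0:ℝ)).mul_const (-√(1 + 2 * cos p.1) / N)).const_add ((chart p).1)).congr_deriv (one_mul _)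
  have dZ : HasDerivAt Z (-sin p.1 / N) 0 := by
    exact (((hasDerivAt_id' (0:ℝ)).mul_const (-sin p.1 / N)).const_add ((chart p).2)).congr_deriv (one_mul _)
  have dY : HasDerivAt Y (s - cos p.1 / N) 0 := by
    exact (((hasDerivAt_id' (0:ℝ)).mul_const (s - cos p.1 / N)).const_add (topHeight p)).congr_deriv (one_mul _)
  have X0 : X 0 = (chart p).1 := by simp [hX]
  have Z0 : Z 0 = (chart p).2 := by simp [hZ]
  have Y0 : Y 0 = topHeight p := by simp [hY]
  have sx : √((1 - p.2)^2 - X 0 ^2) = (1 - p.2) * (cos p.1 / (1 + cos p.1)) := by rw [X0, ex, sqrt_sq px.le]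
  have sz : √(p.2^2 - Z 0 ^2) = p.2 * cos p.1 := by rw [Z0, ez, sqrt_sq pz.le]
  have dx := ((dX.pow 2).const_sub ((1 - p.2)^2)).sqrt (by
    simp only [Pi.pow_apply]; rw [X0, ex]; positivity)
  have dz := ((dZ.pow 2).const_sub (p.2^2)).sqrt (by
    simp only [Pi.pow_apply]; rw [Z0, ez]; positivity)
  have dG := ((dx.add dz).const_add (p.2 - 1/2)).sub dY
  simp only [Pi.pow_apply] at dG
  rw [sx, sz, X0, Z0] at dG
  have evG := eventually_pos_of_hasDerivAt dG (by
    simp only [Pi.sub_apply, Pi.add_apply]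
    rw [sx, sz, Y0, topHeight]; ring) (by
    have e := sq_sqrt hq.le
    have hs2 := sin_sq_add_cos_sq p.1
    have : N / cos p.1 = √(1 + 2 * cos p.1)^2 / (N * cos p.1) + sin p.1 ^2 / (N * cos p.1) + cos p.1 / N := by
      generalize √(1 + 2 * cos p.1) = q at e
      field_simp
      rw [hN2, e]; linear_combination -hs2
    refine lt_of_lt_of_eq (sub_pos.2 hsl) ?_
    rw [this, chart, sin_alpha hb]
    generalize √(1 + 2 * cos p.1) = q
    have e1 : -(((2 : ℕ) : ℝ) * ((1 - p.2) * (q / (1 + cos p.1))) ^ (2 - 1) * (-q / N)) /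
        (2 * ((1 - p.2) * (cos p.1 / (1 + cos p.1)))) = q^2 / (N * cos p.1) := by
      rw [pow_one]; field_simp; push_cast; ring
    have e2 : -(((2 : ℕ) : ℝ) * (p.2 * sin p.1) ^ (2 - 1) * (-sin p.1 / N)) / (2 * (p.2 * cos p.1)) =
        sin p.1^2 / (N * cos p.1) := by
      rw [pow_one]; field_simp; push_cast; ring
    simp only [e1, e2]
    ring)
  have evX : ∀ᶠ t in nhdsWithin 0 (Set.Ioi 0), X t ^2 < (1 - p.2)^2 :=
    ((dX.continuousAt.pow 2).eventually_lt continuousAt_const (by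
      simp only [Pi.pow_apply]; rw [X0]; nlinarith)).filter_mono nhdsWithin_le_nhds
  have evZ : ∀ᶠ t in nhdsWithin 0 (Set.Ioi 0), Z t ^2 < p.2^2 :=
    ((dZ.continuousAt.pow 2).eventually_lt continuousAt_const (by
      simp only [Pi.pow_apply]; rw [Z0]; nlinarith)).filter_mono nhdsWithin_le_nhds
  have evY : ∀ᶠ t in nhdsWithin 0 (Set.Ioi 0), p.2 - 1/2 < Y t :=
    (continuousAt_const.eventually_lt dY.continuousAt (by
      rw [Y0, topHeight]; linarith)).filter_mono nhdsWithin_le_nhds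
  filter_upwards [evG, evX, evZ, evY, self_mem_nhdsWithin] with t hG hx hz hy ht
  have hm : mkPoint (Y t, (X t, Z t)) ∈ oloid := by
    refine mkPoint_mem_oloid hl0 hp.2.2 hx.le hz.le ?_
    rw [abs_of_pos (by linarith)]
    simp only [Pi.sub_apply, Pi.add_apply] at hG
    linarith
  have := add_mem_parallelBody (v := (t / N) • normalVec p.1) (t := t) hm (by
    rw [norm_smul, ← hN, norm_div, Real.norm_of_nonneg ht.le, Real.norm_of_nonneg hNpos.le, div_mul_cancel₀ _ hNpos.ne'])
  convert this using 1
  ext i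
  fin_cases i
  · simp [hX, normalVec]; ring
  · simp [hY, normalVec]; ring
  · simp [hZ, normalVec]; ring

lemma topHeight_mem_oloid {p : ℝ × ℝ} (hp : p ∈ chartDomain) : mkPoint (topHeight p, chart p) ∈ oloid := by
  have h1 := one_add_cos_pos (mem_Icc_of_mem_chartDomain hp)
  have h2 := cos_pos_of_mem_chartDomain hp
  have hl0 := hp.2.1
  have hl1 : 0 < 1 - p.2 := by linarith [hp.2.2]
  have ex := sq_sub_chart_fst hp
  have ez := sq_sub_chart_snd p
  refine mkPoint_mem_oloid (x := (chart p).1) (z := (chart p).2) hp.2.1 hp.2.2 ?_ ?_ ?_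
  · nlinarith [sq_nonneg ((1 - p.2) * (cos p.1 / (1 + cos p.1)))]
  · nlinarith [sq_nonneg (p.2 * cos p.1)]
  · rw [ex, ez, sqrt_sq (by positivity), sqrt_sq (by positivity),
      show topHeight p - (p.2 - 1/2) = (1 - p.2) * (cos p.1 / (1 + cos p.1)) + p.2 * cos p.1 by
        rw [topHeight]; ring, abs_of_nonneg (by positivity)]

lemma swap_mem_triangle {w : ℝ × ℝ} (h : w ∈ triangle) : w.swap ∈ triangle :=
  ⟨h.2.1, h.1, by rw [add_comm]; exact h.2.2⟩

/-- The length of the section of the oloid over a point of `triangle`. -/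
def sectionHeight (w : ℝ × ℝ) : ℝ := (topHeight ∘ chartInv) w + (topHeight ∘ chartInv) w.swap

/-- The growth rate of the length of the section of the parallel bodies over a point of `triangle`. -/
def sectionSlope (w : ℝ × ℝ) : ℝ := (slant ∘ chartInv) w + (slant ∘ chartInv) w.swap

lemma exists_chart_eq {w : ℝ × ℝ} (hw : w ∈ triangle) : ∃ p ∈ chartDomain, chart p = w := by
  rw [← chart_image] at hw; exact hw

lemma slant_pos {p : ℝ × ℝ} (hp : p ∈ chartDomain) : 0 < slant p := by
  have h1 := one_add_cos_pos (mem_Icc_of_mem_chartDomain hp)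
  have h2 := cos_pos_of_mem_chartDomain hp
  rw [slant]; positivity

lemma sectionSlope_nonneg {w : ℝ × ℝ} (hw : w ∈ triangle) : 0 ≤ sectionSlope w := by
  obtain ⟨p, hp, e⟩ := exists_chart_eq hw
  obtain ⟨q, hq, e'⟩ := exists_chart_eq (swap_mem_triangle hw)
  rw [sectionSlope, ← e', ← e, Function.comp_apply, Function.comp_apply, chartInv_chart hp, chartInv_chart hq]
  exact (add_pos (slant_pos hp) (slant_pos hq)).le

lemma sectionHeight_nonneg {w : ℝ × ℝ} (hw : w ∈ triangle) : 0 ≤ sectionHeight w := by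
  obtain ⟨p, hp, e⟩ := exists_chart_eq hw
  obtain ⟨q, hq, e'⟩ := exists_chart_eq (swap_mem_triangle hw)
  rw [sectionHeight, ← e', ← e, Function.comp_apply, Function.comp_apply, chartInv_chart hp, chartInv_chart hq]
  have h := topHeight_mem_oloid hq
  rw [e', ← parallelBody_zero] at h
  have h2 := swap_mem_parallelBody (x := w.2) (z := w.1) h
  have h3 := le_topHeight hp (t := 0) (y := -topHeight q) (by rw [e]; exact h2)
  linarith

lemma sectionLength_parallelBody_le {w : ℝ × ℝ} (hw : w ∈ triangle) (t : ℝ) :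
    sectionLength (parallelBody t) w ≤ ENNReal.ofReal (sectionHeight w + t * sectionSlope w) := by
  obtain ⟨p, hp, e⟩ := exists_chart_eq hw
  obtain ⟨q, hq, e'⟩ := exists_chart_eq (swap_mem_triangle hw)
  have hsub : {y : ℝ | mkPoint (y, w) ∈ parallelBody t} ⊆
      Set.Icc (-(topHeight q + t * slant q)) (topHeight p + t * slant p) := by
    intro y hy
    refine ⟨?_, le_topHeight hp (by rw [e]; exact hy)⟩
    have h2 := swap_mem_parallelBody (x := w.1) (z := w.2) hy
    have h3 := le_topHeight hq (t := t) (y := -y) (by rw [e']; exact h2)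
    linarith
  refine (measure_mono hsub).trans_eq ?_
  rw [Real.volume_Icc, sectionSlope, sectionHeight, ← e', ← e]
  simp only [Function.comp_apply]
  rw [chartInv_chart hp, chartInv_chart hq]
  congr 1; ring

lemma convex_bodySection {S : Set E3} (hS : Convex ℝ S) (w : ℝ × ℝ) : Convex ℝ {y : ℝ | mkPoint (y, w) ∈ S} := by
  intro y hy y' hy' a b ha hb hab
  have := hS hy hy' ha hb hab
  rw [Set.mem_ofPred_eq]
  convert this using 1
  ext i
  fin_cases i
  · simp [← add_mul, hab]
  · simp
  · simp [← add_mul, hab]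

lemma ofReal_le_sectionLength {S : Set E3} (hS : Convex ℝ S) {w : ℝ × ℝ} {a b : ℝ} (ha : mkPoint (a, w) ∈ S)
    (hb : mkPoint (b, w) ∈ S) : ENNReal.ofReal (b - a) ≤ sectionLength S w := by
  rw [← Real.volume_Icc]
  exact measure_mono ((convex_bodySection hS w).ordConnected.out ha hb)

lemma sectionLength_oloid {w : ℝ × ℝ} (hw : w ∈ triangle) :
    sectionLength oloid w = ENNReal.ofReal (sectionHeight w) := by
  refine le_antisymm (by simpa [parallelBody_zero] using sectionLength_parallelBody_le hw 0) ?_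
  obtain ⟨p, hp, e⟩ := exists_chart_eq hw
  obtain ⟨q, hq, e'⟩ := exists_chart_eq (swap_mem_triangle hw)
  have h := topHeight_mem_oloid hq
  rw [e', ← parallelBody_zero] at h
  have h2 := swap_mem_parallelBody (x := w.2) (z := w.1) h
  rw [parallelBody_zero] at h2
  have h3 := topHeight_mem_oloid hp
  rw [e] at h3
  refine le_of_eq_of_le ?_ (ofReal_le_sectionLength convex_oloid h2 h3)
  rw [sectionHeight, ← e', ← e]
  simp only [Function.comp_apply]
  rw [chartInv_chart hp, chartInv_chart hq, sub_neg_eq_add]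

lemma eventually_le_sectionLength {w : ℝ × ℝ} (hw : w ∈ triangle) {ε : ℝ} (hε : 0 < ε) :
    ∀ᶠ t in nhdsWithin 0 (Set.Ioi 0),
      ENNReal.ofReal (sectionHeight w + t * (sectionSlope w - ε)) ≤ sectionLength (parallelBody t) w := by
  obtain ⟨p, hp, e⟩ := exists_chart_eq hw
  obtain ⟨q, hq, e'⟩ := exists_chart_eq (swap_mem_triangle hw)
  filter_upwards [eventually_mem_parallelBody hp (sub_lt_self (slant p) (half_pos hε)),
    eventually_mem_parallelBody hq (sub_lt_self (slant q) (half_pos hε))] with t h3 h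
  rw [e'] at h
  rw [e] at h3
  have h2 := swap_mem_parallelBody (x := w.2) (z := w.1) h
  refine le_of_eq_of_le ?_ (ofReal_le_sectionLength (convex_bodyOf _) h2 h3)
  rw [sectionHeight, sectionSlope, ← e', ← e]
  simp only [Function.comp_apply]
  rw [chartInv_chart hp, chartInv_chart hq]
  congr 1; ring

lemma add_le_of_mem_parallelBody {t x y z : ℝ} (ht : 0 ≤ t) (h : mkPoint (y, (x, z)) ∈ parallelBody t) :
    x + z ≤ 1 + 2 * t := by
  have h1 := h (mkPoint (0, (1, 1)))
  beta_reduce at h1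
  have hn : ‖mkPoint (0, (1, 1))‖ ≤ 2 := by
    refine abs_le_of_sq_le_sq' ?_ zero_le_two |>.2
    rw [norm_sq_eq_sum]; simp; norm_num
  have hs : supportO (mkPoint (0, (1, 1))) = 1 := by simp [supportO, supportA, supportB]
  rw [inner_mkPoint, hs] at h1
  simp only at h1
  nlinarith

lemma le_of_mem_parallelBody {η x y z : ℝ} (h0 : 0 < η) (h1 : η ≤ 1) (hxz : 1 ≤ x + z)
    (h : mkPoint (y, (x, z)) ∈ parallelBody (η^2)) : y ≤ z - 1/2 + 3 * η := by
  have h2 := h (mkPoint (η, (1, 1 - η)))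
  beta_reduce at h2
  have hn : ‖mkPoint (η, (1, 1 - η))‖ ≤ 2 := by
    refine abs_le_of_sq_le_sq' ?_ zero_le_two |>.2
    rw [norm_sq_eq_sum]; simp only [mkPoint_zero, mkPoint_one, mkPoint_two]; nlinarith
  have hs : supportO (mkPoint (η, (1, 1 - η))) ≤ 1 - η/2 + η^2 := by
    rw [supportO, supportA, supportB]
    simp only [mkPoint_zero, mkPoint_one, mkPoint_two]
    refine max_le ?_ ?_
    · have : √(1^2 + η^2) ≤ 1 + η^2 := sqrt_le_iff.2 ⟨by positivity, by nlinarith [sq_nonneg η, sq_nonneg (η^2)]⟩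
      exact (sub_le_sub_right this _).trans (by linarith)
    · have : √(η^2 + (1 - η)^2) ≤ 1 - η + η^2 := sqrt_le_iff.2 ⟨by nlinarith, by nlinarith [sq_nonneg (η * (1 - η))]⟩
      linarith
  rw [inner_mkPoint] at h2
  simp only at h2
  have h3 : η^2 * ‖mkPoint (η, (1, 1 - η))‖ ≤ η^2 * 2 := by gcongr
  refine le_of_mul_le_mul_left ?_ h0
  linarith

/-- A strip along the hypotenuse of `triangle`. -/
def strip (t : ℝ) : Set (ℝ × ℝ) := {w | w.1 ∈ Set.Icc 0 3 ∧ w.1 + w.2 ∈ Set.Icc 1 (1 + 2 * t)}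

lemma sectionLength_le_of_not_mem {η : ℝ} (h0 : 0 < η) (h1 : η ≤ 1) {w : ℝ × ℝ} (hw : w ∈ quadrant \ triangle) :
    sectionLength (parallelBody (η^2)) w ≤ (strip (η^2)).indicator (fun _ => ENNReal.ofReal (8 * η)) w := by
  obtain ⟨x, z⟩ := w
  have hx : 0 < x := hw.1.1
  have hz : 0 < z := hw.1.2
  have hxz : 1 ≤ x + z := by
    by_contra hlt
    exact hw.2 ⟨hx, hz, not_le.1 hlt⟩
  by_cases hle : x + z ≤ 1 + 2 * η^2
  · have hm : (x, z) ∈ strip (η^2) := ⟨⟨hx.le, show x ≤ 3 by nlinarith⟩, hxz, hle⟩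
    rw [Set.indicator_of_mem hm]
    have hsub : {y : ℝ | mkPoint (y, (x, z)) ∈ parallelBody (η^2)} ⊆
        Set.Icc (-(x - 1/2 + 3 * η)) (z - 1/2 + 3 * η) := by
      intro y hy
      refine ⟨?_, le_of_mem_parallelBody h0 h1 hxz hy⟩
      have := le_of_mem_parallelBody h0 h1 (by linarith) (swap_mem_parallelBody hy)
      linarith
    refine (measure_mono hsub).trans ?_
    rw [Real.volume_Icc]
    exact ENNReal.ofReal_le_ofReal (by nlinarith)
  · have : {y : ℝ | mkPoint (y, (x, z)) ∈ parallelBody (η^2)} = ∅ := by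
      refine Set.eq_empty_of_forall_notMem fun y hy => hle (add_le_of_mem_parallelBody (by positivity) hy)
    rw [sectionLength, this, measure_empty]
    exact zero_le

lemma volume_strip (t : ℝ) :
    volume (strip t) = ENNReal.ofReal (6 * t) := by
  have hp := measurePreserving_prod_add (volume : Measure ℝ) (volume : Measure ℝ)
  have := hp.measure_preimage (s := Set.Icc (0:ℝ) 3 ×ˢ Set.Icc (1:ℝ) (1 + 2 * t))
    (measurableSet_Icc.prod measurableSet_Icc).nullMeasurableSet
  rw [Measure.prod_prod, Real.volume_Icc, Real.volume_Icc, ← ENNReal.ofReal_mul (by norm_num)] at this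
  refine Eq.trans ?_ (this.trans (by congr 1; ring))
  rfl

lemma sectionLength_oloid_eq_zero {w : ℝ × ℝ} (hw : w ∈ quadrant \ triangle) : sectionLength oloid w = 0 := by
  have h1 : ∀ᶠ η : ℝ in nhdsWithin 0 (Set.Ioi 0), sectionLength oloid w ≤ ENNReal.ofReal (8 * η) := by
    filter_upwards [Ioo_mem_nhdsGT (zero_lt_one' ℝ)] with η hη
    refine le_trans (measure_mono fun y hy => ?_) ((sectionLength_le_of_not_mem hη.1 hη.2.le hw).trans
      (Set.indicator_le_self' (fun _ _ => zero_le) w))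
    exact parallelBody_mono (sq_nonneg η) (by rw [parallelBody_zero]; exact hy)
  have h2 : Filter.Tendsto (fun η : ℝ => ENNReal.ofReal (8 * η)) (nhdsWithin 0 (Set.Ioi 0)) (nhds 0) := by
    have : Filter.Tendsto (fun η : ℝ => 8 * η) (nhds 0) (nhds 0) := by
      have := (show Continuous fun η : ℝ => 8 * η by fun_prop).tendsto 0
      rwa [mul_zero] at this
    simpa using (ENNReal.tendsto_ofReal this).mono_left nhdsWithin_le_nhds
  exact le_antisymm (ge_of_tendsto h2 h1) zero_le

lemma integral_add_swap_triangle {F : ℝ × ℝ → ℝ} (hF : IntegrableOn F triangle) :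
    IntegrableOn (fun w => F w + F w.swap) triangle ∧ ∫ w in triangle, (F w + F w.swap) = 2 * ∫ w in triangle, F w := by
  have hsw : Prod.swap ⁻¹' triangle = triangle :=
    Set.Subset.antisymm (fun w h => by simpa using swap_mem_triangle h) fun w h => swap_mem_triangle h
  have hp : MeasurePreserving (Prod.swap : ℝ × ℝ → ℝ × ℝ) volume volume := Measure.measurePreserving_swap
  have he : MeasurableEmbedding (Prod.swap : ℝ × ℝ → ℝ × ℝ) := MeasurableEquiv.prodComm.measurableEmbedding
  have h1 : IntegrableOn (fun w => F w.swap) triangle := by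
    have := (hp.integrableOn_comp_preimage he).2 hF
    rwa [hsw] at this
  have h2 := hp.setIntegral_preimage_emb he F triangle
  rw [hsw] at h2
  exact ⟨hF.add h1, by rw [integral_add hF h1, h2, two_mul]⟩

lemma lintegral_sectionHeight : 4 * ∫⁻ w in triangle, ENNReal.ofReal (sectionHeight w) =
    ENNReal.ofReal (2/3 * (2 * ellipticE (√3/2) + ellipticK (√3/2))) := by
  obtain ⟨h1, h2⟩ := integral_add_swap_triangle integral_topHeight.1
  have hm := isOpen_triangle.measurableSet
  rw [← integral_topHeight.2, show (4 : ENNReal) = ENNReal.ofReal 4 by simp,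
    ← ofReal_integral_eq_lintegral_ofReal (f := sectionHeight) h1
      ((ae_restrict_iff' hm).2 (.of_forall fun w hw => sectionHeight_nonneg hw)),
    ← ENNReal.ofReal_mul (by norm_num)]
  congr 1
  exact (congrArg (4 * ·) h2).trans (by ring)

lemma integrableOn_sectionHeight : IntegrableOn sectionHeight triangle :=
  (integral_add_swap_triangle integral_topHeight.1).1

lemma lintegral_sectionSlope : 4 * ∫⁻ w in triangle, ENNReal.ofReal (sectionSlope w) = ENNReal.ofReal (4 * π) := by
  obtain ⟨h1, h2⟩ := integral_add_swap_triangle integral_slant.1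
  have hm := isOpen_triangle.measurableSet
  rw [show (4 : ENNReal) = ENNReal.ofReal 4 by simp,
    ← ofReal_integral_eq_lintegral_ofReal (f := sectionSlope) h1
      ((ae_restrict_iff' hm).2 (.of_forall fun w hw => sectionSlope_nonneg hw)),
    ← ENNReal.ofReal_mul (by norm_num)]
  congr 1
  exact (congrArg (4 * ·) h2).trans (by rw [integral_slant.2]; ring)

lemma volume_parallelBody' (t : ℝ) : volume (parallelBody t) =
    4 * ((∫⁻ w in triangle, sectionLength (parallelBody t) w) +
      ∫⁻ w in quadrant \ triangle, sectionLength (parallelBody t) w) := by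
  rw [volume_parallelBody, ← lintegral_inter_add_sdiff _ quadrant isOpen_triangle.measurableSet,
    Set.inter_eq_self_of_subset_right triangle_subset_quadrant]

lemma volume_oloid : volume oloid = ENNReal.ofReal (2/3 * (2 * ellipticE (√3/2) + ellipticK (√3/2))) := by
  have hm := isOpen_triangle.measurableSet
  rw [← lintegral_sectionHeight, ← parallelBody_zero, volume_parallelBody', parallelBody_zero,
    setLIntegral_congr_fun (measurableSet_quadrant.diff hm) fun w hw => sectionLength_oloid_eq_zero hw,
    lintegral_zero, add_zero, setLIntegral_congr_fun hm fun w hw => sectionLength_oloid hw]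

lemma volume_parallelBody_le {η : ℝ} (h0 : 0 < η) (h1 : η ≤ 1) :
    volume (parallelBody (η^2)) ≤ volume oloid + ENNReal.ofReal (η^2) * (ENNReal.ofReal (4 * π) + ENNReal.ofReal (192 * η)) := by
  have hm := isOpen_triangle.measurableSet
  have hms : MeasurableSet (strip (η^2)) := by
    refine MeasurableSet.inter (measurable_fst measurableSet_Icc) ?_
    exact (measurable_fst.add measurable_snd) measurableSet_Icc
  have e1 : ∫⁻ w in triangle, sectionLength (parallelBody (η^2)) w ≤
      (∫⁻ w in triangle, ENNReal.ofReal (sectionHeight w)) +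
        ENNReal.ofReal (η^2) * ∫⁻ w in triangle, ENNReal.ofReal (sectionSlope w) := by
    rw [← lintegral_const_mul' _ _ ENNReal.ofReal_ne_top,
      ← lintegral_add_left' integrableOn_sectionHeight.aemeasurable.ennreal_ofReal]
    refine setLIntegral_mono' hm fun w hw => (sectionLength_parallelBody_le hw _).trans_eq ?_
    rw [ENNReal.ofReal_add (sectionHeight_nonneg hw) (mul_nonneg (sq_nonneg _) (sectionSlope_nonneg hw)),
      ENNReal.ofReal_mul (sq_nonneg _)]
  have e2 : ∫⁻ w in quadrant \ triangle, sectionLength (parallelBody (η^2)) w ≤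
      ENNReal.ofReal (8 * η) * ENNReal.ofReal (6 * η^2) := by
    calc _ ≤ ∫⁻ w in quadrant \ triangle, (strip (η^2)).indicator (fun _ => ENNReal.ofReal (8 * η)) w :=
          setLIntegral_mono' (measurableSet_quadrant.diff hm) fun w hw => sectionLength_le_of_not_mem h0 h1 hw
      _ ≤ ∫⁻ w, (strip (η^2)).indicator (fun _ => ENNReal.ofReal (8 * η)) w := setLIntegral_le_lintegral _ _
      _ = _ := by rw [lintegral_indicator_const hms, volume_strip]
  rw [volume_oloid, ← lintegral_sectionHeight, ← lintegral_sectionSlope, volume_parallelBody']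
  calc _ ≤ 4 * (((∫⁻ w in triangle, ENNReal.ofReal (sectionHeight w)) +
        ENNReal.ofReal (η^2) * ∫⁻ w in triangle, ENNReal.ofReal (sectionSlope w)) +
          ENNReal.ofReal (8 * η) * ENNReal.ofReal (6 * η^2)) := by gcongr
    _ = _ := by
      have : 4 * (ENNReal.ofReal (8 * η) * ENNReal.ofReal (6 * η^2)) =
          ENNReal.ofReal (η^2) * ENNReal.ofReal (192 * η) := by
        rw [show (4 : ENNReal) = ENNReal.ofReal 4 by simp, ← ENNReal.ofReal_mul (by positivity),
          ← ENNReal.ofReal_mul (by positivity), ← ENNReal.ofReal_mul (by positivity)]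
        congr 1; ring
      rw [mul_add 4 _ (_ * _), this]
      ring

lemma tendsto_ofReal_mul_zero (C : ℝ) :
    Filter.Tendsto (fun η : ℝ => ENNReal.ofReal (C * η)) (nhdsWithin 0 (Set.Ioi 0)) (nhds 0) := by
  have : Filter.Tendsto (fun η : ℝ => C * η) (nhds 0) (nhds 0) := by
    have := (show Continuous fun η : ℝ => C * η by fun_prop).tendsto 0
    rwa [mul_zero] at this
  simpa using (ENNReal.tendsto_ofReal this).mono_left nhdsWithin_le_nhds

lemma volume_oloid_ne_top : volume oloid ≠ ⊤ := by rw [volume_oloid]; exact ENNReal.ofReal_ne_top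

lemma le_of_volume_parallelBody_eq {a b c : ENNReal}
    (h : ∀ t : ℝ, 0 ≤ t → volume (parallelBody t) =
      volume oloid + ENNReal.ofReal t * a + ENNReal.ofReal t^2 * b + ENNReal.ofReal t^3 * c) :
    a ≤ ENNReal.ofReal (4 * π) := by
  have h1 : ∀ᶠ η : ℝ in nhdsWithin 0 (Set.Ioi 0), a ≤ ENNReal.ofReal (4 * π) + ENNReal.ofReal (192 * η) := by
    filter_upwards [Ioo_mem_nhdsGT (zero_lt_one' ℝ)] with η hη
    have h2 := volume_parallelBody_le hη.1 hη.2.le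
    rw [h _ (sq_nonneg η), add_assoc, add_assoc] at h2
    have h3 := le_self_add.trans ((ENNReal.add_le_add_iff_left volume_oloid_ne_top).1 h2)
    exact (ENNReal.mul_le_mul_iff_right (ENNReal.ofReal_pos.2 (pow_pos hη.1 2)).ne' ENNReal.ofReal_ne_top).1 h3
  have h2 := (tendsto_const_nhds (x := ENNReal.ofReal (4 * π))).add (tendsto_ofReal_mul_zero 192)
  rw [add_zero] at h2
  exact ge_of_tendsto h2 h1

lemma ofReal_sectionSlope_le_liminf {w : ℝ × ℝ} (hw : w ∈ triangle) {u : ℕ → ℝ}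
    (hu : Filter.Tendsto u Filter.atTop (nhdsWithin 0 (Set.Ioi 0))) :
    ENNReal.ofReal (sectionSlope w) ≤ Filter.liminf (fun n =>
      (sectionLength (parallelBody (u n)) w - ENNReal.ofReal (sectionHeight w)) / ENNReal.ofReal (u n)) Filter.atTop := by
  have h1 : ∀ᶠ ε : ℝ in nhdsWithin 0 (Set.Ioi 0), ENNReal.ofReal (sectionSlope w - ε) ≤ Filter.liminf (fun n =>
      (sectionLength (parallelBody (u n)) w - ENNReal.ofReal (sectionHeight w)) / ENNReal.ofReal (u n)) Filter.atTop := by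
    filter_upwards [self_mem_nhdsWithin] with ε hε
    refine Filter.le_liminf_of_le (by isBoundedDefault) ?_
    filter_upwards [hu.eventually (eventually_le_sectionLength hw hε), hu.eventually self_mem_nhdsWithin] with n hn hpos
    rw [ENNReal.le_div_iff_mul_le (.inl (ENNReal.ofReal_pos.2 hpos).ne') (.inl ENNReal.ofReal_ne_top),
      ← ENNReal.ofReal_mul' (le_of_lt hpos)]
    refine le_trans (le_of_eq ?_) (tsub_le_tsub_right hn _)
    rw [← ENNReal.ofReal_sub _ (sectionHeight_nonneg hw)]
    congr 1; ring
  refine le_of_tendsto ?_ h1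
  have : Filter.Tendsto (fun ε : ℝ => sectionSlope w - ε) (nhds 0) (nhds (sectionSlope w)) := by
    have := (show Continuous fun ε : ℝ => sectionSlope w - ε by fun_prop).tendsto 0
    rwa [sub_zero] at this
  exact (ENNReal.tendsto_ofReal this).mono_left nhdsWithin_le_nhds

lemma eq_of_volume_parallelBody_eq {a b c : ENNReal}
    (h : ∀ t : ℝ, 0 ≤ t → volume (parallelBody t) =
      volume oloid + ENNReal.ofReal t * a + ENNReal.ofReal t^2 * b + ENNReal.ofReal t^3 * c) :
    a = ENNReal.ofReal (4 * π) := by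
  refine le_antisymm (le_of_volume_parallelBody_eq h) ?_
  have hm := isOpen_triangle.measurableSet
  have hfin : ENNReal.ofReal 1^2 * b + ENNReal.ofReal 1^3 * c ≠ ⊤ := by
    have h1 := volume_parallelBody_le one_pos le_rfl
    rw [h _ (sq_nonneg 1), one_pow, add_assoc _ (_ * b)] at h1
    refine ne_top_of_le_ne_top ?_ (le_add_self.trans h1)
    rw [volume_oloid]
    finiteness
  rw [ENNReal.ofReal_one, one_pow, one_pow, one_mul, one_mul, ENNReal.add_ne_top] at hfin
  set u : ℕ → ℝ := fun n => 1 / ((n : ℝ) + 1) with hu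
  have hpos : ∀ n, 0 < u n := fun n => by positivity
  have hlim : Filter.Tendsto u Filter.atTop (nhds 0) := tendsto_one_div_add_atTop_nhds_zero_nat
  have hlim' : Filter.Tendsto u Filter.atTop (nhdsWithin 0 (Set.Ioi 0)) :=
    tendsto_nhdsWithin_iff.2 ⟨hlim, .of_forall hpos⟩
  set g : ℕ → ℝ × ℝ → ENNReal := fun n w =>
    (sectionLength (parallelBody (u n)) w - sectionLength oloid w) / ENNReal.ofReal (u n) with hg
  have hmo := measurable_sectionLength isCompact_oloid.isClosed.measurableSet
  have hgm : ∀ n, Measurable (g n) := fun n =>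
    ((measurable_sectionLength (isClosed_parallelBody _).measurableSet).sub hmo).div_const _
  have hle : ∀ n, 4 * ∫⁻ w in triangle, g n w ≤ a + ENNReal.ofReal (u n) * b + ENNReal.ofReal (u n)^2 * c := by
    intro n
    have hne := (ENNReal.ofReal_pos.2 (hpos n)).ne'
    have h1 : volume oloid + ENNReal.ofReal (u n) * (4 * ∫⁻ w in triangle, g n w) ≤ volume (parallelBody (u n)) := by
      rw [volume_parallelBody', volume_oloid, ← lintegral_sectionHeight, mul_add 4]
      refine le_trans (le_of_eq ?_) le_self_add
      rw [mul_left_comm, ← mul_add, ← lintegral_const_mul' _ _ ENNReal.ofReal_ne_top,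
        ← lintegral_add_left' integrableOn_sectionHeight.aemeasurable.ennreal_ofReal]
      congr 1
      refine setLIntegral_congr_fun hm fun w hw => ?_
      simp only [hg]
      rw [ENNReal.mul_div_cancel hne ENNReal.ofReal_ne_top, ← sectionLength_oloid hw]
      refine add_tsub_cancel_of_le (measure_mono fun y hy => ?_)
      exact parallelBody_mono (hpos n).le (by rw [parallelBody_zero]; exact hy)
    rw [h _ (hpos n).le, add_assoc, add_assoc, ENNReal.add_le_add_iff_left volume_oloid_ne_top] at h1
    refine (ENNReal.mul_le_mul_iff_right hne ENNReal.ofReal_ne_top).1 (h1.trans_eq ?_)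
    ring
  have hT : Filter.Tendsto (fun n => a + ENNReal.ofReal (u n) * b + ENNReal.ofReal (u n)^2 * c) Filter.atTop (nhds a) := by
    have h0 : Filter.Tendsto (fun n => ENNReal.ofReal (u n)) Filter.atTop (nhds 0) := by
      simpa using ENNReal.tendsto_ofReal hlim
    have h2 := ENNReal.Tendsto.mul_const h0 (.inr hfin.1)
    have h3 := ENNReal.Tendsto.mul_const (ENNReal.Tendsto.pow (n := 2) h0) (.inr hfin.2)
    simpa using (tendsto_const_nhds (x := a)).add h2 |>.add h3
  calc ENNReal.ofReal (4 * π) = 4 * ∫⁻ w in triangle, ENNReal.ofReal (sectionSlope w) := lintegral_sectionSlope.symm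
    _ ≤ 4 * ∫⁻ w in triangle, Filter.liminf (fun n => g n w) Filter.atTop := by
      gcongr 4 * ?_
      refine setLIntegral_mono' hm fun w hw => ?_
      simp only [hg]
      rw [sectionLength_oloid hw]
      exact ofReal_sectionSlope_le_liminf hw hlim'
    _ ≤ 4 * Filter.liminf (fun n => ∫⁻ w in triangle, g n w) Filter.atTop := by
      gcongr; exact lintegral_liminf_le hgm
    _ ≤ Filter.liminf (fun n => 4 * ∫⁻ w in triangle, g n w) Filter.atTop := by
      rw [ENNReal.liminf_const_mul_of_ne_top (by norm_num)]
    _ ≤ Filter.liminf (fun n => a + ENNReal.ofReal (u n) * b + ENNReal.ofReal (u n)^2 * c) Filter.atTop :=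
      Filter.liminf_le_liminf (.of_forall hle)
    _ = a := hT.liminf_eq

lemma lintegral_mixedVol_eq (ν : Measure SO3) [IsProbabilityMeasure ν] [ν.IsMulLeftInvariant]
    {g : E3 → E3} {H : E3 → M3} (hp : IsPotential supportO smoothO g H)
    (hs : ∀ x y, x ≠ y → smoothO x + inner ℝ (g x) (y - x) < smoothO y) :
    ∫⁻ θ, mixedVol H (negMat θ) ∂ν = ENNReal.ofReal (4 * π * meanSupport ν) := by
  have hm := meanSupport_pos ν
  obtain ⟨F, G, hp'⟩ := exists_isPotential_mean ν hp
  have hom : ∀ x : E3, ∀ t : ℝ, 0 < t → supportO (t • x) = t * supportO x := fun x t ht => supportO_smul x t ht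
  have hom' : ∀ x : E3, ∀ t : ℝ, 0 < t → meanSupport ν * ‖t • x‖ = t * (meanSupport ν * ‖x‖) := fun x t ht => by
    rw [norm_smul, Real.norm_of_nonneg ht.le]; ring
  rw [lintegral_mixedVol ν hp]
  set a := ∫⁻ x, ENNReal.ofReal ((H x).adjugate * meanHess ν H x).trace with ha
  have key := eq_of_volume_parallelBody_eq (a := ENNReal.ofReal (1 / meanSupport ν) * a)
    (b := ENNReal.ofReal (1 / meanSupport ν)^2 * ∫⁻ x, ENNReal.ofReal ((meanHess ν H x).adjugate * H x).trace)
    (c := ENNReal.ofReal (1 / meanSupport ν)^3 * ∫⁻ x, ENNReal.ofReal (meanHess ν H x).det) (fun t ht => by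
      have h := IsPotential.volume_add_smul hp hp' hom hom' hs (t := t * (1 / meanSupport ν)) (by positivity)
      rw [ENNReal.ofReal_mul ht] at h
      rw [oloid_eq_bodyOf, parallelBody]
      refine Eq.trans (congrArg (fun f => volume (bodyOf f)) (funext fun x => ?_)) (h.trans ?_)
      · field_simp
      · rw [← ha]; ring)
  have e : ENNReal.ofReal (meanSupport ν) * (ENNReal.ofReal (1 / meanSupport ν) * a) =
      ENNReal.ofReal (meanSupport ν) * ENNReal.ofReal (4 * π) := by rw [key]
  rw [← mul_assoc, ← ENNReal.ofReal_mul hm.le, mul_one_div_cancel hm.ne', ENNReal.ofReal_one, one_mul,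
    ← ENNReal.ofReal_mul hm.le] at e
  rw [e, mul_comm]

lemma integral_cube_mul_exp {c : ℝ} (hc : 0 < c) :
    ∫ ρ in Set.Ioi (0:ℝ), ρ^3 * exp (-(c * ρ^2)) = 1 / (2 * c^2) := by
  have h := integral_rpow_mul_exp_neg_mul_rpow (p := 2) (q := 3) (b := c) (by norm_num) (by norm_num) hc
  rw [show ((3:ℝ) + 1)/2 = 2 by norm_num, show -((3:ℝ) + 1)/2 = ((-2 : ℤ) : ℝ) by norm_num, rpow_intCast,
    Real.Gamma_two] at h
  refine Eq.trans ?_ (h.trans ?_)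
  · refine setIntegral_congr_fun measurableSet_Ioi fun x hx => ?_
    simp only [neg_mul]
    rw [← rpow_natCast, ← rpow_natCast]; norm_num
  · rw [zpow_neg]; norm_cast; field_simp

lemma integrableOn_cube_mul_exp {c : ℝ} (hc : 0 < c) :
    IntegrableOn (fun ρ : ℝ => ρ^3 * exp (-(c * ρ^2))) (Set.Ioi 0) := by
  refine (integrableOn_rpow_mul_exp_neg_mul_sq hc (s := 3) (by norm_num)).congr_fun (fun x hx => ?_) measurableSet_Ioi
  simp only [neg_mul]
  rw [← rpow_natCast x 3]; norm_num

lemma lintegral_cube_mul_exp {c : ℝ} (hc : 0 < c) :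
    ∫⁻ ρ in Set.Ioi (0:ℝ), ENNReal.ofReal (ρ^3 * exp (-(c * ρ^2))) = ENNReal.ofReal (1 / (2 * c^2)) := by
  rw [← integral_cube_mul_exp hc, ofReal_integral_eq_lintegral_ofReal (integrableOn_cube_mul_exp hc)]
  refine (ae_restrict_iff' measurableSet_Ioi).2 (.of_forall fun x hx => ?_)
  have : 0 < x := hx
  simp only [Pi.zero_apply]; positivity

lemma lintegral_norm_mul_exp : ∫⁻ v : E3, ENNReal.ofReal (‖v‖ * exp (-‖v‖^2)) = ENNReal.ofReal (2 * π) := by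
  have hd : Module.finrank ℝ E3 = 3 := by simp
  have hi : Integrable (fun v : E3 => ‖v‖ * exp (-‖v‖^2)) := by
    rw [integrable_fun_norm_addHaar (μ := (volume : Measure E3)) (f := fun ρ => ρ * exp (-ρ^2)), hd]
    refine (integrableOn_cube_mul_exp one_pos).congr_fun (fun x hx => ?_) measurableSet_Ioi
    simp only [smul_eq_mul, one_mul]; ring
  rw [← ofReal_integral_eq_lintegral_ofReal hi (.of_forall fun v => by simp only [Pi.zero_apply]; positivity),
    integral_fun_norm_addHaar volume (fun ρ => ρ * exp (-ρ^2)), hd]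
  congr 1
  have h2 := integral_cube_mul_exp one_pos
  have h3 : ∫ y in Set.Ioi (0:ℝ), y^(3-1) • (y * exp (-y^2)) = 1/2 := by
    refine Eq.trans (setIntegral_congr_fun measurableSet_Ioi fun x hx => ?_) (h2.trans (by norm_num))
    simp only [smul_eq_mul, one_mul]; ring
  rw [h3, measureReal_def, EuclideanSpace.volume_ball_fin_three]
  simp
  rw [ENNReal.toReal_ofReal (by positivity)]
  ring

/-- Cartesian coordinates adapted to polar coordinates in the plane of `k_A`. -/
def planePoint (q : ℝ × (ℝ × ℝ)) : EuclideanSpace ℝ (Fin 3) := !₂[q.2.2, -q.2.1, q.1]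

lemma measurePreserving_planePoint : MeasurePreserving planePoint := by
  have h1 : MeasurePreserving (Prod.swap : ℝ × (ℝ × ℝ) → (ℝ × ℝ) × ℝ) volume volume := Measure.measurePreserving_swap
  have h2 := measurePreserving_prodAssoc (volume : Measure ℝ) (volume : Measure ℝ) (volume : Measure ℝ)
  have h3 := (Measure.measurePreserving_neg (volume : Measure ℝ)).prod (MeasurePreserving.id (volume : Measure (ℝ × ℝ)))
  exact measurePreserving_mkPoint.comp (h3.comp (h2.comp h1))

lemma lintegral_comp_mul_left_of_pos (f : ℝ → ENNReal) {a : ℝ} (ha : 0 < a) :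
    ∫⁻ z, f z = ENNReal.ofReal a * ∫⁻ ζ, f (a * ζ) := by
  have h := (MeasurableEquiv.mulLeft₀ a ha.ne').measurableEmbedding.lintegral_map f (μ := volume)
  rw [MeasurableEquiv.coe_mulLeft₀, Real.map_volume_mul_left ha.ne', lintegral_smul_measure, abs_of_pos (inv_pos.2 ha)] at h
  rw [← h, smul_eq_mul, ← mul_assoc, ← ENNReal.ofReal_mul ha.le, mul_inv_cancel₀ ha.ne', ENNReal.ofReal_one, one_mul]

lemma lintegral_eq_polar {f : E3 → ENNReal} (hf : Measurable f) :
    ∫⁻ v, f v = ∫⁻ φ in Set.Ioo (-π) π, ∫⁻ ζ : ℝ, ∫⁻ ρ in Set.Ioi (0:ℝ),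
      ENNReal.ofReal (ρ^2) * f (ρ • !₂[sin φ, -cos φ, ζ]) := by
  have hpm : Measurable planePoint := measurePreserving_planePoint.measurable
  have hF : Measurable fun q => f (planePoint q) := hf.comp hpm
  have hG : Measurable fun q : ℝ × (ℝ × ℝ) => ENNReal.ofReal (q.2.1^2) * f (q.2.1 • !₂[sin q.2.2, -cos q.2.2, q.1]) := by
    refine Measurable.mul (by fun_prop) (hf.comp ?_)
    have : Measurable fun q : ℝ × (ℝ × ℝ) => planePoint (q.2.1 * q.1, (q.2.1 * cos q.2.2, q.2.1 * sin q.2.2)) :=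
      hpm.comp (by fun_prop)
    convert this using 2 with q
    ext i
    fin_cases i <;> simp [planePoint]
  rw [← measurePreserving_planePoint.lintegral_comp hf, Measure.volume_eq_prod, lintegral_prod_symm' _ hF]
  rw [← lintegral_comp_polarCoord_symm, polarCoord_target, Measure.volume_eq_prod, ← Measure.prod_restrict]
  have h1 : ∀ ρ ∈ Set.Ioi (0:ℝ), ∀ φ : ℝ, ENNReal.ofReal ρ • ∫⁻ z, f (planePoint (z, polarCoord.symm (ρ, φ))) =
      ∫⁻ ζ : ℝ, ENNReal.ofReal (ρ^2) * f (ρ • !₂[sin φ, -cos φ, ζ]) := by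
    intro ρ hρ φ
    have hρ' : 0 < ρ := hρ
    rw [lintegral_comp_mul_left_of_pos _ hρ', lintegral_const_mul' _ _ ENNReal.ofReal_ne_top, smul_eq_mul, ← mul_assoc,
      ← ENNReal.ofReal_mul hρ'.le, ← sq]
    congr 2 with ζ
    congr 1
    ext i
    fin_cases i <;> simp [planePoint]
  have h2 : Measurable fun p : ℝ × ℝ => ∫⁻ ζ : ℝ, ENNReal.ofReal (p.1^2) * f (p.1 • !₂[sin p.2, -cos p.2, ζ]) :=
    hG.lintegral_prod_left'
  have h3 : ∀ᵐ p ∂((volume.restrict (Set.Ioi (0:ℝ))).prod (volume.restrict (Set.Ioo (-π) π))),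
      ENNReal.ofReal p.1 • ∫⁻ z, f (planePoint (z, polarCoord.symm p)) =
      ∫⁻ ζ : ℝ, ENNReal.ofReal (p.1^2) * f (p.1 • !₂[sin p.2, -cos p.2, ζ]) := by
    rw [Measure.prod_restrict]
    refine (ae_restrict_iff' (measurableSet_Ioi.prod measurableSet_Ioo)).2 (.of_forall fun p hp => h1 p.1 hp.1 p.2)
  rw [lintegral_congr_ae h3, lintegral_prod_symm' _ h2]
  refine lintegral_congr fun φ => ?_
  refine lintegral_lintegral_swap (Measurable.aemeasurable ?_)
  exact hG.comp (show Measurable fun q : ℝ × ℝ => (q.2, (q.1, φ)) by fun_prop)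

lemma lintegral_homogeneous {h : E3 → ℝ} (hm : Measurable h) (hom : ∀ x, ∀ t : ℝ, 0 < t → h (t • x) = t * h x)
    (h0 : ∀ x, 0 ≤ h x) :
    ∫⁻ v, ENNReal.ofReal (h v * exp (-‖v‖^2)) = ∫⁻ φ in Set.Ioo (-π) π, ∫⁻ ζ : ℝ,
      ENNReal.ofReal (h !₂[sin φ, -cos φ, ζ] * (1 / (2 * (1 + ζ^2)^2))) := by
  rw [lintegral_eq_polar (by fun_prop)]
  refine lintegral_congr fun φ => lintegral_congr fun ζ => ?_
  have hn : ‖(!₂[sin φ, -cos φ, ζ] : E3)‖^2 = 1 + ζ^2 := by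
    rw [norm_sq_eq_sum]; simp
  rw [ENNReal.ofReal_mul (h0 _), ← lintegral_cube_mul_exp (by positivity), ← lintegral_const_mul' _ _ ENNReal.ofReal_ne_top]
  refine setLIntegral_congr_fun measurableSet_Ioi fun ρ hρ => ?_
  have hρ' : 0 < ρ := hρ
  rw [← ENNReal.ofReal_mul (by positivity), ← ENNReal.ofReal_mul (h0 _), hom _ _ hρ', norm_smul, mul_pow, hn,
    Real.norm_of_nonneg hρ'.le]
  congr 1
  rw [mul_comm (ρ^2) (1 + ζ^2)]; ring

/-- The symmetry of the oloid exchanging its two circles. -/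
def exchange : EuclideanSpace ℝ (Fin 3) → EuclideanSpace ℝ (Fin 3) := fun v => !₂[v 2, -v 1, v 0]

lemma measurePreserving_exchange : MeasurePreserving exchange := by
  have h3 := (Measure.measurePreserving_neg (volume : Measure ℝ)).prod
    (Measure.measurePreserving_swap (μ := (volume : Measure ℝ)) (ν := (volume : Measure ℝ)))
  have h4 : MeasurePreserving pointEquiv.symm := by rw [← mkPoint_eq]; exact measurePreserving_mkPoint
  have := (measurePreserving_mkPoint.comp h3).comp (h4.symm pointEquiv.symm)
  exact this

lemma supportA_exchange (v : E3) : supportA (exchange v) = supportB v := by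
  simp only [supportA, supportB, exchange]
  simp [add_comm, neg_div]

lemma supportB_exchange (v : E3) : supportB (exchange v) = supportA v := by
  simp only [supportA, supportB, exchange]
  simp [add_comm, neg_div, sub_eq_add_neg]

lemma norm_exchange (v : E3) : ‖exchange v‖ = ‖v‖ := by
  rw [← sq_eq_sq₀ (norm_nonneg _) (norm_nonneg _), norm_sq_eq_sum, norm_sq_eq_sum]
  simp [exchange]; ring

lemma measurable_supportA : Measurable supportA := by unfold supportA; fun_prop

lemma measurable_supportB : Measurable supportB := by unfold supportB; fun_prop

lemma lintegral_arctan {q : ℝ} (hq : 0 ≤ q) : ∫⁻ ζ in {ζ : ℝ | ζ^2 ≤ q}, ENNReal.ofReal (1 / (2 * (1 + ζ^2)^2)) =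
    ENNReal.ofReal ((arctan √q + √q / (1 + q)) / 2) := by
  have hs : {ζ : ℝ | ζ^2 ≤ q} = Set.Icc (-√q) √q := by
    ext ζ; exact sq_le hq
  have hc : Continuous fun ζ : ℝ => 1 / (2 * (1 + ζ^2)^2) :=
    continuous_const.div (by fun_prop) fun ζ => by positivity
  rw [hs, ← ofReal_integral_eq_lintegral_ofReal (hc.continuousOn.integrableOn_compact isCompact_Icc)
    (.of_forall fun ζ => by simp only [Pi.zero_apply]; positivity), integral_Icc_eq_integral_Ioc,
    ← intervalIntegral.integral_of_le (by linarith [sqrt_nonneg q])]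
  congr 1
  rw [intervalIntegral.integral_eq_sub_of_hasDerivAt (f := fun ζ => (arctan ζ + ζ / (1 + ζ^2)) / 4) (fun ζ _ => ?_)
    (hc.intervalIntegrable _ _)]
  · rw [arctan_neg, neg_sq, sq_sqrt hq]; ring
  · have hz : (1 + ζ^2) ≠ 0 := by positivity
    refine (((hasDerivAt_arctan ζ).add ((hasDerivAt_id' ζ).div (((hasDerivAt_id' ζ).pow 2).const_add 1) hz)).div_const 4).congr_deriv ?_
    simp only [Pi.pow_apply]
    field_simp
    ring

lemma supportB_le_supportA_iff (φ ζ : ℝ) : supportB (!₂[sin φ, -cos φ, ζ] : E3) ≤ supportA (!₂[sin φ, -cos φ, ζ] : E3) ↔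
    ζ^2 ≤ 1 + 2 * cos φ := by
  have h1 := neg_one_le_cos φ
  rw [supportA, supportB]
  simp
  constructor
  · intro h
    have h2 : √(cos φ^2 + ζ^2) ≤ 1 + cos φ := by linarith
    rw [sqrt_le_iff] at h2
    linarith [h2.2]
  · intro h
    have h2 : √(cos φ^2 + ζ^2) ≤ 1 + cos φ := sqrt_le_iff.2 ⟨by linarith, by linarith⟩
    linarith

lemma supportB_lt_supportA_iff (φ ζ : ℝ) : supportB (!₂[sin φ, -cos φ, ζ] : E3) < supportA (!₂[sin φ, -cos φ, ζ] : E3) ↔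
    ζ^2 < 1 + 2 * cos φ := by
  have h1 := neg_one_le_cos φ
  rw [supportA, supportB]
  simp
  constructor
  · intro h
    have h2 : √(cos φ^2 + ζ^2) < 1 + cos φ := by linarith
    rw [sqrt_lt' ((sqrt_nonneg _).trans_lt h2)] at h2
    linarith
  · intro h
    have h3 : 0 < 1 + cos φ := by nlinarith [sq_nonneg ζ]
    have h2 : √(cos φ^2 + ζ^2) < 1 + cos φ := (sqrt_lt' h3).2 (by linarith)
    linarith

lemma supportA_apply (φ ζ : ℝ) : supportA (!₂[sin φ, -cos φ, ζ] : E3) = 1 + cos φ / 2 := by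
  rw [supportA]; simp; ring

lemma zero_le_one_add_two_mul_cos_iff {φ : ℝ} (h0 : 0 ≤ φ) (hπ : φ ≤ π) : 0 ≤ 1 + 2 * cos φ ↔ φ ≤ 2 * π / 3 := by
  have hc : cos (2 * π / 3) = -(1/2) := by
    rw [show 2 * π / 3 = π - π / 3 by ring, cos_pi_sub, cos_pi_div_three]
  rw [← strictAntiOn_cos.le_iff_ge (a := 2 * π / 3) (b := φ) ⟨by positivity, by linarith [pi_pos]⟩ ⟨h0, hπ⟩, hc]
  constructor <;> intro h <;> linarith

lemma widthDensity_nonneg {φ : ℝ} : 0 ≤ widthDensity φ := by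
  have := neg_one_le_cos φ
  rw [widthDensity]
  have h1 : 0 ≤ arctan √(1 + 2 * cos φ) := arctan_nonneg.2 (sqrt_nonneg _)
  have h2 : 0 ≤ √(1 + 2 * cos φ) / (2 * (1 + cos φ)) := div_nonneg (sqrt_nonneg _) (by linarith)
  exact mul_nonneg (by linarith) (by linarith)

lemma lintegral_even_widthDensity :
    ∫⁻ φ in Set.Ioo (-π) π, {φ : ℝ | 0 ≤ 1 + 2 * cos φ}.indicator (fun φ => ENNReal.ofReal (widthDensity φ / 2)) φ =
      ENNReal.ofReal (∫ t in (0:ℝ)..2*π/3, widthDensity t) := by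
  have hπ := pi_pos
  rw [← lintegral_indicator measurableSet_Ioo, lintegral_eq_two_mul_of_even fun φ => ?_]
  · have : ∫⁻ x in Set.Ioi 0, (Set.Ioo (-π) π).indicator (fun a => {φ : ℝ | 0 ≤ 1 + 2 * cos φ}.indicator
        (fun φ => ENNReal.ofReal (widthDensity φ / 2)) a) x =
        ∫⁻ t in Set.Ioc 0 (2*π/3), ENNReal.ofReal (widthDensity t / 2) := by
      rw [← lintegral_indicator measurableSet_Ioi, ← lintegral_indicator measurableSet_Ioc]
      refine lintegral_congr fun φ => ?_
      simp only [Set.indicator_apply, Set.mem_Ioi, Set.mem_Ioo, Set.mem_Ioc, Set.mem_ofPred_eq]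
      by_cases h0 : 0 < φ
      · by_cases h1 : φ ≤ π
        · by_cases h2 : φ ≤ 2 * π / 3
          · have := (zero_le_one_add_two_mul_cos_iff h0.le h1).2 h2
            rw [if_pos h0, if_pos ⟨by linarith, by linarith⟩, if_pos this, if_pos ⟨h0, h2⟩]
          · have := mt (zero_le_one_add_two_mul_cos_iff h0.le h1).1 h2
            simp [this, h2]
        · rw [if_pos h0, if_neg (fun h => h1 h.2.le), if_neg (fun h => h1 (by linarith [h.2]))]
      · simp [h0]
    have hc : ContinuousOn (fun t => widthDensity t / 2) (Set.Icc 0 (2*π/3)) := continuousOn_widthDensity.div_const 2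
    rw [this, ← ofReal_integral_eq_lintegral_ofReal
      ((hc.integrableOn_compact isCompact_Icc).mono_set Set.Ioc_subset_Icc_self)
      (.of_forall fun t => div_nonneg widthDensity_nonneg zero_le_two),
      ← intervalIntegral.integral_of_le (by positivity), intervalIntegral.integral_div,
      ← ENNReal.ofReal_ofNat 2, ← ENNReal.ofReal_mul zero_le_two]
    congr 1; ring
  · simp only [Set.indicator_apply, Set.mem_Ioo, Set.mem_ofPred_eq, cos_neg, widthDensity]
    refine if_congr ⟨fun h => ⟨by linarith [h.2], by linarith [h.1]⟩, fun h => ⟨by linarith [h.2], by linarith [h.1]⟩⟩ rfl rfl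

lemma lintegral_indicator_supportA {S : Set E3} (hS : MeasurableSet S) (hom : ∀ x, ∀ t : ℝ, 0 < t → (t • x ∈ S ↔ x ∈ S))
    (hlt : ∀ φ ζ : ℝ, ζ^2 < 1 + 2 * cos φ → (!₂[sin φ, -cos φ, ζ] : E3) ∈ S)
    (hle : ∀ φ ζ : ℝ, (!₂[sin φ, -cos φ, ζ] : E3) ∈ S → ζ^2 ≤ 1 + 2 * cos φ) :
    ∫⁻ v, ENNReal.ofReal (S.indicator supportA v * exp (-‖v‖^2)) = ENNReal.ofReal (∫ t in (0:ℝ)..2*π/3, widthDensity t) := by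
  rw [lintegral_homogeneous (measurable_supportA.indicator hS) (fun x t ht => ?_)
    (Set.indicator_nonneg fun x _ => le_trans (by positivity) (supportA_nonneg x)), ← lintegral_even_widthDensity]
  · refine lintegral_congr fun φ => ?_
    have hφ := neg_one_le_cos φ
    by_cases hq : 0 ≤ 1 + 2 * cos φ
    · have hq' : φ ∈ {φ : ℝ | 0 ≤ 1 + 2 * cos φ} := hq
      have hA : 0 ≤ 1 + cos φ / 2 := by linarith
      rw [Set.indicator_of_mem hq']
      have hae : ∀ᵐ ζ : ℝ, ζ ∉ ({√(1 + 2 * cos φ), -√(1 + 2 * cos φ)} : Set ℝ) :=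
        (show ({√(1 + 2 * cos φ), -√(1 + 2 * cos φ)} : Set ℝ).Finite by simp).countable.ae_notMem volume
      have hms : MeasurableSet {ζ : ℝ | ζ^2 ≤ 1 + 2 * cos φ} := measurableSet_le (by fun_prop) (by fun_prop)
      calc _ = ∫⁻ ζ : ℝ, {ζ : ℝ | ζ^2 ≤ 1 + 2 * cos φ}.indicator (fun ζ =>
            ENNReal.ofReal (1 + cos φ / 2) * ENNReal.ofReal (1 / (2 * (1 + ζ^2)^2))) ζ := by
            refine lintegral_congr_ae ?_
            filter_upwards [hae] with ζ hζ
            by_cases h : ζ^2 ≤ 1 + 2 * cos φ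
            · have h' : ζ^2 < 1 + 2 * cos φ := lt_of_le_of_ne h fun e => hζ <| by
                rw [Set.mem_insert_iff, Set.mem_singleton_iff, ← abs_eq (sqrt_nonneg _), ← e, sqrt_sq_eq_abs]
              have hm : ζ ∈ {ζ : ℝ | ζ^2 ≤ 1 + 2 * cos φ} := h
              rw [Set.indicator_of_mem hm, Set.indicator_of_mem (hlt φ ζ h'), supportA_apply, ENNReal.ofReal_mul hA]
            · have hm : ζ ∉ {ζ : ℝ | ζ^2 ≤ 1 + 2 * cos φ} := h
              rw [Set.indicator_of_notMem hm, Set.indicator_of_notMem (fun hh => h (hle φ ζ hh)), zero_mul,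
                ENNReal.ofReal_zero]
        _ = _ := by
            rw [lintegral_indicator hms, lintegral_const_mul' _ _ ENNReal.ofReal_ne_top, lintegral_arctan hq,
              ← ENNReal.ofReal_mul hA, widthDensity]
            congr 1
            rw [show 1 + (1 + 2 * cos φ) = 2 * (1 + cos φ) by ring]
            ring
    · have hq' : φ ∉ {φ : ℝ | 0 ≤ 1 + 2 * cos φ} := hq
      rw [Set.indicator_of_notMem hq', ← lintegral_zero (μ := (volume : Measure ℝ))]
      refine lintegral_congr fun ζ => ?_
      rw [Set.indicator_of_notMem fun h => hq ((sq_nonneg ζ).trans (hle φ ζ h)), zero_mul, ENNReal.ofReal_zero]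
  · by_cases h : x ∈ S
    · rw [Set.indicator_of_mem h, Set.indicator_of_mem ((hom x t ht).2 h), supportA_smul x t ht]
    · rw [Set.indicator_of_notMem h, Set.indicator_of_notMem (mt (hom x t ht).1 h), mul_zero]

lemma lintegral_supportO : ∫⁻ v : E3, ENNReal.ofReal (supportO v * exp (-‖v‖^2)) =
    ENNReal.ofReal (2 * ∫ t in (0:ℝ)..2*π/3, widthDensity t) := by
  set S : Set E3 := {v | supportB v ≤ supportA v} with hS
  set S' : Set E3 := {v | supportB v < supportA v} with hS'
  have mS : MeasurableSet S := measurableSet_le measurable_supportB measurable_supportA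
  have mS' : MeasurableSet S' := measurableSet_lt measurable_supportB measurable_supportA
  have mA := measurable_supportA
  have hI : ∫⁻ v, ENNReal.ofReal (S.indicator supportA v * exp (-‖v‖^2)) = ENNReal.ofReal (∫ t in (0:ℝ)..2*π/3, widthDensity t) :=
    lintegral_indicator_supportA mS (fun x t ht => by
      simp only [hS, Set.mem_ofPred_eq, supportA_smul x t ht, supportB_smul x t ht, mul_le_mul_iff_right₀ ht])
      (fun φ ζ h => (supportB_le_supportA_iff φ ζ).2 h.le) (fun φ ζ h => (supportB_le_supportA_iff φ ζ).1 h)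
  have hI' : ∫⁻ v, ENNReal.ofReal (S'.indicator supportA v * exp (-‖v‖^2)) = ENNReal.ofReal (∫ t in (0:ℝ)..2*π/3, widthDensity t) :=
    lintegral_indicator_supportA mS' (fun x t ht => by
      simp only [hS', Set.mem_ofPred_eq, supportA_smul x t ht, supportB_smul x t ht, mul_lt_mul_iff_right₀ ht])
      (fun φ ζ h => (supportB_lt_supportA_iff φ ζ).2 h) (fun φ ζ h => ((supportB_lt_supportA_iff φ ζ).1 h).le)
  have hm : Measurable fun v : E3 => ENNReal.ofReal (S'.indicator supportA v * exp (-‖v‖^2)) :=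
    ((mA.indicator mS').mul (by fun_prop)).ennreal_ofReal
  have hm2 : Measurable fun v : E3 => ENNReal.ofReal (S.indicator supportA v * exp (-‖v‖^2)) :=
    ((mA.indicator mS).mul (by fun_prop)).ennreal_ofReal
  rw [← measurePreserving_exchange.lintegral_comp hm] at hI'
  rw [two_mul, ENNReal.ofReal_add]
  · nth_rewrite 1 [← hI]
    rw [← hI', ← lintegral_add_left hm2]
    refine lintegral_congr fun v => ?_
    by_cases h : supportB v ≤ supportA v
    · have h1 : v ∈ S := h
      have h2 : exchange v ∉ S' := by simp [hS', supportA_exchange, supportB_exchange, h]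
      rw [Set.indicator_of_mem h1, Set.indicator_of_notMem h2, supportO, max_eq_left h, zero_mul, ENNReal.ofReal_zero, add_zero]
    · have h1 : v ∉ S := h
      have h2 : exchange v ∈ S' := by simpa [hS', supportA_exchange, supportB_exchange] using h
      rw [Set.indicator_of_notMem h1, Set.indicator_of_mem h2, supportA_exchange, norm_exchange, supportO,
        max_eq_right (le_of_not_ge h), zero_mul, ENNReal.ofReal_zero, zero_add]
  all_goals exact intervalIntegral.integral_nonneg (by positivity) fun t _ => widthDensity_nonneg

lemma pi_mul_meanSupport (ν : Measure SO3) [IsProbabilityMeasure ν] [ν.IsMulLeftInvariant] :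
    π * meanSupport ν = 3 * π^2 / 8 + 3 / 4 * ellipticK (√3 / 2) - constI := by
  have h := meanSupport_mul_lintegral ν
  have h0 : 0 ≤ meanSupport ν := (meanSupport_pos ν).le
  have h1 : 0 ≤ ∫ t in (0:ℝ)..2*π/3, widthDensity t :=
    intervalIntegral.integral_nonneg (by positivity) fun t _ => widthDensity_nonneg
  rw [lintegral_norm_mul_exp, lintegral_supportO, ← ENNReal.ofReal_mul h0,
    ENNReal.ofReal_eq_ofReal_iff (by positivity) (by positivity), integral_widthDensity] at h
  linarith

lemma lintegral_volume_inter_vadd {A B : Set E3} (hA : MeasurableSet A) (hB : MeasurableSet B) :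
    ∫⁻ x : E3, volume (A ∩ (fun p => p + x) '' B) = volume A * volume B := by
  have hm : Measurable fun p : E3 × E3 => A.indicator (1 : E3 → ENNReal) p.2 * B.indicator (1 : E3 → ENNReal) (p.2 - p.1) :=
    ((measurable_one.indicator hA).comp measurable_snd).mul
      ((measurable_one.indicator hB).comp (measurable_snd.sub measurable_fst))
  calc ∫⁻ x : E3, volume (A ∩ (fun p => p + x) '' B)
      = ∫⁻ x : E3, ∫⁻ p : E3, A.indicator (1 : E3 → ENNReal) p * B.indicator (1 : E3 → ENNReal) (p - x) := by
        refine lintegral_congr fun x => ?_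
        have e : (fun p => p + x) '' B = (fun p => p - x) ⁻¹' B := by
          ext p; simp [sub_eq_add_neg]
        have hB' : MeasurableSet ((fun p => p - x) ⁻¹' B) := (measurable_id.sub_const x) hB
        rw [e, ← lintegral_indicator_one (hA.inter hB')]
        refine lintegral_congr fun p => ?_
        rw [Set.inter_indicator_one, Pi.mul_apply]
        rfl
    _ = ∫⁻ p : E3, A.indicator (1 : E3 → ENNReal) p * volume B := by
        rw [lintegral_lintegral_swap hm.aemeasurable]
        refine lintegral_congr fun p => ?_
        have hp : Measurable fun x => B.indicator (1 : E3 → ENNReal) (p - x) :=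
          (measurable_one.indicator hB).comp (measurable_id.const_sub p)
        rw [lintegral_const_mul _ hp,
          lintegral_sub_left_eq_self (fun y => B.indicator (1 : E3 → ENNReal) y) p, lintegral_indicator_one hB]
    _ = _ := by rw [lintegral_mul_const _ (measurable_one.indicator hA), lintegral_indicator_one hA]

lemma moveSet_eq (θ : SO3) (x : E3) (S : Set E3) : moveSet θ x S = (fun p => p + x) '' (matCLM θ.1 '' S) := by
  rw [moveSet, Set.image_image]; rfl

lemma SO3.transpose_mul (θ : SO3) : θ.1.transpose * θ.1 = 1 := by
  have := negMat_transpose_mul θ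
  simpa [negMat] using this

lemma measurableSet_oloid : MeasurableSet oloid := isCompact_oloid.isClosed.measurableSet

lemma moveSet_smul {r : ℝ} (θ : SO3) (x : E3) (S : Set E3) : moveSet θ (r • x) (r • S) = r • moveSet θ x S := by
  rw [moveSet_eq, moveSet_eq]
  ext p
  simp only [Set.mem_image, Set.mem_smul_set, exists_exists_and_eq_and, map_smul, smul_add]

lemma volume_smul_E3 {r : ℝ} (hr : 0 < r) (S : Set E3) : volume (r • S) = ENNReal.ofReal (r^3) * volume S := by
  rw [Measure.addHaar_smul, finrank_euclideanSpace_fin, abs_of_pos (by positivity)]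

lemma hitting_set_smul {r : ℝ} (hr : 0 < r) (θ : SO3) :
    {x : E3 | (oloidR r ∩ moveSet θ x (oloidR r)).Nonempty} = r • {x : E3 | (oloid ∩ moveSet θ x oloid).Nonempty} := by
  ext x
  rw [Set.mem_smul_set_iff_inv_smul_mem₀ hr.ne', Set.mem_ofPred_eq, Set.mem_ofPred_eq, oloidR]
  nth_rewrite 1 [← smul_inv_smul₀ hr.ne' x]
  rw [moveSet_smul, ← Set.smul_set_inter₀ hr.ne', Set.smul_set_nonempty]

lemma ellipticK_nonneg (k : ℝ) : 0 ≤ ellipticK k :=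
  intervalIntegral.integral_nonneg (by positivity) fun _ _ => by positivity

lemma ellipticE_nonneg (k : ℝ) : 0 ≤ ellipticE k :=
  intervalIntegral.integral_nonneg (by positivity) fun _ _ => by positivity

lemma lintegral_volume_inter {r : ℝ} (hr : 0 < r) (θ : SO3) :
    ∫⁻ x : E3, volume (oloidR r ∩ moveSet θ x (oloidR r)) =
      ENNReal.ofReal ((r^3 * (2/3 * (2 * ellipticE (√3/2) + ellipticK (√3/2))))^2) := by
  have hm : MeasurableSet (oloidR r) := measurableSet_oloid.const_smul₀ r
  have hE := ellipticE_nonneg (√3/2)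
  have hK := ellipticK_nonneg (√3/2)
  have he := measurableEmbedding_matCLM (SO3.transpose_mul θ)
  have hp := measurePreserving_matCLM (SO3.transpose_mul θ)
  simp only [moveSet_eq]
  rw [lintegral_volume_inter_vadd hm (he.measurableSet_image.2 hm), ← hp.measure_preimage_emb he (matCLM θ.1 '' _),
    Set.preimage_image_eq _ he.injective, oloidR, volume_smul_E3 hr, volume_oloid, ← ENNReal.ofReal_mul (by positivity),
    ← ENNReal.ofReal_mul (by positivity), sq]

lemma lintegral_volume_hitting {r : ℝ} (hr : 0 < r) (ν : Measure SO3) [IsProbabilityMeasure ν] [ν.IsMulLeftInvariant] :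
    ∃ D : ℝ, 0 < D ∧ 9 * π^2 + 8 * ellipticE (√3/2) + 22 * ellipticK (√3/2) - 24 * constI = 3 * D ∧
    ∫⁻ θ : SO3, volume {x : E3 | (oloidR r ∩ moveSet θ x (oloidR r)).Nonempty} ∂ν = ENNReal.ofReal (r^3 * D) := by
  obtain ⟨g, H, hp, hs⟩ := exists_potential_oloid
  have hE := ellipticE_nonneg (√3/2)
  have hK := ellipticK_nonneg (√3/2)
  have hM := meanSupport_pos ν
  have hV : 0 ≤ 2/3 * (2 * ellipticE (√3/2) + ellipticK (√3/2)) := by positivity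
  refine ⟨2 * (2/3 * (2 * ellipticE (√3/2) + ellipticK (√3/2))) + 2 * (4 * π * meanSupport ν), by positivity, ?_, ?_⟩
  · linear_combination (-24) * pi_mul_meanSupport ν
  · simp only [hitting_set_smul hr, volume_smul_E3 hr]
    rw [lintegral_const_mul' _ _ ENNReal.ofReal_ne_top, lintegral_hitting hp hs ν, lintegral_mixedVol_eq ν hp hs, volume_oloid,
      ← ENNReal.ofReal_ofNat 2, ← ENNReal.ofReal_mul zero_le_two, ← ENNReal.ofReal_mul zero_le_two,
      ← ENNReal.ofReal_add (by positivity) (by positivity), ← ENNReal.ofReal_mul (by positivity)]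

/-- The expected volume of the intersection of a fixed oloid `Ω_r` and a uniformly moving
congruent oloid in hitting position:
`(∫_{SO(3)} ∫_{ℝ³} vol(Ω_r ∩ (θ·Ω_r + x)) dλ(x) dν(θ)) / (∫_{SO(3)} λ{x : Ω_r ∩ (θ·Ω_r + x) ≠ ∅} dν(θ))
  = 4·[2E(√3/2) + K(√3/2)]²·r³ / (3·[9π² + 8E(√3/2) + 22K(√3/2) − 24I])`. -/
theorem expected_volume_oloid_oloid (r : ℝ) (hr : 0 < r)
    (ν : Measure SO3) [IsProbabilityMeasure ν] [ν.IsMulLeftInvariant] :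
    (∫⁻ θ : SO3, ∫⁻ x : EuclideanSpace ℝ (Fin 3),
        volume (oloidR r ∩ moveSet θ x (oloidR r)) ∂volume ∂ν) /
      (∫⁻ θ : SO3, volume {x : EuclideanSpace ℝ (Fin 3) |
        (oloidR r ∩ moveSet θ x (oloidR r)).Nonempty} ∂ν) =
      ENNReal.ofReal
        (4 * (2 * ellipticE (Real.sqrt 3 / 2) + ellipticK (Real.sqrt 3 / 2)) ^ 2 * r ^ 3 /
          (3 * (9 * π ^ 2 + 8 * ellipticE (Real.sqrt 3 / 2)
            + 22 * ellipticK (Real.sqrt 3 / 2) - 24 * constI))) := by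
  obtain ⟨D, hD, hD', hden⟩ := lintegral_volume_hitting hr ν
  rw [hden, hD']
  simp only [lintegral_volume_inter hr]
  rw [lintegral_const, measure_univ, mul_one, ← ENNReal.ofReal_div_of_pos (by positivity)]
  congr 1
  field_simp
  ring
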